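/- arXiv:0708.3257 — 2 statements merged into one kernel-verified Lean document; each statement's English description precedes it below -/
import Mathlib

section
/- Fix an even integer q = 2p with p ≥ 2 and let λ = 2·cos(π/q). For Lebesgue-almost every x ∈ [−λ/2, λ/2) and every integer k ≥ 1, the limit lim_{N→∞} (1/N)·#{ 1 ≤ j ≤ N : min{Θ_{j−1}(x), Θ_j(x), …, Θ_{j+k(p−1)}(x)} > 1/2 and Θ_{j+k(p−1)+1}(x) < 1/2 } exists and equals ν(A_{k−1}) − ν(A_k). -/
noncomputable section

open Real Filter Topology MeasureTheory
open scoped Classical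

namespace RosenTong

/-- `λ_q = 2 cos(π/q)`. -/
def lam (q : ℕ) : ℝ := 2 * Real.cos (Real.pi / q)

/-- The Rosen map `f_q` on `[-λ/2, λ/2)`. -/
def f (l : ℝ) (x : ℝ) : ℝ :=
  if x = 0 then 0 else 1 / |x| - l * (⌊1 / (l * |x|) + 1 / 2⌋ : ℝ)

/-- `x` is `G_q`-irrational: its Rosen orbit never hits `0`. -/
def Irr (l : ℝ) (x : ℝ) : Prop := ∀ n : ℕ, (f l)^[n] x ≠ 0

/-- `ε_n = sign (f^{n-1} x)` (for `n ≥ 1`). -/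
def eps (l x : ℝ) (n : ℕ) : ℝ := Real.sign ((f l)^[n - 1] x)

/-- `r_n = ⌊1/(λ |f^{n-1} x|) + 1/2⌋` (for `n ≥ 1`), as a real number. -/
def rr (l x : ℝ) (n : ℕ) : ℝ := (⌊1 / (l * |(f l)^[n - 1] x|) + 1 / 2⌋ : ℝ)

/-- `((R_{n-1}, R_n), (S_{n-1}, S_n))`. -/
def RS (l x : ℝ) : ℕ → (ℝ × ℝ) × (ℝ × ℝ)
  | 0 => ((1, 0), (0, 1))
  | n + 1 =>
      (((RS l x n).1.2, rr l x (n + 1) * l * (RS l x n).1.2 + eps l x (n + 1) * (RS l x n).1.1),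
       ((RS l x n).2.2, rr l x (n + 1) * l * (RS l x n).2.2 + eps l x (n + 1) * (RS l x n).2.1))

/-- Numerator `R_n` of the `n`-th Rosen convergent. -/
def Rnum (l x : ℝ) (n : ℕ) : ℝ := (RS l x n).1.2

/-- Denominator `S_n` of the `n`-th Rosen convergent. -/
def Snum (l x : ℝ) (n : ℕ) : ℝ := (RS l x n).2.2

/-- The approximation coefficient `Θ_n = S_n² |x - R_n/S_n|`. -/
def theta (l x : ℝ) (n : ℕ) : ℝ := (Snum l x n) ^ 2 * |x - Rnum l x n / Snum l x n|

/-- The natural extension map `𝒯(x,y) = (f x, 1/(r(x)λ + ε(x) y))`. -/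
def T (l : ℝ) (z : ℝ × ℝ) : ℝ × ℝ :=
  (f l z.1, 1 / ((⌊1 / (l * |z.1|) + 1 / 2⌋ : ℝ) * l + Real.sign z.1 * z.2))

/-- `(t_n, v_n) = 𝒯^n (x, 0)`. -/
def tv (l x : ℝ) (n : ℕ) : ℝ × ℝ := (T l)^[n] (x, 0)

/-- `G(y) = -1/(λ + y)`. -/
def G (l : ℝ) (y : ℝ) : ℝ := -1 / (l + y)

/-- `C(y) = -1/(2λ + y)`. -/
def CC (l : ℝ) (y : ℝ) : ℝ := -1 / (2 * l + y)

/-- `τ_k` in the even case `q = 2p`. -/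
def tauE (l : ℝ) (p : ℕ) : ℕ → ℝ
  | 0 => -2 / (3 * l)
  | k + 1 => -1 / (2 * l + (G l)^[p - 2] (tauE l p k))

/-- `τ_k` in the odd case `q = 2h+3`. -/
def tauO (l : ℝ) (h : ℕ) : ℕ → ℝ
  | 0 => -2 / (3 * l)
  | k + 1 => CC l ((G l)^[h] (CC l ((G l)^[h - 1] (tauO l h k))))

/-- `φ_j = f^j(-λ/2)`. -/
def phi (l : ℝ) (j : ℕ) : ℝ := (f l)^[j] (-(l / 2))

/-- The heights `L_j` in the even case: `L_1 = 1/(λ+1)`, `L_j = 1/(λ - L_{j-1})`. -/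
def LE (l : ℝ) : ℕ → ℝ
  | 0 => 0
  | 1 => 1 / (l + 1)
  | j + 2 => 1 / (l - LE l (j + 1))

/-- The natural extension domain `Ω` in the even case `q = 2p`. -/
def OmegaE (l : ℝ) (p : ℕ) : Set (ℝ × ℝ) :=
  (⋃ j ∈ Finset.Icc 1 (p - 1),
    (Set.Ico (phi l (j - 1)) (phi l j)) ×ˢ (Set.Icc 0 (LE l j)))
  ∪ (Set.Ico (0 : ℝ) (l / 2)) ×ˢ (Set.Icc (0 : ℝ) 1)

/-- The region `D` (even case): both `Θ_{n-1}` and `Θ_n` exceed `1/2`. -/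
def DE (l : ℝ) (p : ℕ) : Set (ℝ × ℝ) :=
  {z ∈ OmegaE l p | z.2 / (1 + z.1 * z.2) > 1 / 2 ∧ |z.1| / (1 + z.1 * z.2) > 1 / 2}

/-- The region `A = {(t,v) ∈ D : -2/(3λ) ≤ t ≤ -1/(λ+1)}`. -/
def AE (l : ℝ) (p : ℕ) : Set (ℝ × ℝ) :=
  {z ∈ DE l p | -2 / (3 * l) ≤ z.1 ∧ z.1 ≤ -1 / (l + 1)}

/-- `A_k = {(t,v) ∈ A : t ≥ τ_k}`. -/
def AEk (l : ℝ) (p k : ℕ) : Set (ℝ × ℝ) :=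
  {z ∈ AE l p | tauE l p k ≤ z.1}

/-- The invariant measure `ν` (even case), with density `C_q/(1+tv)²` on `Ω`. -/
def nuE (q p : ℕ) : Measure (ℝ × ℝ) :=
  (volume.restrict (OmegaE (lam q) p)).withDensity fun z =>
    ENNReal.ofReal
      ((1 / Real.log ((1 + Real.cos (Real.pi / q)) / Real.sin (Real.pi / q))) /
        (1 + z.1 * z.2) ^ 2)

/-- The Hurwitz constant `H_q` for odd `q`. -/
def Hodd (l : ℝ) : ℝ := 1 / (2 * Real.sqrt ((1 - l / 2) ^ 2 + 1) )

/-- The positive root `R` of `R² + (2-λ)R - 1 = 0` (odd case). -/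
def Rodd (l : ℝ) : ℝ := (l - 2 + Real.sqrt ((2 - l) ^ 2 + 4)) / 2

section Birkhoff

variable {α : Type*} {U : α → α} {g : α → ℝ}

/-- The running maximum of `0` and the Birkhoff sums of `g` up to time `n`. -/
def birkhoffMax (U : α → α) (g : α → ℝ) : ℕ → α → ℝ
  | 0, _ => 0
  | n + 1, x => max 0 (g x + birkhoffMax U g n (U x))

lemma birkhoffSum_le_birkhoffMax (n : ℕ) (x : α) :
    birkhoffSum U g n x ≤ birkhoffMax U g n x := by
  induction n generalizing x with
  | zero => simp [birkhoffMax]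
  | succ n ih =>
    rw [birkhoffSum_succ', birkhoffMax]
    exact le_max_of_le_right (by linarith [ih (U x)])

lemma birkhoffMax_le_succ (n : ℕ) (x : α) :
    birkhoffMax U g n x ≤ birkhoffMax U g (n + 1) x := by
  induction n generalizing x with
  | zero => simp [birkhoffMax]
  | succ n ih =>
    rw [birkhoffMax, birkhoffMax]
    exact max_le_max le_rfl (by linarith [ih (U x)])

variable [MeasurableSpace α] {μ : Measure α}

lemma measurable_birkhoffMax (hU : Measurable U) (hg : Measurable g) (n : ℕ) :
    Measurable (birkhoffMax U g n) := by
  induction n with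
  | zero => exact measurable_const
  | succ n ih => exact measurable_const.max (hg.add (ih.comp hU))

lemma integrable_birkhoffMax [IsFiniteMeasure μ] (hU : MeasurePreserving U μ μ)
    (hg : Integrable g μ) (n : ℕ) : Integrable (birkhoffMax U g n) μ := by
  induction n with
  | zero => exact integrable_const 0
  | succ n ih =>
    exact (integrable_const (0 : ℝ)).sup (hg.add (hU.integrable_comp_of_integrable ih))

/-- If an ergodic average is negative, then almost every sequence of Birkhoff sums is bounded
above. -/
lemma ae_bddAbove_birkhoffMax [IsProbabilityMeasure μ] (hU : Ergodic U μ)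
    (hgm : Measurable g) (hg : Integrable g μ) (hneg : ∫ x, g x ∂μ < 0) :
    ∀ᵐ x ∂μ, ∃ C : ℕ, ∀ n, birkhoffMax U g n x ≤ C := by
  set B : Set α := {x | ∃ C : ℕ, ∀ n, birkhoffMax U g n x ≤ C} with hB
  have hBm : MeasurableSet B := by
    have : B = ⋃ C : ℕ, ⋂ n, {x | birkhoffMax U g n x ≤ C} := by
      ext x; simp [hB]
    rw [this]
    exact MeasurableSet.iUnion fun C => MeasurableSet.iInter fun n =>
      measurableSet_le (measurable_birkhoffMax hU.measurable hgm n) measurable_const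
  have hinv : U ⁻¹' B = B := by
    ext x
    constructor
    · rintro ⟨C, hC⟩
      obtain ⟨K, hK⟩ := exists_nat_ge (max 0 (g x + C))
      refine ⟨K, fun n => ?_⟩
      cases n with
      | zero => simp [birkhoffMax]
      | succ n =>
        rw [birkhoffMax]
        exact (max_le_max le_rfl (by linarith [hC n])).trans hK
    · rintro ⟨C, hC⟩
      obtain ⟨K, hK⟩ := exists_nat_ge (C - g x)
      refine ⟨K, fun n => ?_⟩
      have := hC (n + 1)
      rw [birkhoffMax] at this
      linarith [le_max_right 0 (g x + birkhoffMax U g n (U x))]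
  rcases hU.toPreErgodic.ae_mem_or_ae_notMem hBm hinv with h | h
  · exact h
  exfalso
  have key : ∀ n, 0 ≤ ∫ x, max (-birkhoffMax U g n (U x)) (g x) ∂μ := by
    intro n
    have hM := integrable_birkhoffMax hU.toMeasurePreserving hg
    have hMU := hU.toMeasurePreserving.integrable_comp_of_integrable (hM n)
    have h1 : ∀ x, max (-birkhoffMax U g n (U x)) (g x)
        = birkhoffMax U g (n + 1) x - (birkhoffMax U g n ∘ U) x := by
      intro x
      rw [birkhoffMax, Function.comp, ← max_sub_sub_right]
      congr 1 <;> ring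
    simp_rw [h1]
    rw [integral_sub (hM _) hMU]
    have h2 : ∫ x, (birkhoffMax U g n ∘ U) x ∂μ = ∫ x, birkhoffMax U g n x ∂μ := by
      have := integral_map (μ := μ) hU.measurable.aemeasurable
        (f := birkhoffMax U g n)
        (measurable_birkhoffMax hU.measurable hgm n).aestronglyMeasurable
      rw [hU.map_eq] at this
      exact this.symm
    rw [h2, sub_nonneg]
    exact integral_mono (hM _) (hM _) (birkhoffMax_le_succ n)
  have hlim : Tendsto (fun n => ∫ x, max (-birkhoffMax U g n (U x)) (g x) ∂μ) atTop
      (𝓝 (∫ x, g x ∂μ)) := by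
    refine tendsto_integral_of_dominated_convergence (fun x => |g x|) ?_ hg.abs ?_ ?_
    · intro n
      exact (((measurable_birkhoffMax hU.measurable hgm n).comp
        hU.measurable).neg.max hgm).aestronglyMeasurable
    · intro n
      filter_upwards with x
      have h0 : 0 ≤ birkhoffMax U g n (U x) := by
        cases n with
        | zero => simp [birkhoffMax]
        | succ n => exact le_max_left _ _
      rw [Real.norm_eq_abs, abs_le]
      constructor
      · exact (neg_abs_le _).trans (le_max_right _ _)
      · exact max_le (by linarith [abs_nonneg (g x)]) (le_abs_self _)
    · filter_upwards [h] with x hx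
      have hx' : U x ∉ B := by
        rw [← hinv] at hx; exact hx
      have hx2 : ∃ n, -g x < birkhoffMax U g n (U x) := by
        by_contra! hc
        obtain ⟨K, hK⟩ := exists_nat_ge (-g x)
        exact hx' ⟨K, fun n => (hc n).trans hK⟩
      obtain ⟨n, hn⟩ := hx2
      refine tendsto_const_nhds.congr' ?_
      filter_upwards [eventually_ge_atTop n] with m hm
      have := monotone_nat_of_le_succ (f := fun n => birkhoffMax U g n (U x))
        (fun n => birkhoffMax_le_succ n (U x)) hm
      simp only at this
      rw [max_eq_right]
      linarith
  exact absurd (ge_of_tendsto' hlim key) (not_le.mpr hneg)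

lemma ae_eventually_birkhoffSum_le [IsProbabilityMeasure μ] (hU : Ergodic U μ)
    (hgm : Measurable g) (hg : Integrable g μ) {ε : ℝ} (hε : 0 < ε) :
    ∀ᵐ x ∂μ, ∀ᶠ n : ℕ in atTop, birkhoffSum U g n x / n ≤ ∫ y, g y ∂μ + ε := by
  set I := ∫ y, g y ∂μ with hI
  have h1 : ∫ y, (g y - (I + ε / 2)) ∂μ < 0 := by
    rw [integral_sub hg (integrable_const _)]
    simp
    linarith
  filter_upwards [ae_bddAbove_birkhoffMax (g := fun y => g y - (I + ε / 2)) hU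
    (hgm.sub_const _) (hg.sub (integrable_const _)) h1] with x ⟨C, hC⟩
  obtain ⟨K, hK⟩ := exists_nat_ge (2 * C / ε)
  filter_upwards [eventually_ge_atTop (K + 1)] with n hn
  have hn0 : (0 : ℝ) < n := by exact_mod_cast (by lia : 0 < n)
  have h2 := (birkhoffSum_le_birkhoffMax (U := U) (g := fun y => g y - (I + ε / 2)) n x).trans
    (hC n)
  have h3 : birkhoffSum U (fun y => g y - (I + ε / 2)) n x
      = birkhoffSum U g n x - n * (I + ε / 2) := by
    simp [birkhoffSum, Finset.sum_sub_distrib]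
    ring
  rw [h3] at h2
  rw [div_le_iff₀ hn0]
  have h4 : (K : ℝ) ≤ n := by exact_mod_cast (by lia : K ≤ n)
  rw [div_le_iff₀ hε] at hK
  nlinarith

/-- Birkhoff's pointwise ergodic theorem for an ergodic probability-preserving map. -/
theorem ae_tendsto_birkhoffSum_div [IsProbabilityMeasure μ] (hU : Ergodic U μ)
    (hgm : Measurable g) (hg : Integrable g μ) :
    ∀ᵐ x ∂μ, Tendsto (fun n : ℕ => birkhoffSum U g n x / n) atTop (𝓝 (∫ y, g y ∂μ)) := by
  have hu : ∀ k : ℕ, (0 : ℝ) < 1 / ((k : ℝ) + 1) := fun k => Nat.one_div_pos_of_nat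
  have h1 := ae_all_iff.mpr fun k : ℕ => ae_eventually_birkhoffSum_le hU hgm hg (hu k)
  have h2 := ae_all_iff.mpr fun k : ℕ =>
    ae_eventually_birkhoffSum_le (g := fun y => -g y) hU hgm.neg hg.neg (hu k)
  filter_upwards [h1, h2] with x hx1 hx2
  rw [Metric.tendsto_atTop']
  intro ε hε
  obtain ⟨k, hk⟩ := exists_nat_one_div_lt hε
  obtain ⟨N, hN⟩ := ((hx1 k).and (hx2 k)).exists_forall_of_atTop
  refine ⟨N, fun n hn => ?_⟩
  obtain ⟨ha, hb⟩ := hN n hn.le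
  have h3 : birkhoffSum U (fun y => -g y) n x = -birkhoffSum U g n x := by
    simp [birkhoffSum]
  rw [h3, integral_neg, neg_div] at hb
  rw [Real.dist_eq, abs_lt]
  constructor <;> linarith

end Birkhoff

section Hopf

/-- Hopf's argument: an almost invariant set is saturated, up to a null set, under any relation
whose classes are uniformly contracted by the dynamics. -/
theorem exists_ae_saturated {μ : Measure (ℝ × ℝ)} [IsFiniteMeasure μ] {U : ℝ × ℝ → ℝ × ℝ}
    (hU : MeasurePreserving U μ μ) {E : Set (ℝ × ℝ)} (hE : MeasurableSet E)
    (hinv : ∀ᵐ z ∂μ, U z ∈ E ↔ z ∈ E) {R : ℝ × ℝ → ℝ × ℝ → Prop} {W : Set (ℝ × ℝ)}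
    (hW : ∀ᵐ z ∂μ, z ∈ W) {b : ℕ → ℝ} (hb : Tendsto b atTop (𝓝 0))
    (hR : ∀ z ∈ W, ∀ w ∈ W, R z w → ∀ n, dist (U^[n] z) (U^[n] w) ≤ b n) :
    ∃ Z : Set (ℝ × ℝ), (∀ᵐ z ∂μ, z ∈ Z) ∧ ∀ z ∈ Z, ∀ w ∈ Z, R z w → (z ∈ E ↔ w ∈ E) := by
  set h : ℝ × ℝ → ℝ := E.indicator 1 with hh
  have hhi : Integrable h μ := (integrable_const (1 : ℝ)).indicator hE
  have hhinv : ∀ n : ℕ, ∀ᵐ z ∂μ, h (U^[n] z) = h z := by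
    intro n
    induction n with
    | zero => simp
    | succ n ih =>
      filter_upwards [hU.quasiMeasurePreserving.ae ih, hinv] with z hz hz'
      rw [Function.iterate_succ_apply, hz]
      simp [hh, Set.indicator_apply, hz']
  have happrox : ∀ k : ℕ, ∃ g : ℝ × ℝ → ℝ, Continuous g ∧ HasCompactSupport g ∧
      eLpNorm (h - g) 1 μ ≤ ENNReal.ofReal (1 / ((k : ℝ) + 1)) := by
    intro k
    obtain ⟨g, hg1, hg2, hg3, -⟩ :=
      (memLp_one_iff_integrable.mpr hhi).exists_hasCompactSupport_eLpNorm_sub_le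
      (p := 1) ENNReal.one_ne_top (ε := ENNReal.ofReal (1 / ((k : ℝ) + 1)))
      (by simpa using (by positivity : (0 : ℝ) < (k : ℝ) + 1))
    exact ⟨g, hg3, hg1, hg2⟩
  choose g hgc hgs hgE using happrox
  have hosc : ∀ k : ℕ, ∃ n : ℕ, ∀ z ∈ W, ∀ w ∈ W, R z w →
      dist (g k (U^[n] z)) (g k (U^[n] w)) < 1 / ((k : ℝ) + 1) := by
    intro k
    have huc := (hgs k).uniformContinuous_of_continuous (hgc k)
    obtain ⟨δ, hδ, H⟩ := Metric.uniformContinuous_iff.mp huc (1 / ((k : ℝ) + 1))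
      Nat.one_div_pos_of_nat
    obtain ⟨n, hn⟩ := (hb.eventually (gt_mem_nhds hδ)).exists
    exact ⟨n, fun z hz w hw hzw => H ((hR z hz w hw hzw n).trans_lt hn)⟩
  choose m hm using hosc
  set F : ℕ → ℝ × ℝ → ℝ := fun k z => g k (U^[m k] z) with hF
  have hFm : ∀ k, Measurable (F k) := fun k =>
    (hgc k).measurable.comp (hU.measurable.iterate _)
  have hFE : ∀ k, eLpNorm (F k - h) 1 μ ≤ ENNReal.ofReal (1 / ((k : ℝ) + 1)) := by
    intro k
    have h1 : eLpNorm (F k - h) 1 μ = eLpNorm ((h - g k) ∘ U^[m k]) 1 μ := by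
      rw [← eLpNorm_neg]
      refine eLpNorm_congr_ae ?_
      filter_upwards [hhinv (m k)] with z hz
      simp [hF, hz]
    rw [h1, eLpNorm_comp_measurePreserving _ (hU.iterate _)]
    · exact hgE k
    · exact ((measurable_one.indicator hE).sub (hgc k).measurable).aestronglyMeasurable
  have hlim : Tendsto (fun k => eLpNorm (F k - h) 1 μ) atTop (𝓝 0) := by
    refine tendsto_of_tendsto_of_tendsto_of_le_of_le tendsto_const_nhds ?_
      (fun _ => zero_le) hFE
    have := ENNReal.tendsto_ofReal (tendsto_one_div_add_atTop_nhds_zero_nat (𝕜 := ℝ))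
    simpa using this
  obtain ⟨ns, hns, hlim'⟩ := (tendstoInMeasure_of_tendsto_eLpNorm one_ne_zero
    (fun k => (hFm k).aestronglyMeasurable)
    (measurable_one.indicator hE).aestronglyMeasurable hlim).exists_seq_tendsto_ae
  refine ⟨{z | z ∈ W ∧ Tendsto (fun i => F (ns i) z) atTop (𝓝 (h z))}, ?_, ?_⟩
  · filter_upwards [hW, hlim'] with z h1 h2 using ⟨h1, h2⟩
  rintro z ⟨hzW, hz⟩ w ⟨hwW, hw⟩ hzw
  have h1 : Tendsto (fun i => dist (F (ns i) z) (F (ns i) w)) atTop (𝓝 (dist (h z) (h w))) :=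
    hz.dist hw
  have h2 : Tendsto (fun i => dist (F (ns i) z) (F (ns i) w)) atTop (𝓝 0) := by
    refine squeeze_zero (fun _ => dist_nonneg) (fun i => (hm (ns i) z hzW w hwW hzw).le) ?_
    exact (tendsto_one_div_add_atTop_nhds_zero_nat (𝕜 := ℝ)).comp hns.tendsto_atTop
  have h3 : h z = h w := dist_eq_zero.mp (tendsto_nhds_unique h1 h2)
  by_cases hzE : z ∈ E <;> by_cases hwE : w ∈ E <;> simp_all

end Hopf

section Geometry

/-- The Rosen digit `r(t)` as an integer. -/
def digit (l t : ℝ) : ℤ := ⌊1 / (l * |t|) + 1 / 2⌋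

lemma f_eq_digit {l t : ℝ} (ht : t ≠ 0) : f l t = 1 / |t| - l * digit l t := by
  rw [f, if_neg ht, digit]

lemma f_mem_Ico {l t : ℝ} (hl : 0 < l) (ht : t ≠ 0) :
    f l t ∈ Set.Ico (-(l / 2)) (l / 2) := by
  rw [f_eq_digit ht, digit]
  have h0 : 0 < |t| := abs_pos.mpr ht
  have h1 := Int.floor_le (1 / (l * |t|) + 1 / 2)
  have h2 := Int.lt_floor_add_one (1 / (l * |t|) + 1 / 2)
  have h3 : 1 / |t| = l * (1 / (l * |t|)) := by field_simp
  rw [h3]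
  constructor <;> nlinarith

lemma one_le_digit {l t : ℝ} (hl : 0 < l) (hl2 : l < 2) (ht : t ≠ 0) (htl : |t| ≤ l / 2) :
    1 ≤ digit l t := by
  rw [digit, Int.le_floor]
  have h0 : 0 < |t| := abs_pos.mpr ht
  have : (1 : ℝ) / 2 ≤ 1 / (l * |t|) := one_div_le_one_div_of_le (by positivity) (by nlinarith)
  push_cast
  linarith

lemma digit_eq_one {l t : ℝ} (hl : 0 < l) (hl2 : l < 2) (h1 : 2 / (3 * l) < |t|)
    (h2 : |t| ≤ l / 2) : digit l t = 1 := by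
  have ht : t ≠ 0 := by
    rintro rfl
    have : 0 < 2 / (3 * l) := by positivity
    simp at h1
    linarith
  refine le_antisymm ?_ (one_le_digit hl hl2 ht h2)
  have h0 : 0 < |t| := abs_pos.mpr ht
  rw [div_lt_iff₀ (by positivity)] at h1
  have : 1 / (l * |t|) < 3 / 2 := by
    rw [div_lt_iff₀ (by positivity)]; nlinarith
  rw [digit, ← Int.lt_add_one_iff, Int.floor_lt]
  push_cast
  linarith

/-- The analytic data about `λ = 2 cos (π / 2p)`, the orbit of the left endpoint and the heights of
the natural extension domain. -/
structure Geom (l : ℝ) (p : ℕ) : Prop where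
  two_le : 2 ≤ p
  sq : 2 ≤ l ^ 2
  pos : 0 < l
  lt_two : l < 2
  phi_zero : phi l 0 = -(l / 2)
  phi_succ : ∀ j, j + 2 ≤ p → phi l (j + 1) = -1 / phi l j - l
  phi_le : ∀ j, j + 2 ≤ p → phi l j ≤ -1 / l
  phi_pred_pred : phi l (p - 2) = -1 / l
  phi_pred : phi l (p - 1) = 0
  LE_nonneg : ∀ j, 1 ≤ j → j + 1 ≤ p → 0 < LE l j
  LE_lt_one : ∀ j, 1 ≤ j → j + 1 ≤ p → LE l j < 1
  LE_pred : LE l (p - 1) = l - 1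
  rotation : ∃ σ : ℝ, σ ^ 2 = 1 - l ^ 2 / 4 ∧ ∀ x : ℕ → ℝ, (∀ i, x (i + 2) = l * x (i + 1) - x i) →
    σ * x (p - 1) = l / 2 * x 1 - (l ^ 2 / 2 - 1) * x 0

lemma Geom.one_lt {l : ℝ} {p : ℕ} (h : Geom l p) : 1 < l := by nlinarith [h.sq, h.pos]

lemma LE_succ {l : ℝ} {j : ℕ} (hj : 1 ≤ j) : LE l (j + 1) = 1 / (l - LE l j) := by
  obtain ⟨i, rfl⟩ := Nat.exists_eq_add_of_le' hj
  rw [LE]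

section Trig

variable {p : ℕ} {θ : ℝ}

lemma theta_pos (hp : 2 ≤ p) (hθ : θ * p = π / 2) : 0 < θ := by
  have hp' : (2 : ℝ) ≤ p := by exact_mod_cast hp
  by_contra h
  nlinarith [pi_pos]

lemma cos_mul_pos (hp : 2 ≤ p) (hθ : θ * p = π / 2) {x : ℝ} (h0 : 0 ≤ x) (h1 : x < p) :
    0 < cos (x * θ) := by
  have := theta_pos hp hθ
  exact cos_pos_of_mem_Ioo ⟨by nlinarith [pi_pos], by nlinarith⟩

lemma sin_mul_pos (hp : 2 ≤ p) (hθ : θ * p = π / 2) {x : ℝ} (h0 : 0 < x) (h1 : x ≤ p) :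
    0 < sin (x * θ) := by
  have := theta_pos hp hθ
  exact sin_pos_of_pos_of_lt_pi (by positivity) (by nlinarith [pi_pos])

lemma cos_theta_lt_one (hp : 2 ≤ p) (hθ : θ * p = π / 2) : cos θ < 1 := by
  have hp' : (2 : ℝ) ≤ p := by exact_mod_cast hp
  have hθ0 := theta_pos hp hθ
  rw [← cos_zero]
  exact cos_lt_cos_of_nonneg_of_le_pi_div_two le_rfl (by nlinarith) hθ0

lemma cos_theta_pos (hp : 2 ≤ p) (hθ : θ * p = π / 2) : 0 < cos θ := by
  have hp' : (2 : ℝ) ≤ p := by exact_mod_cast hp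
  simpa using cos_mul_pos hp hθ zero_le_one (by linarith)

lemma two_mul_cos_mul (x : ℝ) :
    2 * cos θ * cos ((x + 1) * θ) = cos ((x + 2) * θ) + cos (x * θ) := by
  have h1 : (x + 2) * θ = (x + 1) * θ + θ := by ring
  have h2 : x * θ = (x + 1) * θ - θ := by ring
  rw [h1, h2, cos_add, cos_sub]; ring

lemma two_mul_cos_mul_sin (x : ℝ) :
    2 * cos θ * sin ((x + 1) * θ) = sin ((x + 2) * θ) + sin (x * θ) := by
  have h1 : (x + 2) * θ = (x + 1) * θ + θ := by ring
  have h2 : x * θ = (x + 1) * θ - θ := by ring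
  rw [h1, h2, sin_add, sin_sub]; ring

lemma phi_step (hp : 2 ≤ p) (hθ : θ * p = π / 2) {j : ℕ} (hj : j + 2 ≤ p)
    (h : phi (2 * cos θ) j = -(cos ((j + 1) * θ) / cos (j * θ))) :
    phi (2 * cos θ) j ≤ -1 / (2 * cos θ) ∧
      phi (2 * cos θ) (j + 1) = -1 / phi (2 * cos θ) j - 2 * cos θ := by
  have hp' : (2 : ℝ) ≤ p := by exact_mod_cast hp
  have hθ0 := theta_pos hp hθ
  have hc1 := cos_theta_pos hp hθ
  have hc2 := cos_theta_lt_one hp hθ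
  have hjp2 : (j : ℝ) + 2 ≤ p := by exact_mod_cast hj
  have hcj := cos_mul_pos hp hθ (x := j) (by positivity) (by linarith)
  have hc := cos_mul_pos hp hθ (x := j + 1) (by positivity) (by linarith)
  have hc' : 0 ≤ cos (((j : ℝ) + 2) * θ) :=
    cos_nonneg_of_mem_Icc ⟨by nlinarith [pi_pos], by nlinarith⟩
  have hsum := two_mul_cos_mul (θ := θ) j
  have hle : phi (2 * cos θ) j ≤ -1 / (2 * cos θ) := by
    rw [h, neg_div, neg_le_neg_iff, div_le_div_iff₀ (by positivity) hcj]
    linarith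
  have hge : -(2 * cos θ / 2) ≤ phi (2 * cos θ) j := by
    rw [h, neg_le_neg_iff, div_le_iff₀ hcj]
    have h1 : ((j : ℝ) + 1) * θ = j * θ + θ := by ring
    have h2 : 0 ≤ sin (j * θ) := sin_nonneg_of_nonneg_of_le_pi (by positivity)
      (by nlinarith [pi_pos])
    have h3 : 0 ≤ sin θ := sin_nonneg_of_nonneg_of_le_pi hθ0.le (by nlinarith [pi_pos])
    rw [h1, cos_add]
    nlinarith [mul_nonneg h2 h3]
  refine ⟨hle, ?_⟩
  have hneg : phi (2 * cos θ) j < 0 := hle.trans_lt (by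
    rw [neg_div]; exact neg_neg_of_pos (by positivity))
  rw [phi, Function.iterate_succ_apply', ← phi, f_eq_digit hneg.ne,
    digit_eq_one (by positivity) (by linarith), abs_of_neg hneg]
  · rw [neg_div, ← div_neg]; push_cast; ring
  · rw [abs_of_neg hneg]
    have : 2 / (3 * (2 * cos θ)) < 1 / (2 * cos θ) := by
      rw [div_lt_div_iff₀ (by positivity) (by positivity)]; linarith
    rw [neg_div] at hle
    linarith
  · rw [abs_of_neg hneg]; linarith

lemma phi_eq_cos_div (hp : 2 ≤ p) (hθ : θ * p = π / 2) {j : ℕ} (hj : j + 1 ≤ p) :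
    phi (2 * cos θ) j = -(cos ((j + 1) * θ) / cos (j * θ)) := by
  induction j with
  | zero => simp [phi]
  | succ j ih =>
    have hjp2 : (j : ℝ) + 2 ≤ p := by exact_mod_cast hj
    have h := ih (by lia)
    rw [(phi_step hp hθ hj h).2, h]
    have hcj := cos_mul_pos hp hθ (x := j) (by positivity) (by linarith)
    have hc := cos_mul_pos hp hθ (x := j + 1) (by positivity) (by linarith)
    have hsum := two_mul_cos_mul (θ := θ) j
    push_cast
    rw [show (j : ℝ) + 1 + 1 = j + 2 by ring]
    generalize cos (((j : ℝ) + 2) * θ) = a at *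
    generalize cos (((j : ℝ) + 1) * θ) = b at *
    generalize cos ((j : ℝ) * θ) = c at *
    field_simp
    linarith

lemma LE_eq_sin_div (hp : 2 ≤ p) (hθ : θ * p = π / 2) {j : ℕ} (hj : j + 2 ≤ p) :
    LE (2 * cos θ) (j + 1) = sin ((j + 1 / 2) * θ) / sin ((j + 1 / 2 + 1) * θ) := by
  induction j with
  | zero =>
    have hp' : (2 : ℝ) ≤ p := by exact_mod_cast hp
    have h1 := sin_mul_pos hp hθ (x := 1 / 2) (by norm_num) (by linarith)
    have h2 := sin_mul_pos hp hθ (x := 3 / 2) (by norm_num) (by linarith)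
    have h3 := cos_theta_pos hp hθ
    have h4 : sin (3 / 2 * θ) = sin (1 / 2 * θ) * (2 * cos θ + 1) := by
      rw [show 3 / 2 * θ = 3 * (1 / 2 * θ) by ring, show cos θ = cos (2 * (1 / 2 * θ)) by ring_nf,
        sin_three_mul, cos_two_mul, cos_sq']
      ring
    rw [LE, CharP.cast_eq_zero, zero_add, show (1 : ℝ) / 2 + 1 = 3 / 2 by norm_num, h4]
    generalize sin (1 / 2 * θ) = a at *
    field_simp
  | succ j ih =>
    have hjp : (j : ℝ) + 3 ≤ p := by exact_mod_cast hj
    have h1 := sin_mul_pos hp hθ (x := j + 1 / 2 + 1) (by positivity) (by linarith)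
    have h2 := sin_mul_pos hp hθ (x := j + 1 / 2 + 2) (by positivity) (by linarith)
    have h3 := two_mul_cos_mul_sin (θ := θ) (j + 1 / 2)
    rw [LE_succ (by lia), ih (by lia)]
    push_cast
    rw [show (j : ℝ) + 1 + 1 / 2 = j + 1 / 2 + 1 by ring,
      show (j : ℝ) + 1 / 2 + 1 + 1 = j + 1 / 2 + 2 by ring]
    have h4 : 2 * cos θ - sin ((j + 1 / 2) * θ) / sin ((j + 1 / 2 + 1) * θ)
        = sin ((j + 1 / 2 + 2) * θ) / sin ((j + 1 / 2 + 1) * θ) := by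
      generalize sin (((j : ℝ) + 1 / 2 + 2) * θ) = a at *
      generalize sin (((j : ℝ) + 1 / 2 + 1) * θ) = b at *
      generalize sin (((j : ℝ) + 1 / 2) * θ) = c at *
      field_simp
      linarith
    rw [h4, one_div_div]

lemma sin_mul_recurrence {x : ℕ → ℝ} (hx : ∀ i, x (i + 2) = 2 * cos θ * x (i + 1) - x i) (i : ℕ) :
    sin θ * x (i + 1) = sin ((i + 1) * θ) * x 1 - sin (i * θ) * x 0 ∧
      sin θ * x i = sin (i * θ) * x 1 - sin ((i - 1) * θ) * x 0 := by
  induction i with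
  | zero => simp
  | succ i ih =>
    obtain ⟨h1, h2⟩ := ih
    have h3 := two_mul_cos_mul_sin (θ := θ) i
    have h4 := two_mul_cos_mul_sin (θ := θ) (i - 1)
    push_cast
    rw [show (i : ℝ) - 1 + 1 = i by ring, show (i : ℝ) - 1 + 2 = i + 1 by ring] at h4
    rw [show (i : ℝ) + 1 + 1 = i + 2 by ring, show (i : ℝ) + 1 - 1 = i by ring]
    refine ⟨?_, h1⟩
    rw [hx]
    linear_combination (2 * cos θ) * h1 - h2 + x 1 * h3 - x 0 * h4

lemma geom_two_mul_cos (hp : 2 ≤ p) (hθ : θ * p = π / 2) : Geom (2 * cos θ) p := by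
  have hp' : (2 : ℝ) ≤ p := by exact_mod_cast hp
  have hθ0 := theta_pos hp hθ
  have hc1 := cos_theta_pos hp hθ
  have hc2 := cos_theta_lt_one hp hθ
  have hs1 := sin_mul_pos hp hθ (x := 1) (by norm_num) (by linarith)
  obtain ⟨m, rfl⟩ := Nat.exists_eq_add_of_le' hp
  push_cast at hθ
  have hcp : cos ((m + 2) * θ) = 0 := by rw [mul_comm, hθ, cos_pi_div_two]
  have hcp1 : cos ((m + 1) * θ) = sin θ := by
    rw [show ((m : ℝ) + 1) * θ = π / 2 - θ by linarith, cos_pi_div_two_sub]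
  have hcp2 : cos (m * θ) = 2 * cos θ * sin θ := by
    have := two_mul_cos_mul (θ := θ) m
    rw [hcp, hcp1] at this
    linarith
  refine ⟨hp, ?_, by positivity, by linarith, by simp [phi], fun j hj => ?_, fun j hj => ?_, ?_,
    ?_, fun j hj1 hj2 => ?_, fun j hj1 hj2 => ?_, ?_,
    sin θ, ?_, fun x hx => ?_⟩
  · have h1 : 0 ≤ cos (2 * θ) := by
      rcases hp'.eq_or_lt with h | h
      · exact cos_nonneg_of_mem_Icc ⟨by nlinarith [pi_pos], by push_cast at h; nlinarith⟩
      · exact (cos_mul_pos hp (by push_cast; exact hθ) (by norm_num) h).le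
    rw [cos_two_mul] at h1
    nlinarith
  · exact (phi_step hp (by push_cast; exact hθ) hj
      (phi_eq_cos_div hp (by push_cast; exact hθ) (by lia))).2
  · exact (phi_step hp (by push_cast; exact hθ) hj
      (phi_eq_cos_div hp (by push_cast; exact hθ) (by lia))).1
  · rw [show m + 2 - 2 = m by lia, phi_eq_cos_div hp (by push_cast; exact hθ) (by lia), hcp1, hcp2]
    rw [one_mul] at hs1
    field_simp
  · rw [show m + 2 - 1 = m + 1 by lia, phi_eq_cos_div hp (by push_cast; exact hθ) (by lia)]
    push_cast
    rw [show (m : ℝ) + 1 + 1 = m + 2 by ring, hcp]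
    simp
  · obtain ⟨i, rfl⟩ := Nat.exists_eq_add_of_le' hj1
    have hi : (i : ℝ) ≤ m := by exact_mod_cast (by lia : i ≤ m)
    rw [LE_eq_sin_div hp (by push_cast; exact hθ) (by lia)]
    exact div_pos (sin_mul_pos hp (by push_cast; exact hθ) (by positivity) (by push_cast; linarith))
      (sin_mul_pos hp (by push_cast; exact hθ) (by positivity) (by push_cast; linarith))
  · obtain ⟨i, rfl⟩ := Nat.exists_eq_add_of_le' hj1
    have hi : (i : ℝ) ≤ m := by exact_mod_cast (by lia : i ≤ m)
    rw [LE_eq_sin_div hp (by push_cast; exact hθ) (by lia), div_lt_one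
      (sin_mul_pos hp (by push_cast; exact hθ) (by positivity) (by push_cast; linarith))]
    exact sin_lt_sin_of_lt_of_le_pi_div_two (by nlinarith [pi_pos]) (by nlinarith) (by nlinarith)
  · rw [show m + 2 - 1 = m + 1 by lia, LE_eq_sin_div hp (by push_cast; exact hθ) (by lia),
      show ((m : ℝ) + 1 / 2) * θ = π / 2 - 3 * (θ / 2) by linarith,
      show ((m : ℝ) + 1 / 2 + 1) * θ = π / 2 - θ / 2 by linarith, sin_pi_div_two_sub,
      sin_pi_div_two_sub, cos_three_mul]
    have h2 : 0 < cos (θ / 2) := cos_pos_of_mem_Ioo ⟨by nlinarith [pi_pos], by nlinarith⟩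
    have h3 : cos θ = 2 * cos (θ / 2) ^ 2 - 1 := by rw [← cos_two_mul]; ring_nf
    rw [h3]
    field_simp
    ring
  · rw [sin_sq]; ring
  · have h1 := (sin_mul_recurrence hx m).1
    have h2 : sin ((m + 1) * θ) = cos θ := by
      rw [show ((m : ℝ) + 1) * θ = π / 2 - θ by linarith, sin_pi_div_two_sub]
    have h3 : sin (m * θ) = 2 * cos θ ^ 2 - 1 := by
      rw [show (m : ℝ) * θ = π / 2 - 2 * θ by linarith, sin_pi_div_two_sub, cos_two_mul]
    rw [show m + 2 - 1 = m + 1 by lia, h1, h2, h3]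
    ring

end Trig
end Geometry

section Domain

variable {l : ℝ} {p : ℕ}

namespace Geom

lemma quad_pos (h : Geom l p) (x : ℝ) : 0 < x ^ 2 + l * x + 1 := by
  nlinarith [sq_nonneg (x + l / 2), h.lt_two, h.pos]

lemma phi_neg (h : Geom l p) {j : ℕ} (hj : j + 2 ≤ p) : phi l j < 0 :=
  (h.phi_le j hj).trans_lt (by rw [neg_div]; have := h.pos; exact neg_neg_of_pos (by positivity))

lemma phi_lt_succ (h : Geom l p) {j : ℕ} (hj : j + 2 ≤ p) : phi l j < phi l (j + 1) := by
  have h0 := h.phi_neg hj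
  have h1 : -1 / phi l j - l - phi l j = -(phi l j ^ 2 + l * phi l j + 1) / phi l j := by
    have := h0.ne
    field_simp
    ring
  have h2 : 0 < -(phi l j ^ 2 + l * phi l j + 1) / phi l j :=
    div_pos_of_neg_of_neg (by linarith [h.quad_pos (phi l j)]) h0
  rw [h.phi_succ j hj]
  linarith

lemma phi_mono (h : Geom l p) {i j : ℕ} (hij : i ≤ j) (hj : j + 1 ≤ p) : phi l i ≤ phi l j := by
  induction j, hij using Nat.le_induction with
  | base => exact le_rfl
  | succ j _ ih => exact (ih (by lia)).trans (h.phi_lt_succ hj).le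

lemma LE_le_succ (h : Geom l p) {j : ℕ} (hj : 1 ≤ j) (hjp : j + 2 ≤ p) :
    LE l j ≤ LE l (j + 1) := by
  have h0 := h.LE_nonneg j hj (by lia)
  have h1 := h.LE_lt_one j hj (by lia)
  have h2 := h.one_lt
  rw [LE_succ hj, le_div_iff₀ (by linarith)]
  nlinarith [h.quad_pos (-LE l j)]

lemma LE_mono (h : Geom l p) {i j : ℕ} (hi : 1 ≤ i) (hij : i ≤ j) (hj : j + 1 ≤ p) :
    LE l i ≤ LE l j := by
  induction j, hij using Nat.le_induction with
  | base => exact le_rfl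
  | succ j _ ih => exact (ih (by lia)).trans (h.LE_le_succ (by lia) hj)

lemma LE_le (h : Geom l p) {i : ℕ} (hi : 1 ≤ i) (hj : i + 1 ≤ p) : LE l i ≤ l - 1 := by
  rw [← h.LE_pred]
  exact h.LE_mono hi (by lia) (by lia)

lemma inv_le_LE (h : Geom l p) {i : ℕ} (hi : 1 ≤ i) (hj : i + 1 ≤ p) : 1 / (l + 1) ≤ LE l i :=
  h.LE_mono le_rfl hi hj

end Geom

lemma mem_OmegaE_iff {z : ℝ × ℝ} : z ∈ OmegaE l p ↔
    (∃ i, i + 2 ≤ p ∧ phi l i ≤ z.1 ∧ z.1 < phi l (i + 1) ∧ 0 ≤ z.2 ∧ z.2 ≤ LE l (i + 1)) ∨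
      (0 ≤ z.1 ∧ z.1 < l / 2 ∧ 0 ≤ z.2 ∧ z.2 ≤ 1) := by
  simp only [OmegaE, Set.mem_union, Set.mem_iUnion, Finset.mem_Icc, Set.mem_prod, Set.mem_Ico,
    Set.mem_Icc, exists_prop, and_assoc]
  refine or_congr ⟨?_, ?_⟩ Iff.rfl
  · rintro ⟨j, h1, h2, h⟩
    obtain ⟨i, rfl⟩ := Nat.exists_eq_add_of_le' h1
    exact ⟨i, by lia, h⟩
  · rintro ⟨i, h1, h⟩
    exact ⟨i + 1, by lia, by lia, h⟩

lemma mem_OmegaE_of_phi_le (h : Geom l p) {z : ℝ × ℝ} {i : ℕ} (hi : i + 2 ≤ p)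
    (h1 : phi l i ≤ z.1) (h2 : z.1 < l / 2) (h3 : 0 ≤ z.2) (h4 : z.2 ≤ LE l (i + 1)) :
    z ∈ OmegaE l p := by
  rw [mem_OmegaE_iff]
  by_cases ht : 0 ≤ z.1
  · exact Or.inr ⟨ht, h2, h3, h4.trans (h.LE_lt_one _ (by lia) (by lia)).le⟩
  left
  obtain ⟨n, hn⟩ := Nat.exists_eq_add_of_le' hi
  induction n generalizing i with
  | zero =>
    refine ⟨i, hi, h1, ?_, h3, h4⟩
    rw [show i + 1 = p - 1 by lia, h.phi_pred]
    exact not_le.mp ht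
  | succ n ih =>
    rcases lt_or_ge z.1 (phi l (i + 1)) with hlt | hge
    · exact ⟨i, hi, h1, hlt, h3, h4⟩
    · exact ih (by lia) hge (h4.trans (h.LE_le_succ (by lia) (by lia))) (by lia)

lemma mem_OmegaE_of_le (h : Geom l p) {z : ℝ × ℝ} (h1 : z.1 ∈ Set.Ico (-(l / 2)) (l / 2))
    (h3 : 0 ≤ z.2) (h4 : z.2 ≤ 1 / (l + 1)) : z ∈ OmegaE l p :=
  mem_OmegaE_of_phi_le h h.two_le (i := 0) (h.phi_zero ▸ h1.1) h1.2 h3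
    (h4.trans (h.inv_le_LE le_rfl h.two_le))

structure OmegaBounds (l : ℝ) (z : ℝ × ℝ) : Prop where
  left : -(l / 2) ≤ z.1
  right : z.1 < l / 2
  nonneg : 0 ≤ z.2
  le_one : z.2 ≤ 1
  le_of_neg : z.1 < 0 → z.2 ≤ l - 1

lemma omegaBounds (h : Geom l p) {z : ℝ × ℝ} (hz : z ∈ OmegaE l p) : OmegaBounds l z := by
  have hl := h.pos
  have hl2 := h.lt_two
  rcases mem_OmegaE_iff.mp hz with ⟨i, hi, h1, h2, h3, h4⟩ | ⟨h1, h2, h3, h4⟩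
  · have h5 := h.LE_le (i := i + 1) (by lia) (by lia)
    have h6 := h.phi_mono (Nat.zero_le i) (by lia)
    rw [h.phi_zero] at h6
    have h7 := h.phi_mono (i := i + 1) (j := p - 1) (by lia) (by lia)
    rw [h.phi_pred] at h7
    exact ⟨by linarith, by linarith, h3, by linarith, fun _ => by linarith⟩
  · exact ⟨by linarith, h2, h3, h4, fun _ => by linarith⟩

namespace OmegaBounds

variable {z : ℝ × ℝ}

lemma abs_le (b : OmegaBounds l z) : |z.1| ≤ l / 2 := _root_.abs_le.mpr ⟨b.left, b.right.le⟩

lemma one_add_mul_pos (b : OmegaBounds l z) (h : Geom l p) : 0 < 1 + z.1 * z.2 := by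
  nlinarith [b.left, b.right, b.nonneg, b.le_one, h.lt_two, h.pos]

lemma one_add_mul_ge (b : OmegaBounds l z) : 1 - l / 2 ≤ 1 + z.1 * z.2 := by
  nlinarith [b.left, b.right, b.nonneg, b.le_one]

end OmegaBounds

lemma T_of_pos {z : ℝ × ℝ} (hz : 0 < z.1) :
    T l z = (1 / z.1 - l * digit l z.1, 1 / (digit l z.1 * l + z.2)) := by
  rw [T, f_eq_digit hz.ne', abs_of_pos hz, Real.sign_of_pos hz, one_mul, digit, abs_of_pos hz]

lemma T_of_neg {z : ℝ × ℝ} (hz : z.1 < 0) :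
    T l z = (-1 / z.1 - l * digit l z.1, 1 / (digit l z.1 * l - z.2)) := by
  rw [T, f_eq_digit hz.ne, abs_of_neg hz, Real.sign_of_neg hz, digit, abs_of_neg hz]
  simp [sub_eq_add_neg, neg_div, div_neg]

lemma T_of_zero {z : ℝ × ℝ} (hz : z.1 = 0) : T l z = (0, 0) := by
  norm_num [T, hz, f]

lemma T_mem_OmegaE (h : Geom l p) {z : ℝ × ℝ} (hz : z ∈ OmegaE l p) : T l z ∈ OmegaE l p := by
  have hl := h.pos
  have hl1 := h.one_lt
  have hl2 := h.lt_two
  have b := omegaBounds h hz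
  have := b.nonneg
  rcases lt_trichotomy z.1 0 with ht | ht | ht
  · have hd := one_le_digit hl hl2 ht.ne b.abs_le
    have hf : (T l z).1 ∈ Set.Ico (-(l / 2)) (l / 2) := f_mem_Ico hl ht.ne
    have hv := b.le_of_neg ht
    rw [T_of_neg ht] at hf ⊢
    rcases hd.eq_or_lt with hd | hd
    · rw [← hd] at hf ⊢
      simp only [Int.cast_one, mul_one, one_mul] at hf ⊢
      rcases mem_OmegaE_iff.mp hz with ⟨i, hi, h1, h2, h3, h4⟩ | h0
      · have hphi : phi l (i + 1) ≤ -1 / z.1 - l := by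
          rw [h.phi_succ i hi]
          have hi0 := h.phi_neg hi
          have : -1 / phi l i ≤ -1 / z.1 := by
            have := one_div_le_one_div_of_neg_of_le ht h1
            rw [neg_div, neg_div]
            linarith
          linarith
        have hL := h.LE_lt_one (i + 1) (by lia) (by lia)
        have hv0 : 0 ≤ 1 / (l - z.2) := one_div_nonneg.mpr (by linarith)
        rcases Nat.lt_or_ge (i + 2) p with hip | hip
        · refine mem_OmegaE_of_phi_le h (i := i + 1) (by lia) hphi hf.2 hv0 ?_
          rw [LE_succ (by lia)]
          exact one_div_le_one_div_of_le (by linarith) (by linarith)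
        · rw [show i + 1 = p - 1 by lia, h.phi_pred] at hphi
          refine mem_OmegaE_iff.mpr (Or.inr ⟨hphi, hf.2, hv0, ?_⟩)
          rw [div_le_one (by linarith)]
          linarith
      · linarith
    · have hd' : (2 : ℝ) ≤ digit l z.1 := by exact_mod_cast hd
      refine mem_OmegaE_of_le h hf (one_div_nonneg.mpr (by nlinarith)) ?_
      exact one_div_le_one_div_of_le (by linarith) (by nlinarith)
  · rw [T_of_zero ht]
    exact mem_OmegaE_iff.mpr (Or.inr ⟨le_rfl, by positivity, le_rfl, zero_le_one⟩)
  · have hd := one_le_digit hl hl2 ht.ne' b.abs_le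
    have hf : (T l z).1 ∈ Set.Ico (-(l / 2)) (l / 2) := f_mem_Ico hl ht.ne'
    rw [T_of_pos ht] at hf ⊢
    have hd1 : (1 : ℝ) ≤ digit l z.1 := by exact_mod_cast hd
    have hv0 : 0 ≤ 1 / (digit l z.1 * l + z.2) := one_div_nonneg.mpr (by nlinarith)
    rcases hd.eq_or_lt with hd | hd
    · rw [← hd] at hf hv0 ⊢
      simp only [Int.cast_one, mul_one, one_mul] at hf hv0 ⊢
      have hphi : phi l 1 ≤ 1 / z.1 - l := by
        rw [h.phi_succ 0 h.two_le, h.phi_zero]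
        have : -1 / -(l / 2) ≤ 1 / z.1 := by
          rw [neg_div_neg_eq]
          exact one_div_le_one_div_of_le ht b.right.le
        linarith
      have hv1 : 1 / (l + z.2) ≤ 1 / l := one_div_le_one_div_of_le hl (by linarith)
      rcases Nat.lt_or_ge 2 p with hip | hip
      · refine mem_OmegaE_of_phi_le h (i := 1) (by lia) hphi hf.2 hv0 (hv1.trans ?_)
        rw [LE_succ le_rfl]
        have h5 := h.LE_nonneg 1 le_rfl (by lia)
        have h6 := h.LE_lt_one 1 le_rfl (by lia)
        exact one_div_le_one_div_of_le (by linarith) (by linarith)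
      · rw [show 1 = p - 1 by have := h.two_le; lia, h.phi_pred] at hphi
        refine mem_OmegaE_iff.mpr (Or.inr ⟨hphi, hf.2, hv0, hv1.trans ?_⟩)
        rw [div_le_one hl]
        exact hl1.le
    · have hd' : (2 : ℝ) ≤ digit l z.1 := by exact_mod_cast hd
      refine mem_OmegaE_of_le h hf hv0 ?_
      exact one_div_le_one_div_of_le (by linarith) (by nlinarith)

lemma T_iterate_mem_OmegaE (h : Geom l p) {z : ℝ × ℝ} (hz : z ∈ OmegaE l p) (n : ℕ) :
    (T l)^[n] z ∈ OmegaE l p := by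
  induction n with
  | zero => exact hz
  | succ n ih =>
    rw [Function.iterate_succ_apply']
    exact T_mem_OmegaE h ih

/-- On the domain, the second coordinate of `T z` is the inverse of a positive number. -/
lemma T_snd_spec (h : Geom l p) {z : ℝ × ℝ} (hz : z ∈ OmegaE l p) (ht : z.1 ≠ 0) :
    0 < digit l z.1 * l + Real.sign z.1 * z.2 := by
  have hl := h.pos
  have hl1 := h.one_lt
  have b := omegaBounds h hz
  have := b.nonneg
  have hd : (1 : ℝ) ≤ digit l z.1 := by exact_mod_cast one_le_digit hl h.lt_two ht b.abs_le
  rcases lt_or_gt_of_ne ht with ht | ht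
  · rw [Real.sign_of_neg ht]
    have := b.le_of_neg ht
    nlinarith
  · rw [Real.sign_of_pos ht]
    nlinarith

/-- The approximation coefficient `|t| / (1 + t v)` as a function on the domain. -/
def Th (z : ℝ × ℝ) : ℝ := |z.1| / (1 + z.1 * z.2)

lemma T_snd_div (h : Geom l p) {z : ℝ × ℝ} (hz : z ∈ OmegaE l p) (ht : z.1 ≠ 0) :
    (T l z).2 / (1 + (T l z).1 * (T l z).2) = Th z := by
  have h1 := T_snd_spec h hz ht
  have h2 := (omegaBounds h hz).one_add_mul_pos h
  have h3 := (omegaBounds h (T_mem_OmegaE h hz)).one_add_mul_pos h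
  rcases lt_or_gt_of_ne ht with ht' | ht'
  · rw [T_of_neg ht'] at h3 ⊢
    rw [Real.sign_of_neg ht'] at h1
    rw [Th, abs_of_neg ht', div_eq_div_iff h3.ne' h2.ne']
    have h4 : digit l z.1 * l - z.2 ≠ 0 := by linarith
    field_simp
    ring
  · rw [T_of_pos ht'] at h3 ⊢
    rw [Real.sign_of_pos ht'] at h1
    rw [Th, abs_of_pos ht', div_eq_div_iff h3.ne' h2.ne']
    have h4 : digit l z.1 * l + z.2 ≠ 0 := by linarith
    field_simp
    ring

end Domain

section Blocks

variable {l : ℝ} {p : ℕ} {z : ℝ × ℝ}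

/-- The coefficient at `T^i z` exceeds `1/2` for `i ≤ m` and drops below `1/2` at `i = m + 1`. -/
def Stay (l : ℝ) (m : ℕ) (z : ℝ × ℝ) : Prop :=
  (∀ i ≤ m, 1 / 2 < Th ((T l)^[i] z)) ∧ Th ((T l)^[m + 1] z) < 1 / 2

lemma Stay.unique {m n : ℕ} (hm : Stay l m z) (hn : Stay l n z) : m = n := by
  rcases lt_trichotomy m n with hlt | heq | hgt
  · exact absurd hm.2 (hn.1 _ hlt).not_gt
  · exact heq
  · exact absurd hn.2 (hm.1 _ hgt).not_gt

lemma stay_add_iff {m n : ℕ} (h : ∀ i < n, 1 / 2 < Th ((T l)^[i] z)) :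
    Stay l (m + n) z ↔ Stay l m ((T l)^[n] z) := by
  simp only [Stay, ← Function.iterate_add_apply]
  refine and_congr ⟨fun H i hi => H _ (by lia), fun H i hi => ?_⟩ ?_
  · rcases lt_or_ge i n with hin | hin
    · exact h i hin
    · convert H (i - n) (by lia) using 3
      lia
  · rw [show m + n + 1 = m + 1 + n by lia]

lemma T_of_digit_one (ht : z.1 < -2 / (3 * l)) (hl : 0 < l) (hl2 : l < 2) (hz : -(l / 2) ≤ z.1) :
    T l z = (-1 / z.1 - l, 1 / (l - z.2)) := by
  have h0 : 0 < 2 / (3 * l) := by positivity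
  have h1 : z.1 < 0 := by rw [neg_div] at ht; linarith
  rw [neg_div] at ht
  rw [T_of_neg h1, digit_eq_one hl hl2 (by rw [abs_of_neg h1]; linarith)
    (by rw [abs_of_neg h1]; linarith)]
  simp

lemma Th_of_neg (hz : z.1 < 0) : Th z = -z.1 / (1 + z.1 * z.2) := by
  rw [Th, abs_of_neg hz]

lemma mem_DE_iff (h : Geom l p) : z ∈ DE l p ↔
    z ∈ OmegaE l p ∧ 1 + z.1 * z.2 < 2 * z.2 ∧ 1 / 2 < Th z := by
  refine and_congr_right fun hz => and_congr_left fun _ => ?_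
  have := (omegaBounds h hz).one_add_mul_pos h
  rw [gt_iff_lt, lt_div_iff₀ this]
  constructor <;> intro <;> linarith

lemma T_mem_DE (h : Geom l p) (hz : z ∈ OmegaE l p) (ht : z.1 ≠ 0) (h0 : 1 / 2 < Th z)
    (h1 : 1 / 2 < Th (T l z)) : T l z ∈ DE l p :=
  ⟨T_mem_OmegaE h hz, by rwa [T_snd_div h hz ht], h1⟩

lemma Th_le_half_of_nonneg (h : Geom l p) (hz : z ∈ OmegaE l p) (ht : 0 ≤ z.1)
    (hv : 1 + z.1 * z.2 < 2 * z.2) : Th z < 1 / 2 := by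
  have b := omegaBounds h hz
  have := b.one_add_mul_pos h
  rw [Th, abs_of_nonneg ht, div_lt_iff₀ this]
  nlinarith [mul_nonneg (sub_nonneg.mpr b.le_one) (sub_nonneg.mpr (b.right.le.trans
    (show l / 2 ≤ 1 by linarith [h.lt_two])))]

lemma neg_of_mem_DE (h : Geom l p) (hz : z ∈ DE l p) : z.1 < 0 := by
  rw [mem_DE_iff h] at hz
  by_contra! ht
  exact absurd hz.2.2 (Th_le_half_of_nonneg h hz.1 ht hz.2.1).not_gt

lemma lt_of_mem_DE (h : Geom l p) (hz : z ∈ DE l p) : z.1 < -1 / (l + 1) := by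
  have ht := neg_of_mem_DE h hz
  rw [mem_DE_iff h] at hz
  have b := omegaBounds h hz.1
  have h1 := b.one_add_mul_pos h
  have h2 := hz.2.2
  rw [Th_of_neg ht, lt_div_iff₀ h1] at h2
  have := b.le_of_neg ht
  rw [lt_div_iff₀ (by linarith [h.pos])]
  nlinarith

lemma stay_zero (h : Geom l p) (hz : z ∈ DE l p) (h1 : -1 / l ≤ z.1) (h2 : z.1 < -2 / (3 * l)) :
    Stay l 0 z := by
  have ht := neg_of_mem_DE h hz
  have hD := (mem_DE_iff h).mp hz
  have b := omegaBounds h hD.1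
  have hT := T_mem_OmegaE h hD.1
  have hpos := (omegaBounds h hT).one_add_mul_pos h
  refine ⟨fun i hi => by rw [Nat.le_zero.mp hi]; exact hD.2.2, ?_⟩
  rw [zero_add, Function.iterate_one]
  refine Th_le_half_of_nonneg h hT ?_ ?_
  · rw [T_of_digit_one h2 h.pos h.lt_two b.left]
    rw [div_le_iff₀ h.pos] at h1
    have : l ≤ -1 / z.1 := by
      rw [le_div_iff_of_neg ht]
      linarith
    simpa using this
  · have := hD.2.2
    rw [← T_snd_div h hD.1 ht.ne, lt_div_iff₀ hpos] at this
    linarith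

/-- Along digits equal to one the coefficients have no interior local minimum. -/
lemma not_local_min (h : Geom l p) (hz : z ∈ OmegaE l p) (h2 : z.1 < -2 / (3 * l))
    (h3 : (T l z).1 < 0) :
    ¬ (Th z ≤ z.2 / (1 + z.1 * z.2) ∧ Th z ≤ Th (T l z)) := by
  rintro ⟨ha, hb⟩
  have hl := h.pos
  have ht : z.1 < 0 := h2.trans (by rw [neg_div]; exact neg_neg_of_pos (by positivity))
  have b := omegaBounds h hz
  have h1 := b.one_add_mul_pos h
  have hv : 0 < l - z.2 := by linarith [b.le_of_neg ht]
  have hpos := (omegaBounds h (T_mem_OmegaE h hz)).one_add_mul_pos h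
  rw [Th_of_neg h3] at hb
  rw [Th_of_neg ht] at ha hb
  rw [T_of_digit_one h2 h.pos h.lt_two b.left] at h3 hb hpos
  simp only at h3 hb hpos
  rw [div_le_div_iff_of_pos_right h1] at ha
  have key : -(-1 / z.1 - l) / (1 + (-1 / z.1 - l) * (1 / (l - z.2))) =
      (-l * z.1 - 1) * (l - z.2) / (1 + z.1 * z.2) := by
    rw [div_eq_div_iff hpos.ne' h1.ne']
    have := ht.ne
    field_simp
    ring
  rw [key, div_le_div_iff_of_pos_right h1] at hb
  have h4 : 0 < -l * z.1 - 1 := by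
    have h5 : -1 / z.1 < l := by linarith
    rw [div_lt_iff_of_neg ht] at h5
    linarith
  nlinarith [h.quad_pos z.1, mul_nonneg h4.le (show 0 ≤ z.2 + z.1 by linarith)]

end Blocks

section Excursion

variable {l : ℝ} {p : ℕ} {z : ℝ × ℝ}

lemma Geom.neg_inv_lt (h : Geom l p) : -1 / l < -2 / (3 * l) := by
  have := h.pos
  rw [div_lt_div_iff₀ this (by positivity)]
  linarith

lemma lt_of_le_neg_LE (h : Geom l p) {j : ℕ} (hj : 2 ≤ j) (hjp : j + 1 ≤ p) {t : ℝ}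
    (ht : t ≤ -LE l j) : t < -2 / (3 * l) := by
  have h1 := h.one_lt
  have h2 : LE l 2 = (l + 1) / (l ^ 2 + l - 1) := by
    rw [LE_succ le_rfl, LE]
    have : l - 1 / (l + 1) = (l ^ 2 + l - 1) / (l + 1) := by field_simp
    rw [this, one_div_div]
  have h3 : 2 / (3 * l) < LE l 2 := by
    rw [h2, div_lt_div_iff₀ (by positivity) (by nlinarith)]
    nlinarith
  have := h.LE_mono (by lia) hj hjp
  rw [neg_div]
  linarith

lemma T_fst_le_neg_LE (h : Geom l p) (hz : z ∈ OmegaE l p) {j : ℕ} (hj : 1 ≤ j) (hjp : j + 2 ≤ p)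
    (ht : z.1 ≤ -LE l (j + 1)) : (T l z).1 ≤ -LE l j := by
  have hlt := lt_of_le_neg_LE h (by lia) (by lia) ht
  have h0 := h.LE_nonneg j hj (by lia)
  have h2 := h.LE_lt_one j hj (by lia)
  have h3 := h.one_lt
  rw [T_of_digit_one hlt h.pos h.lt_two (omegaBounds h hz).left]
  rw [LE_succ hj] at ht
  have hneg : z.1 < 0 := ht.trans_lt (neg_neg_of_pos (one_div_pos.mpr (by linarith)))
  have : -1 / z.1 ≤ l - LE l j := by
    rw [div_le_iff_of_neg hneg]
    have h4 := mul_le_mul_of_nonneg_left ht (show 0 ≤ l - LE l j by linarith)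
    have h5 : (l - LE l j) * -(1 / (l - LE l j)) = -1 := by
      have : l - LE l j ≠ 0 := by linarith
      field_simp
    linarith
  simp only
  linarith

lemma phi_le_T_fst (h : Geom l p) (hz : z ∈ OmegaE l p) {i : ℕ} (hi : i + 2 ≤ p)
    (hneg : z.1 < -2 / (3 * l)) (ht : phi l i ≤ z.1) : phi l (i + 1) ≤ (T l z).1 := by
  rw [T_of_digit_one hneg h.pos h.lt_two (omegaBounds h hz).left, h.phi_succ i hi]
  have hz0 : z.1 < 0 := hneg.trans (by
    rw [neg_div]
    have := h.pos
    exact neg_neg_of_pos (by positivity))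
  have := one_div_le_one_div_of_neg_of_le hz0 ht
  simp only [neg_div]
  linarith

/-- Digits on `A` equal two. -/
lemma T_of_mem_AE (h : Geom l p) (hz : z ∈ AE l p) :
    T l z = (-1 / z.1 - 2 * l, 1 / (2 * l - z.2)) := by
  have hl := h.pos
  have hneg := neg_of_mem_DE h hz.1
  have h1 := hz.2.1
  have h2 := hz.2.2
  have hd : digit l z.1 = 2 := by
    rw [div_le_iff₀ (by positivity)] at h1
    rw [le_div_iff₀ (by positivity)] at h2
    rw [digit, Int.floor_eq_iff, abs_of_neg hneg]
    have h3 : 0 < l * -z.1 := by nlinarith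
    have h4 : 3 / 2 ≤ 1 / (l * -z.1) := by
      rw [le_div_iff₀ h3]
      nlinarith
    have h5 : 1 / (l * -z.1) < 5 / 2 := by
      rw [div_lt_iff₀ h3]
      nlinarith [h.one_lt]
    push_cast
    constructor <;> linarith
  rw [T_of_neg hneg, hd]
  push_cast
  rw [mul_comm l 2]

lemma T_fst_of_mem_AE (h : Geom l p) (hz : z ∈ AE l p) : (T l z).1 ≤ -LE l (p - 1) := by
  have hneg := neg_of_mem_DE h hz.1
  have hl := h.pos
  rw [h.LE_pred, T_of_mem_AE h hz]
  have : -1 / z.1 ≤ l + 1 := by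
    rw [div_le_iff_of_neg hneg]
    have := hz.2.2
    rw [le_div_iff₀ (by positivity)] at this
    linarith
  simp only
  linarith

/-- The excursion of a point of `A`: after one digit two, digits one follow. -/
lemma iterate_fst_mem (h : Geom l p) (hz : z ∈ AE l p) {i : ℕ} (hi : i + 2 ≤ p) :
    phi l i ≤ ((T l)^[i + 1] z).1 ∧ ((T l)^[i + 1] z).1 ≤ -LE l (p - 1 - i) := by
  have hΩ := T_iterate_mem_OmegaE h hz.1.1
  induction i with
  | zero =>
    rw [h.phi_zero]
    exact ⟨(omegaBounds h (hΩ 1)).left, T_fst_of_mem_AE h hz⟩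
  | succ i ih =>
    obtain ⟨h1, h2⟩ := ih (by lia)
    rw [Function.iterate_succ_apply']
    have h3 := lt_of_le_neg_LE h (by lia) (by lia) h2
    refine ⟨phi_le_T_fst h (hΩ _) (by lia) h3 h1, T_fst_le_neg_LE h (hΩ _) (by lia) (by lia) ?_⟩
    rwa [show p - 1 - (i + 1) + 1 = p - 1 - i by lia]

lemma iterate_fst_lt (h : Geom l p) (hz : z ∈ AE l p) {i : ℕ} (hi : i + 3 ≤ p) :
    ((T l)^[i + 1] z).1 < -2 / (3 * l) :=
  lt_of_le_neg_LE h (by lia) (by lia) (iterate_fst_mem h hz (by lia)).2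

lemma iterate_fst_neg (h : Geom l p) (hz : z ∈ AE l p) {i : ℕ} (hi : i + 1 ≤ p) :
    ((T l)^[i] z).1 < 0 := by
  rcases i with _ | i
  · exact neg_of_mem_DE h hz.1
  · have := h.LE_nonneg (p - 1 - i) (by lia) (by lia)
    linarith [(iterate_fst_mem h hz hi).2]

/-- Solution of `x_{i+2} = l x_{i+1} - x_i` with given first two values. -/
def chain (l a b : ℝ) : ℕ → ℝ
  | 0 => a
  | 1 => b
  | i + 2 => l * chain l a b (i + 1) - chain l a b i

lemma iterate_eq_chain (h : Geom l p) (hz : z ∈ AE l p) {i : ℕ} (hi : i + 2 ≤ p) :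
    let s := chain l 1 (2 * l - z.2)
    let d := chain l (-z.1) (2 * l * -z.1 - 1)
    0 < s (i + 1) ∧ 0 < d i ∧ (T l)^[i + 1] z = (-d (i + 1) / d i, s i / s (i + 1)) ∧
      s (i + 1) * d i - d (i + 1) * s i = 1 + z.1 * z.2 := by
  intro s d
  have hΩ := T_iterate_mem_OmegaE h hz.1.1
  have hneg := neg_of_mem_DE h hz.1
  induction i with
  | zero =>
    have b := omegaBounds h hz.1.1
    have h1 := h.one_lt
    refine ⟨?_, ?_, ?_, ?_⟩
    · simp only [s, chain]
      linarith [b.le_one]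
    · simp only [d, chain]
      linarith
    · simp only [s, d, chain, zero_add, Function.iterate_one]
      rw [T_of_mem_AE h hz]
      refine Prod.ext ?_ rfl
      simp only
      have := hneg.ne
      field_simp
      ring
    · simp only [s, d, chain]
      ring
  | succ i ih =>
    obtain ⟨h1, h2, h3, h4⟩ := ih (by lia)
    have h5 := iterate_fst_lt h hz hi
    have h6 := iterate_fst_neg h hz (i := i + 1) (by lia)
    have hd : 0 < d (i + 1) := by
      rw [h3] at h6
      simp only [neg_div] at h6
      by_contra! hd
      have := div_nonpos_of_nonpos_of_nonneg hd h2.le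
      linarith
    have hb := omegaBounds h (hΩ (i + 1))
    have hv := hb.le_of_neg h6
    have hs : s (i + 2) = l * s (i + 1) - s i := rfl
    have hd' : d (i + 2) = l * d (i + 1) - d i := rfl
    rw [Function.iterate_succ_apply', T_of_digit_one h5 h.pos h.lt_two hb.left, h3]
    rw [h3] at hv
    simp only at hv
    rw [div_le_iff₀ h1] at hv
    have hs2 : 0 < s (i + 2) := by rw [hs]; nlinarith
    refine ⟨hs2, hd, ?_, ?_⟩
    · refine Prod.ext ?_ ?_ <;> simp only
      · rw [show i + 1 + 1 = i + 2 from rfl, hd']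
        field_simp
        ring
      · have : l - s i / s (i + 1) = s (i + 2) / s (i + 1) := by
          rw [hs]
          field_simp
        rw [this, one_div_div]
    · rw [show i + 1 + 1 = i + 2 from rfl, hd', hs]
      linarith

/-- The coefficient at the end of the excursion exceeds `1/2`. -/
lemma half_lt_Th_iterate_pred (h : Geom l p) (hz : z ∈ AE l p) :
    1 / 2 < Th ((T l)^[p - 1] z) := by
  obtain ⟨h1, h2, h3, h4⟩ := iterate_eq_chain h hz (i := p - 2) (by have := h.two_le; lia)
  have hneg := iterate_fst_neg h hz (i := p - 1) (by have := h.two_le; lia)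
  have hb := (omegaBounds h (T_iterate_mem_OmegaE h hz.1.1 (p - 1))).one_add_mul_pos h
  have hX := (omegaBounds h hz.1.1).one_add_mul_pos h
  obtain ⟨σ, hσ, hrot⟩ := h.rotation
  have hs := hrot (chain l 1 (2 * l - z.2)) fun i => rfl
  have hd := hrot (chain l (-z.1) (2 * l * -z.1 - 1)) fun i => rfl
  simp only [show p - 2 + 1 = p - 1 by have := h.two_le; lia] at h1 h2 h3 h4
  set s := chain l 1 (2 * l - z.2)
  set d := chain l (-z.1) (2 * l * -z.1 - 1)
  have e0 : s 0 = 1 := rfl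
  have e1 : s 1 = 2 * l - z.2 := rfl
  have e2 : d 0 = -z.1 := rfl
  have e3 : d 1 = 2 * l * -z.1 - 1 := rfl
  rw [e0, e1] at hs
  rw [e2, e3] at hd
  have hTh : Th ((T l)^[p - 1] z) = s (p - 1) * d (p - 1) / (1 + z.1 * z.2) := by
    rw [Th_of_neg hneg, div_eq_div_iff hb.ne' hX.ne', h3, ← h4]
    simp only
    field_simp
    ring
  rw [hTh, lt_div_iff₀ hX]
  have hl := h.pos
  have hl2 := h.lt_two
  have hσ0 : 0 < σ ^ 2 := by rw [hσ]; nlinarith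
  have hz1 := (mem_DE_iff h).mp hz.1
  have hneg0 := neg_of_mem_DE h hz.1
  have hu := hz1.2.2
  rw [Th_of_neg hneg0, lt_div_iff₀ hX] at hu
  have hA : l + 1 ≥ 1 := by linarith
  have hst := hz.2.2
  rw [le_div_iff₀ (by linarith)] at hst
  have hprod : σ ^ 2 * (s (p - 1) * d (p - 1)) =
      (l ^ 2 / 2 + 1 - l / 2 * z.2) * ((l ^ 2 / 2 + 1) * -z.1 - l / 2) := by
    linear_combination (σ * d (p - 1)) * hs +
      (l / 2 * (2 * l - z.2) - (l ^ 2 / 2 - 1) * 1) * hd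
  set t := -z.1 with ht
  have hzt : z.1 = -t := by rw [ht]; ring
  rw [hzt] at hu hX hst hneg0 ⊢
  have ht0 : 0 < t := by linarith
  set X := 1 + -t * z.2 with hXdef
  set A := (l ^ 2 / 2 + 1) * t - l / 2 with hAdef
  have hA1 : t * (1 - l / 2) ≤ A := by rw [hAdef]; nlinarith
  have hA2 : t * (1 + l / 2) ≤ A + l * t := by linarith
  have hA0 : 0 < A := lt_of_lt_of_le (mul_pos ht0 (by linarith)) hA1
  have hm : t * (1 - l / 2) * (t * (1 + l / 2)) ≤ A * (A + l * t) :=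
    mul_le_mul hA1 hA2 (by positivity) hA0.le
  have hq : t * (l ^ 2 / 2 + 1 - l / 2 * z.2) = A + l / 2 * X := by
    rw [hAdef, hXdef]
    ring
  have hm1 := mul_le_mul_of_nonneg_left hm hX.le
  have hm2 := mul_lt_mul_of_pos_right hu (mul_pos hA0 hA0)
  have hfin : (t * t * σ ^ 2) * (1 / 2 * X) < (t * t * σ ^ 2) * (s (p - 1) * d (p - 1)) := by
    have e : (t * t * σ ^ 2) * (s (p - 1) * d (p - 1)) = t * (A + l / 2 * X) * A := by
      rw [← hq]
      linear_combination (t * t) * hprod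
    rw [e, hσ]
    nlinarith
  exact lt_of_mul_lt_mul_left hfin (by positivity)

/-- All coefficients along the excursion exceed `1/2`. -/
lemma half_lt_Th_iterate (h : Geom l p) (hz : z ∈ AE l p) {i : ℕ} (hi : i + 1 ≤ p) :
    1 / 2 < Th ((T l)^[i] z) := by
  obtain ⟨m, hm, hmin⟩ := Finset.exists_min_image (Finset.range p) (fun i => Th ((T l)^[i] z))
    ⟨0, Finset.mem_range.mpr (by lia)⟩
  simp only [Finset.mem_range] at hm hmin
  refine lt_of_lt_of_le ?_ (hmin i (by lia))
  rcases Nat.eq_zero_or_pos m with rfl | hm0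
  · exact ((mem_DE_iff h).mp hz.1).2.2
  rcases Nat.lt_or_ge (m + 1) p with hmp | hmp
  · exfalso
    obtain ⟨j, rfl⟩ := Nat.exists_eq_add_of_le' hm0
    have hΩ := T_iterate_mem_OmegaE h hz.1.1
    refine not_local_min h (hΩ (j + 1)) (iterate_fst_lt h hz (by lia)) ?_ ⟨?_, ?_⟩
    · rw [← Function.iterate_succ_apply' (T l)]
      exact iterate_fst_neg h hz (by lia)
    · rw [Function.iterate_succ_apply' (T l),
        T_snd_div h (hΩ j) (iterate_fst_neg h hz (by lia)).ne, ← Function.iterate_succ_apply' (T l)]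
      exact hmin j (by lia)
    · rw [← Function.iterate_succ_apply' (T l)]
      exact hmin _ (by lia)
  · rw [show m = p - 1 by lia]
    exact half_lt_Th_iterate_pred h hz

end Excursion

section Returns

variable {l : ℝ} {p : ℕ} {z : ℝ × ℝ}

lemma iterate_mem_DE (h : Geom l p) (hz : z ∈ AE l p) : (T l)^[p - 1] z ∈ DE l p := by
  have hp := h.two_le
  obtain ⟨j, hj⟩ : ∃ j, p - 1 = j + 1 := ⟨p - 2, by lia⟩
  rw [hj, Function.iterate_succ_apply']
  refine T_mem_DE h (T_iterate_mem_OmegaE h hz.1.1 j) (iterate_fst_neg h hz (by lia)).ne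
    (half_lt_Th_iterate h hz (by lia)) ?_
  rw [← Function.iterate_succ_apply' (T l)]
  exact half_lt_Th_iterate h hz (by lia)

lemma neg_inv_le_iterate_fst (h : Geom l p) (hz : z ∈ AE l p) : -1 / l ≤ ((T l)^[p - 1] z).1 := by
  have hp := h.two_le
  have := (iterate_fst_mem h hz (i := p - 2) (by lia)).1
  rwa [h.phi_pred_pred, show p - 2 + 1 = p - 1 by lia] at this

lemma neg_one_div_le_iff {a b t : ℝ} (ht : t < 0) (ha : 0 < a + b) :
    -1 / (a + b) ≤ t ↔ b ≤ -1 / t - a := by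
  rw [div_le_iff₀ ha, le_sub_iff_add_le, le_div_iff_of_neg ht]
  constructor <;> intro <;> linarith

lemma phi_le_G_iterate (h : Geom l p) {y : ℝ} (hy : -1 / l ≤ y) {j : ℕ} (hj : j + 2 ≤ p) :
    phi l (p - 2 - j) ≤ (G l)^[j] y := by
  induction j with
  | zero => exact h.phi_pred_pred.trans_le hy
  | succ j ih =>
    have ih := ih (by lia)
    have h1 := h.phi_mono (Nat.zero_le (p - 2 - j)) (by lia)
    rw [h.phi_zero] at h1
    have h2 := h.pos
    have h3 := h.phi_succ (p - 2 - (j + 1)) (by lia)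
    rw [show p - 2 - (j + 1) + 1 = p - 2 - j by lia] at h3
    have h4 := h.phi_neg (j := p - 2 - (j + 1)) (by lia)
    rw [Function.iterate_succ_apply', G, ← not_lt]
    intro hlt
    have hpos : 0 < l + (G l)^[j] y := by linarith
    have h5 := (neg_one_div_le_iff h4 hpos).mp hlt.le
    have h6 : -1 / phi l (p - 2 - (j + 1)) - l = (G l)^[j] y := le_antisymm (by linarith) h5
    have h7 : -1 / (l + (G l)^[j] y) = phi l (p - 2 - (j + 1)) := by
      rw [← h6]
      have := h4.ne
      field_simp
      ring
    linarith

lemma neg_half_le_G_iterate (h : Geom l p) {y : ℝ} (hy : -1 / l ≤ y) {j : ℕ} (hj : j + 2 ≤ p) :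
    -(l / 2) ≤ (G l)^[j] y := by
  rw [← h.phi_zero]
  exact (h.phi_mono (Nat.zero_le _) (by lia)).trans (phi_le_G_iterate h hy hj)

lemma le_tauE (h : Geom l p) (k : ℕ) : -2 / (3 * l) ≤ tauE l p k := by
  have hl := h.pos
  induction k with
  | zero => exact le_rfl
  | succ k ih =>
    have := neg_half_le_G_iterate h (h.neg_inv_lt.le.trans ih) (j := p - 2)
      (by have := h.two_le; lia)
    rw [tauE, div_le_div_iff₀ (by positivity) (by linarith)]
    linarith

/-- The return map of `A` transports the thresholds `τ_k`. -/
lemma tauE_succ_le_iff (h : Geom l p) (hz : z ∈ AE l p) (k : ℕ) :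
    tauE l p (k + 1) ≤ z.1 ↔ tauE l p k ≤ ((T l)^[p - 1] z).1 := by
  have hp := h.two_le
  have hl := h.pos
  have hτ := h.neg_inv_lt.le.trans (le_tauE h k)
  have key : ∀ j, j + 2 ≤ p →
      ((G l)^[j] (tauE l p k) ≤ ((T l)^[p - 2 - j + 1] z).1 ↔
        tauE l p k ≤ ((T l)^[p - 1] z).1) := by
    intro j hj
    induction j with
    | zero =>
      rw [show p - 2 - 0 + 1 = p - 1 by lia]
      rfl
    | succ j ih =>
      rw [← ih (by lia), Function.iterate_succ_apply', G,
        neg_one_div_le_iff (iterate_fst_neg h hz (by lia))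
          (by linarith [neg_half_le_G_iterate h hτ (j := j) (by lia)]),
        show p - 2 - j + 1 = p - 2 - (j + 1) + 1 + 1 by lia,
        Function.iterate_succ_apply' (T l) (p - 2 - (j + 1) + 1),
        T_of_digit_one (iterate_fst_lt h hz (i := p - 2 - (j + 1)) (by lia)) hl h.lt_two
          (omegaBounds h (T_iterate_mem_OmegaE h hz.1.1 _)).left]
  have := key (p - 2) (by lia)
  rw [Nat.sub_self, zero_add, Function.iterate_one, T_of_mem_AE h hz] at this
  rw [← this, tauE, neg_one_div_le_iff (neg_of_mem_DE h hz.1)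
    (by linarith [neg_half_le_G_iterate h hτ (j := p - 2) (by lia)])]

lemma mem_AE_of_le (h : Geom l p) (hz : z ∈ DE l p) (ht : -2 / (3 * l) ≤ z.1) : z ∈ AE l p :=
  ⟨hz, ht, (lt_of_mem_DE h hz).le⟩

lemma AEk_succ_subset (h : Geom l p) (k : ℕ) : AEk l p (k + 1) ⊆ AEk l p k := by
  induction k with
  | zero => exact fun z hz => ⟨hz.1, hz.1.2.1⟩
  | succ k ih =>
    intro z hz
    have h1 := (tauE_succ_le_iff h hz.1 (k + 1)).mp hz.2
    have h2 : (T l)^[p - 1] z ∈ AEk l p (k + 1) :=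
      ⟨mem_AE_of_le h (iterate_mem_DE h hz.1) ((le_tauE h _).trans h1), h1⟩
    exact ⟨hz.1, (tauE_succ_le_iff h hz.1 k).mpr (ih h2).2⟩

lemma stay_iff_of_mem_AE (h : Geom l p) (hz : z ∈ AE l p) (m : ℕ) :
    Stay l (m + (p - 1)) z ↔ Stay l m ((T l)^[p - 1] z) :=
  stay_add_iff fun _ hi => half_lt_Th_iterate h hz (by lia)

lemma le_of_stay (h : Geom l p) (hz : z ∈ AE l p) {m : ℕ} (hm : Stay l m z) : p - 1 ≤ m := by
  by_contra! hlt
  exact (half_lt_Th_iterate h hz (i := m + 1) (by lia)).not_gt hm.2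

lemma dvd_of_stay (h : Geom l p) {m : ℕ} (hz : z ∈ DE l p) (ht : -1 / l ≤ z.1)
    (hm : Stay l m z) : p - 1 ∣ m := by
  induction m using Nat.strong_induction_on generalizing z with
  | _ m ih =>
    rcases lt_or_ge z.1 (-2 / (3 * l)) with hlt | hge
    · rw [hm.unique (stay_zero h hz ht hlt)]
      exact dvd_zero _
    · have hA := mem_AE_of_le h hz hge
      obtain ⟨n, rfl⟩ := Nat.exists_eq_add_of_le' (le_of_stay h hA hm)
      have hp := h.two_le
      exact (ih n (by lia) (iterate_mem_DE h hA) (neg_inv_le_iterate_fst h hA)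
        ((stay_iff_of_mem_AE h hA n).mp hm)).add (dvd_refl _)

lemma stay_mul_iff (h : Geom l p) (hz : z ∈ DE l p) (ht : -1 / l ≤ z.1) (k : ℕ) :
    Stay l (k * (p - 1)) z ↔ z.1 < tauE l p k ∧ (k ≠ 0 → tauE l p (k - 1) ≤ z.1) := by
  have hp := h.two_le
  induction k generalizing z with
  | zero =>
    simp only [zero_mul, ne_eq, not_true_eq_false, false_imp_iff, and_true, tauE]
    refine ⟨fun hs => ?_, stay_zero h hz ht⟩
    by_contra! hge
    have := le_of_stay h (mem_AE_of_le h hz hge) hs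
    lia
  | succ k ih =>
    rcases lt_or_ge z.1 (-2 / (3 * l)) with hlt | hge
    · refine iff_of_false (fun hs => ?_) fun hs => ?_
      · have := hs.unique (stay_zero h hz ht hlt)
        rcases Nat.mul_eq_zero.mp this with h0 | h0 <;> lia
      · have := hs.2 (by lia)
        rw [Nat.add_sub_cancel] at this
        linarith [le_tauE h k]
    · have hA := mem_AE_of_le h hz hge
      have e := ih (iterate_mem_DE h hA) (neg_inv_le_iterate_fst h hA)
      rw [Nat.succ_mul, stay_iff_of_mem_AE h hA]
      refine e.trans ?_
      rw [← not_le, ← not_le,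
        ← tauE_succ_le_iff h hA, Nat.add_sub_cancel]
      refine and_congr_right fun _ => ?_
      rcases k with _ | k
      · simpa [tauE] using hge
      · simp only [ne_eq, Nat.add_eq_zero_iff, one_ne_zero, and_false, not_false_eq_true,
          true_imp_iff, Nat.add_sub_cancel]
        exact (tauE_succ_le_iff h hA k).symm

lemma neg_inv_le_of_stay (h : Geom l p) {k : ℕ} (hk : 1 ≤ k) (hz : z ∈ DE l p)
    (hs : Stay l (k * (p - 1)) z) : -1 / l ≤ z.1 := by
  have hl := h.pos
  have hneg := neg_of_mem_DE h hz
  obtain ⟨i, hi, h1, h2, -⟩ | h1 := mem_OmegaE_iff.mp hz.1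
  swap
  · linarith
  by_contra! hlt
  have hip : i + 2 < p := by
    by_contra! hge
    rw [show i = p - 2 by lia, h.phi_pred_pred] at h1
    linarith
  have hΩ := T_iterate_mem_OmegaE h hz.1
  have key : ∀ j, i + j + 2 ≤ p →
      phi l (i + j) ≤ ((T l)^[j] z).1 ∧ ((T l)^[j] z).1 < phi l (i + j + 1) := by
    intro j hj
    induction j with
    | zero => exact ⟨h1, h2⟩
    | succ j ih =>
      obtain ⟨h3, h4⟩ := ih (by lia)
      have h5 := h.phi_le (i + j + 1) (by lia)
      have h6 : ((T l)^[j] z).1 < -2 / (3 * l) := by linarith [h.neg_inv_lt]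
      rw [Function.iterate_succ_apply']
      refine ⟨phi_le_T_fst h (hΩ j) (by lia) h6 h3, ?_⟩
      rw [T_of_digit_one h6 hl h.lt_two (omegaBounds h (hΩ j)).left, ← add_assoc,
        h.phi_succ (i + j + 1) (by lia)]
      have := one_div_lt_one_div_of_neg_of_lt (h.phi_neg (j := i + j + 1) (by lia)) h4
      simp only [neg_div]
      linarith
  obtain ⟨a, rfl⟩ : ∃ a, p = i + (a + 1) + 2 := ⟨p - i - 3, by lia⟩
  obtain ⟨h3, -⟩ := key (a + 1) le_rfl
  obtain ⟨h4, h5⟩ := key a (by lia)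
  have h6 := h.phi_neg (j := i + a + 1) (by lia)
  have hle : a + 1 ≤ k * (i + (a + 1) + 2 - 1) := by
    calc a + 1 ≤ 1 * (i + (a + 1) + 2 - 1) := by lia
      _ ≤ _ := Nat.mul_le_mul_right _ hk
  have hD : (T l)^[a + 1] z ∈ DE l (i + (a + 1) + 2) := by
    rw [Function.iterate_succ_apply']
    refine T_mem_DE h (hΩ a) (by linarith) (hs.1 _ (by lia)) ?_
    rw [← Function.iterate_succ_apply' (T l)]
    exact hs.1 _ hle
  have hphi := h.phi_pred_pred
  rw [show i + (a + 1) + 2 - 2 = i + (a + 1) by lia] at hphi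
  rw [hphi] at h3
  obtain ⟨b, hb⟩ := Nat.exists_eq_add_of_le' hle
  rw [hb] at hs
  have hdvd := dvd_of_stay h hD h3 ((stay_add_iff fun j hj => hs.1 j (by lia)).mp hs)
  have h7 : (i + (a + 1) + 2 - 1) ∣ a + 1 :=
    (Nat.dvd_add_right hdvd).mp (hb ▸ Dvd.intro_left k rfl)
  have := Nat.le_of_dvd (by lia) h7
  lia

/-- Blocks of `k (p - 1) + 2` large coefficients start exactly in `A_{k-1} \ A_k`. -/
lemma mem_DE_and_stay_iff (h : Geom l p) {k : ℕ} (hk : 1 ≤ k) :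
    z ∈ DE l p ∧ Stay l (k * (p - 1)) z ↔ z ∈ AEk l p (k - 1) \ AEk l p k := by
  constructor
  · rintro ⟨hz, hs⟩
    obtain ⟨h1, h2⟩ := (stay_mul_iff h hz (neg_inv_le_of_stay h hk hz hs) k).mp hs
    have h3 := h2 (by lia)
    exact ⟨⟨mem_AE_of_le h hz ((le_tauE h _).trans h3), h3⟩, fun h4 => h4.2.not_gt h1⟩
  · rintro ⟨⟨h1, h2⟩, h3⟩
    refine ⟨h1.1, (stay_mul_iff h h1.1 (h.neg_inv_lt.le.trans h1.2.1) k).mpr ⟨?_, fun _ => h2⟩⟩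
    by_contra! h4
    exact h3 ⟨h1, h4⟩

end Returns

section Convergents

variable {l x : ℝ} {p : ℕ}

lemma T_iterate_fst (z : ℝ × ℝ) (n : ℕ) : ((T l)^[n] z).1 = (f l)^[n] z.1 := by
  induction n with
  | zero => rfl
  | succ n ih => rw [Function.iterate_succ_apply', Function.iterate_succ_apply', ← ih, T]

/-- The standard relations between the convergents and the natural extension orbit. -/
lemma RS_spec (h : Geom l p) (hx : Irr l x) (hx1 : x ∈ Set.Ico (-(l / 2)) (l / 2)) (n : ℕ) :
    0 < (RS l x n).2.2 ∧ (tv l x n).2 = (RS l x n).2.1 / (RS l x n).2.2 ∧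
      x * ((RS l x n).2.2 + (tv l x n).1 * (RS l x n).2.1) =
        (RS l x n).1.2 + (tv l x n).1 * (RS l x n).1.1 ∧
      |(RS l x n).1.1 * (RS l x n).2.2 - (RS l x n).1.2 * (RS l x n).2.1| = 1 := by
  have hΩ : (x, (0 : ℝ)) ∈ OmegaE l p :=
    mem_OmegaE_of_le h hx1 le_rfl (by have := h.pos; positivity)
  induction n with
  | zero => simp [RS, tv]
  | succ n ih =>
    obtain ⟨h1, h2, h3, h4⟩ := ih
    have hfst : (tv l x n).1 = (f l)^[n] x := T_iterate_fst (x, 0) n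
    have ht : (tv l x n).1 ≠ 0 := hfst ▸ hx n
    have hpos := T_snd_spec h (T_iterate_mem_OmegaE h hΩ n) ht
    change 0 < digit l (tv l x n).1 * l + Real.sign (tv l x n).1 * (tv l x n).2 at hpos
    have hsucc : tv l x (n + 1) = T l (tv l x n) := Function.iterate_succ_apply' _ _ _
    have hT1 : (T l (tv l x n)).1 = 1 / |(tv l x n).1| - l * digit l (tv l x n).1 := f_eq_digit ht
    have hT2 : (T l (tv l x n)).2 =
      1 / (digit l (tv l x n).1 * l + Real.sign (tv l x n).1 * (tv l x n).2) := rfl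
    have hr : rr l x (n + 1) = digit l (tv l x n).1 := by rw [hfst]; rfl
    have he : eps l x (n + 1) = Real.sign (tv l x n).1 := by rw [hfst]; rfl
    rw [hsucc, hT1, hT2, RS, hr, he]
    simp only
    obtain ⟨e, he1, het⟩ : ∃ e : ℝ, |e| = 1 ∧ Real.sign (tv l x n).1 = e ∧
        |(tv l x n).1| = e * (tv l x n).1 := by
      rcases lt_or_gt_of_ne ht with ht | ht
      · exact ⟨-1, by simp, Real.sign_of_neg ht, by rw [abs_of_neg ht]; ring⟩
      · exact ⟨1, by simp, Real.sign_of_pos ht, by rw [abs_of_pos ht]; ring⟩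
    have hee : e * e = 1 := by rw [← abs_mul_abs_self, he1, one_mul]
    have hinv : 1 / |(tv l x n).1| = e / (tv l x n).1 := by
      have : e ≠ 0 := by rintro rfl; simp at he1
      rw [het.2, div_eq_div_iff (mul_ne_zero this ht) ht]
      linear_combination (-(tv l x n).1) * hee
    rw [hinv]
    rw [het.1] at hpos ⊢
    generalize (digit l (tv l x n).1 : ℝ) = r at *
    generalize (RS l x n).1.1 = R at *
    generalize (RS l x n).1.2 = R' at *
    generalize (RS l x n).2.1 = S at *
    generalize (RS l x n).2.2 = S' at *
    rw [h2] at hpos ⊢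
    generalize (tv l x n).1 = t at *
    have hS : r * l * S' + e * S = S' * (r * l + e * (S / S')) := by field_simp
    refine ⟨hS ▸ mul_pos h1 hpos, ?_, ?_, ?_⟩
    · rw [hS, div_mul_cancel_left₀ h1.ne', one_div]
    · field_simp
      linear_combination e * h3
    · rw [← h4, ← one_mul |R * S' - R' * S|, ← he1, ← abs_mul, ← abs_neg]
      congr 1
      ring

lemma theta_eq_Th (h : Geom l p) (hx : Irr l x) (hx1 : x ∈ Set.Ico (-(l / 2)) (l / 2)) (n : ℕ) :
    theta l x n = Th ((T l)^[n] (x, 0)) := by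
  obtain ⟨h1, h2, h3, h4⟩ := RS_spec h hx hx1 n
  have hΩ : (x, (0 : ℝ)) ∈ OmegaE l p :=
    mem_OmegaE_of_le h hx1 le_rfl (by have := h.pos; positivity)
  have hpos := (omegaBounds h (T_iterate_mem_OmegaE h hΩ n)).one_add_mul_pos h
  change theta l x n = Th (tv l x n)
  change 0 < 1 + (tv l x n).1 * (tv l x n).2 at hpos
  rw [theta, Rnum, Snum, Th]
  rw [h2] at hpos ⊢
  generalize (RS l x n).1.1 = R at *
  generalize (RS l x n).1.2 = R' at *
  generalize (RS l x n).2.1 = S at *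
  generalize (RS l x n).2.2 = S' at *
  generalize (tv l x n).1 = t at *
  have h5 : 1 + t * (S / S') = (S' + t * S) / S' := by field_simp
  rw [h5] at hpos ⊢
  have h6 : 0 < S' + t * S := (div_pos_iff_of_pos_right h1).mp hpos
  have h7 : x - R' / S' = t * (R * S' - R' * S) / ((S' + t * S) * S') := by
    rw [eq_div_iff (by positivity)]
    field_simp
    linear_combination S' * h3
  rw [h7, abs_div, abs_mul, h4, abs_of_pos (mul_pos h6 h1)]
  field_simp

end Convergents

section Invariance

variable {l : ℝ} {p : ℕ} {z : ℝ × ℝ}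

lemma measurable_digit : Measurable (digit l) := by
  unfold digit
  exact Int.measurable_floor.comp (by fun_prop)

lemma measurable_f : Measurable (f l) := by
  have : f l = fun x => if x = 0 then 0 else 1 / |x| - l * (digit l x : ℝ) := by
    funext x
    rfl
  rw [this]
  refine Measurable.ite (measurableSet_singleton 0) measurable_const ?_
  have : Measurable fun x => (digit l x : ℝ) := (measurable_from_top).comp measurable_digit
  fun_prop

lemma measurable_sign : Measurable Real.sign := by
  unfold Real.sign
  exact Measurable.ite measurableSet_Iio measurable_const
    (Measurable.ite measurableSet_Ioi measurable_const measurable_const)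

lemma measurable_T : Measurable (T l) := by
  have h1 : Measurable fun z : ℝ × ℝ => (digit l z.1 : ℝ) :=
    (measurable_from_top (f := fun n : ℤ => (n : ℝ))).comp (measurable_digit.comp measurable_fst)
  have h2 : Measurable fun z : ℝ × ℝ => Real.sign z.1 := measurable_sign.comp measurable_fst
  refine (measurable_f.comp measurable_fst).prodMk ?_
  exact ((h1.mul_const l).add (h2.mul measurable_snd)).const_div 1

lemma measurable_Th : Measurable Th := by
  unfold Th
  fun_prop

lemma measurableSet_OmegaE : MeasurableSet (OmegaE l p) :=
  (Finset.measurableSet_biUnion _ fun _ _ => measurableSet_Ico.prod measurableSet_Icc).union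
    (measurableSet_Ico.prod measurableSet_Icc)

/-- The points where the natural extension map is invertible. -/
def OmegaReg (l : ℝ) (p : ℕ) : Set (ℝ × ℝ) := {z ∈ OmegaE l p | z.1 ≠ 0 ∧ 0 < z.2 ∧ z.2 < 1}

lemma measurableSet_OmegaReg : MeasurableSet (OmegaReg l p) := by
  refine measurableSet_OmegaE.inter (MeasurableSet.inter ?_ (MeasurableSet.inter ?_ ?_))
  · exact (measurable_fst (measurableSet_singleton 0)).compl
  · exact measurable_snd measurableSet_Ioi
  · exact measurable_snd measurableSet_Iio

/-- The inverse of the natural extension map. -/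
def Tinv (l : ℝ) (w : ℝ × ℝ) : ℝ × ℝ :=
  if 1 / w.2 - ⌊1 / w.2 / l⌋ * l < 1 then
    (1 / (⌊1 / w.2 / l⌋ * l + w.1), 1 / w.2 - ⌊1 / w.2 / l⌋ * l)
  else (-1 / ((⌊1 / w.2 / l⌋ + 1) * l + w.1), l - (1 / w.2 - ⌊1 / w.2 / l⌋ * l))

lemma measurable_Tinv : Measurable (Tinv l) := by
  have h1 : Measurable fun w : ℝ × ℝ => (⌊1 / w.2 / l⌋ : ℝ) :=
    (measurable_from_top (f := fun n : ℤ => (n : ℝ))).comp (Int.measurable_floor.comp (by fun_prop))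
  refine Measurable.ite (measurableSet_lt (by fun_prop) measurable_const) ?_ ?_ <;> fun_prop

lemma Tinv_T (h : Geom l p) (hz : z ∈ OmegaReg l p) : Tinv l (T l z) = z := by
  obtain ⟨hΩ, ht, h0, h1⟩ := hz
  have hl := h.pos
  have hl1 := h.one_lt
  have b := omegaBounds h hΩ
  rcases lt_or_gt_of_ne ht with ht' | ht'
  · have hv := b.le_of_neg ht'
    rw [T_of_neg ht']
    generalize digit l z.1 = r
    have hfl : ⌊1 / (1 / (r * l - z.2)) / l⌋ = r - 1 := by
      rw [one_div_one_div, Int.floor_eq_iff]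
      push_cast
      rw [le_div_iff₀ hl, div_lt_iff₀ hl]
      constructor <;> nlinarith
    rw [Tinv]
    simp only
    rw [hfl, one_div_one_div]
    push_cast
    rw [if_neg (by linarith)]
    refine Prod.ext ?_ ?_ <;> simp only
    · have : (r - 1 + 1) * l + (-1 / z.1 - l * r) = -1 / z.1 := by ring
      rw [this]
      field_simp
    · ring
  · rw [T_of_pos ht']
    generalize digit l z.1 = r
    have hfl : ⌊1 / (1 / (r * l + z.2)) / l⌋ = r := by
      rw [one_div_one_div, Int.floor_eq_iff]
      rw [le_div_iff₀ hl, div_lt_iff₀ hl]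
      constructor <;> nlinarith
    rw [Tinv]
    simp only
    rw [hfl, one_div_one_div, if_pos (by linarith)]
    refine Prod.ext ?_ ?_ <;> simp only
    · have : r * l + (1 / z.1 - l * r) = 1 / z.1 := by ring
      rw [this]
      field_simp
    · ring

lemma injOn_T (h : Geom l p) : Set.InjOn (T l) (OmegaReg l p) :=
  fun z hz w hw e => by rw [← Tinv_T h hz, e, Tinv_T h hw]

/-- The part of the domain with given sign and digit. -/
def piece (l : ℝ) (p : ℕ) (i : ℤ × ℤ) : Set (ℝ × ℝ) :=
  {z ∈ OmegaReg l p | Real.sign z.1 = i.1 ∧ digit l z.1 = i.2}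

lemma measurableSet_piece (i : ℤ × ℤ) : MeasurableSet (piece l p i) := by
  refine measurableSet_OmegaReg.inter (MeasurableSet.inter ?_ ?_)
  · exact measurable_sign.comp measurable_fst (measurableSet_singleton _)
  · exact measurable_digit.comp measurable_fst (measurableSet_singleton _)

lemma iUnion_piece : ⋃ i, piece l p i = OmegaReg l p := by
  ext z
  simp only [Set.mem_iUnion]
  refine ⟨fun ⟨i, hi⟩ => hi.1, fun hz => ?_⟩
  rcases lt_or_gt_of_ne hz.2.1 with ht | ht
  · exact ⟨(-1, digit l z.1), hz, by simp [Real.sign_of_neg ht], rfl⟩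
  · exact ⟨(1, digit l z.1), hz, by simp [Real.sign_of_pos ht], rfl⟩

lemma disjoint_piece : Pairwise (Function.onFun Disjoint (piece l p)) := by
  intro i j hij
  refine Set.disjoint_left.mpr fun z hi hj => hij ?_
  refine Prod.ext ?_ (hi.2.2.symm.trans hj.2.2)
  exact_mod_cast hi.2.1.symm.trans hj.2.1

/-- The invariant density up to normalisation. -/
def rho (c : ℝ) (z : ℝ × ℝ) : ENNReal := ENNReal.ofReal (c / (1 + z.1 * z.2) ^ 2)

lemma measurable_rho (c : ℝ) : Measurable (rho c) := by
  unfold rho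
  fun_prop

lemma lintegral_image_T (h : Geom l p) {c : ℝ} (i : ℤ × ℤ) {X : Set (ℝ × ℝ)}
    (hX : MeasurableSet X) (hXi : X ⊆ piece l p i) :
    MeasurableSet (T l '' X) ∧ ∫⁻ z in T l '' X, rho c z = ∫⁻ z in X, rho c z := by
  let g : ℝ × ℝ → ℝ × ℝ :=
    Prod.map (fun t => i.1 / t - l * i.2) (fun v => 1 / (i.2 * l + i.1 * v))
  let g' : ℝ × ℝ → (ℝ × ℝ →L[ℝ] ℝ × ℝ) := fun z =>
    (ContinuousLinearMap.toSpanSingleton ℝ (-i.1 / z.1 ^ 2 : ℝ)).prodMap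
      (ContinuousLinearMap.toSpanSingleton ℝ (-i.1 / (i.2 * l + i.1 * z.2) ^ 2 : ℝ))
  have hTg : ∀ z ∈ X, T l z = g z := by
    intro z hz
    obtain ⟨⟨-, ht, -⟩, hs, hd⟩ := hXi hz
    refine Prod.ext ?_ ?_
    · change f l z.1 = i.1 / z.1 - l * i.2
      rw [f_eq_digit ht, ← hs, hd]
      rcases lt_or_gt_of_ne ht with ht' | ht'
      · rw [abs_of_neg ht', Real.sign_of_neg ht', div_neg, neg_div]
      · rw [abs_of_pos ht', Real.sign_of_pos ht']
    · change 1 / ((digit l z.1 : ℝ) * l + Real.sign z.1 * z.2) = 1 / (i.2 * l + i.1 * z.2)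
      rw [hs, hd]
  have hsq : ∀ z ∈ X, (i.1 : ℝ) * i.1 = 1 := by
    intro z hz
    obtain ⟨⟨-, ht, -⟩, hs, -⟩ := hXi hz
    rw [← hs]
    rcases lt_or_gt_of_ne ht with ht' | ht'
    · rw [Real.sign_of_neg ht']; norm_num
    · rw [Real.sign_of_pos ht']; norm_num
  have hw : ∀ z ∈ X, 0 < i.2 * l + i.1 * z.2 := by
    intro z hz
    obtain ⟨⟨hΩ, ht, -⟩, hs, hd⟩ := hXi hz
    have := T_snd_spec h hΩ ht
    rwa [hs, hd] at this
  have hg : ∀ z ∈ X, HasFDerivWithinAt g (g' z) X z := by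
    intro z hz
    have ht := (hXi hz).1.2.1
    have hw := (hw z hz).ne'
    refine (HasFDerivAt.prodMap z ?_ ?_).hasFDerivWithinAt
    · have := ((hasDerivAt_inv ht).const_mul (i.1 : ℝ)).sub_const (l * i.2)
      refine HasDerivAt.hasFDerivAt ?_
      simpa only [div_eq_mul_inv, neg_mul, mul_neg] using this
    · have h1 : HasDerivAt (fun v : ℝ => i.2 * l + i.1 * v) (i.1 : ℝ) z.2 := by
        simpa using ((hasDerivAt_id z.2).const_mul (i.1 : ℝ)).const_add (i.2 * l)
      refine HasDerivAt.hasFDerivAt ?_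
      simpa only [one_div] using h1.fun_inv hw
  have hinj : Set.InjOn g X := by
    intro z hz w hw e
    rw [← hTg z hz, ← hTg w hw] at e
    exact injOn_T h (hXi hz).1 (hXi hw).1 e
  rw [Set.image_congr hTg]
  refine ⟨measurable_image_of_fderivWithin hX hg hinj, ?_⟩
  rw [lintegral_image_eq_lintegral_abs_det_fderiv_mul volume hX hg hinj]
  refine setLIntegral_congr_fun hX fun z hz => ?_
  have hdet : (g' z).det = (-i.1 / z.1 ^ 2 : ℝ) * (-i.1 / (i.2 * l + i.1 * z.2) ^ 2 : ℝ) := by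
    rw [ContinuousLinearMap.det]
    erw [LinearMap.det_prodMap]
    exact congrArg₂ _ (ContinuousLinearMap.det_toSpanSingleton _)
      (ContinuousLinearMap.det_toSpanSingleton _)
  have hdet' : (g' z).det = 1 / (z.1 ^ 2 * (i.2 * l + i.1 * z.2) ^ 2) := by
    rw [hdet, div_mul_div_comm, neg_mul_neg, hsq z hz]
  obtain ⟨⟨hΩ, ht, -⟩, -⟩ := hXi hz
  have hw := hw z hz
  have hpos := (omegaBounds h hΩ).one_add_mul_pos h
  have hpos' := (omegaBounds h (T_mem_OmegaE h hΩ)).one_add_mul_pos h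
  rw [hTg z hz] at hpos'
  have hsqz := hsq z hz
  rw [hdet', abs_of_nonneg (by positivity), rho, rho, ← ENNReal.ofReal_mul (by positivity)]
  congr 1
  have hgz : 1 + (g z).1 * (g z).2 = i.1 * (1 + z.1 * z.2) / (z.1 * (i.2 * l + i.1 * z.2)) := by
    change 1 + (i.1 / z.1 - l * i.2) * (1 / (i.2 * l + i.1 * z.2)) = _
    obtain ⟨w, hwe⟩ : ∃ w, i.2 * l + i.1 * z.2 = w := ⟨_, rfl⟩
    rw [hwe] at hw ⊢
    rw [show l * i.2 = w - i.1 * z.2 by rw [← hwe]; ring]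
    field_simp
    ring
  rw [hgz, div_pow, mul_pow, show ((i.1 : ℝ)) ^ 2 = 1 by rw [sq]; exact hsqz]
  field_simp

/-- The natural extension measure with a free normalisation constant. -/
def nuC (l : ℝ) (p : ℕ) (c : ℝ) : Measure (ℝ × ℝ) :=
  (volume.restrict (OmegaE l p)).withDensity (rho c)

lemma nuC_apply {c : ℝ} {B : Set (ℝ × ℝ)} (hB : MeasurableSet B) :
    nuC l p c B = ∫⁻ z in B ∩ OmegaE l p, rho c z := by
  rw [nuC, withDensity_apply _ hB, Measure.restrict_restrict hB]

lemma nuC_absolutelyContinuous {c : ℝ} : nuC l p c ≪ volume.restrict (OmegaE l p) :=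
  withDensity_absolutelyContinuous _ _

lemma volume_snd_eq (a : ℝ) : volume {z : ℝ × ℝ | z.2 = a} = 0 := by
  have : {z : ℝ × ℝ | z.2 = a} = Set.univ ×ˢ {a} := by ext; simp
  rw [this, Measure.volume_eq_prod, Measure.prod_prod]
  simp

lemma volume_fst_eq (a : ℝ) : volume {z : ℝ × ℝ | z.1 = a} = 0 := by
  have : {z : ℝ × ℝ | z.1 = a} = {a} ×ˢ Set.univ := by ext; simp
  rw [this, Measure.volume_eq_prod, Measure.prod_prod]
  simp

lemma ae_mem_OmegaReg (h : Geom l p) : ∀ᵐ z ∂(volume.restrict (OmegaE l p)), z ∈ OmegaReg l p := by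
  rw [ae_restrict_iff' measurableSet_OmegaE]
  have h1 : ∀ᵐ z : ℝ × ℝ, z.1 ≠ 0 := by
    rw [ae_iff]; simpa using volume_fst_eq 0
  have h2 : ∀ᵐ z : ℝ × ℝ, z.2 ≠ 0 := by
    rw [ae_iff]; simpa using volume_snd_eq 0
  have h3 : ∀ᵐ z : ℝ × ℝ, z.2 ≠ 1 := by
    rw [ae_iff]; simpa using volume_snd_eq 1
  filter_upwards [h1, h2, h3] with z h1 h2 h3 hz
  have b := omegaBounds h hz
  exact ⟨hz, h1, lt_of_le_of_ne b.nonneg h2.symm, lt_of_le_of_ne b.le_one h3⟩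

lemma measurePreserving_T (h : Geom l p) {c : ℝ} [IsFiniteMeasure (nuC l p c)] :
    MeasurePreserving (T l) (nuC l p c) (nuC l p c) := by
  refine ⟨measurable_T, ?_⟩
  refine Measure.eq_of_le_of_measure_univ_eq (Measure.le_intro fun B hB _ => ?_)
    (by rw [Measure.map_apply measurable_T MeasurableSet.univ, Set.preimage_univ])
  rw [Measure.map_apply measurable_T hB]
  have hTB := measurable_T (l := l) hB
  have hreg : nuC l p c (T l ⁻¹' B) = ∫⁻ z in T l ⁻¹' B ∩ OmegaReg l p, rho c z := by
    rw [nuC_apply hTB]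
    refine setLIntegral_congr ?_
    have := ae_mem_OmegaReg h
    rw [ae_restrict_iff' measurableSet_OmegaE] at this
    filter_upwards [this] with z hz
    refine propext (and_congr_right fun _ => ⟨hz, fun hz => hz.1⟩)
  let X : ℤ × ℤ → Set (ℝ × ℝ) := fun i => T l ⁻¹' B ∩ piece l p i
  have hX : ∀ i, MeasurableSet (X i) := fun i => hTB.inter (measurableSet_piece i)
  have hdisj : Pairwise (Function.onFun Disjoint X) := fun i j hij =>
    (disjoint_piece hij).mono Set.inter_subset_right Set.inter_subset_right
  have himg := fun i => lintegral_image_T h (c := c) i (hX i) Set.inter_subset_right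
  have hdisj' : Pairwise (Function.onFun Disjoint fun i => T l '' X i) := by
    intro i j hij
    refine Set.disjoint_left.mpr ?_
    rintro _ ⟨z, hz, rfl⟩ ⟨w, hw, e⟩
    have := injOn_T h hw.2.1 hz.2.1 e
    exact Set.disjoint_left.mp (hdisj hij) hz (this ▸ hw)
  rw [hreg, ← iUnion_piece, Set.inter_iUnion, lintegral_iUnion hX hdisj]
  simp_rw [← fun i => (himg i).2]
  rw [← lintegral_iUnion (fun i => (himg i).1) hdisj', nuC_apply hB]
  refine lintegral_mono_set (Set.iUnion_subset fun i => ?_)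
  rintro _ ⟨z, hz, rfl⟩
  exact ⟨hz.1, T_mem_OmegaE h hz.2.1.1⟩

lemma measurePreserving_Tinv (h : Geom l p) {c : ℝ} [IsFiniteMeasure (nuC l p c)] :
    MeasurePreserving (Tinv l) (nuC l p c) (nuC l p c) := by
  refine ⟨measurable_Tinv, ?_⟩
  conv_lhs => rw [← (measurePreserving_T h (c := c)).map_eq]
  rw [Measure.map_map measurable_Tinv measurable_T]
  conv_rhs => rw [← Measure.map_id (μ := nuC l p c)]
  refine Measure.map_congr ?_
  filter_upwards [nuC_absolutelyContinuous.ae_le (ae_mem_OmegaReg h)] with z hz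
  exact Tinv_T h hz

end Invariance

section TotalMass

lemma lintegral_Icc_of_hasDerivAt {a b : ℝ} (hab : a ≤ b) {F g : ℝ → ℝ}
    (hF : ∀ x ∈ Set.Icc a b, HasDerivAt F (g x) x) (hg : ContinuousOn g (Set.Icc a b))
    (h0 : ∀ x ∈ Set.Icc a b, 0 ≤ g x) :
    ∫⁻ x in Set.Icc a b, ENNReal.ofReal (g x) = ENNReal.ofReal (F b - F a) := by
  have hi : IntervalIntegrable g volume a b := by
    apply ContinuousOn.intervalIntegrable
    rwa [Set.uIcc_of_le hab]
  rw [← intervalIntegral.integral_eq_sub_of_hasDerivAt (by rwa [Set.uIcc_of_le hab]) hi,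
    intervalIntegral.integral_of_le hab, ← integral_Icc_eq_integral_Ioc]
  refine (ofReal_integral_eq_lintegral_ofReal hg.integrableOn_Icc ?_).symm
  exact (ae_restrict_iff' measurableSet_Icc).mpr (ae_of_all _ h0)

lemma one_add_mul_pos_of_le {a t h v : ℝ} (ha : 0 < 1 + a * h) (hat : a ≤ t) (hv : 0 ≤ v)
    (hvh : v ≤ h) : 0 < 1 + t * v := by
  rcases le_or_gt 0 t with ht | ht
  · positivity
  · nlinarith

lemma lintegral_rho_rectangle {a b h c : ℝ} (hab : a ≤ b) (hh : 0 ≤ h) (hc : 0 ≤ c)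
    (ha : 0 < 1 + a * h) :
    ∫⁻ z in Set.Ico a b ×ˢ Set.Icc 0 h, rho c z =
      ENNReal.ofReal (c * log ((1 + b * h) / (1 + a * h))) := by
  have hpos : ∀ t ∈ Set.Icc a b, ∀ v ∈ Set.Icc 0 h, 0 < 1 + t * v := fun t ht v hv =>
    one_add_mul_pos_of_le ha ht.1 hv.1 hv.2
  have hmem : h ∈ Set.Icc 0 h := ⟨hh, le_rfl⟩
  rw [Measure.volume_eq_prod, ← Measure.prod_restrict,
    lintegral_prod _ (measurable_rho c).aemeasurable]
  rw [setLIntegral_congr Ico_ae_eq_Icc]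
  have inner : ∀ t ∈ Set.Icc a b, ∫⁻ v in Set.Icc 0 h, rho c (t, v) =
      ENNReal.ofReal (c * h / (1 + t * h)) := by
    intro t ht
    have := lintegral_Icc_of_hasDerivAt (F := fun v => c * v / (1 + t * v))
      (g := fun v => c / (1 + t * v) ^ 2) hh ?_ ?_ ?_
    · simpa [rho] using this
    · intro v hv
      have hp := (hpos t ht v hv).ne'
      have h1 : HasDerivAt (fun v => c * v) c v := by simpa using (hasDerivAt_id v).const_mul c
      have h2 : HasDerivAt (fun v => 1 + t * v) t v := by
        simpa using ((hasDerivAt_id v).const_mul t).const_add 1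
      exact (h1.div h2 hp).congr_deriv (by ring)
    · exact ContinuousOn.div (by fun_prop) (by fun_prop)
        fun v hv => pow_ne_zero 2 (hpos t ht v hv).ne'
    · intro v _
      positivity
  rw [setLIntegral_congr_fun measurableSet_Icc inner,
    lintegral_Icc_of_hasDerivAt (F := fun t => c * log (1 + t * h)) hab]
  · rw [Real.log_div (hpos b ⟨hab, le_rfl⟩ h hmem).ne' ha.ne']
    ring_nf
  · intro t ht
    have h2 : HasDerivAt (fun t => 1 + t * h) h t := by
      simpa using ((hasDerivAt_id t).mul_const h).const_add 1
    exact ((h2.log (hpos t ht h hmem).ne').const_mul c).congr_deriv (by ring)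
  · exact ContinuousOn.div (by fun_prop) (by fun_prop) fun t ht => (hpos t ht h hmem).ne'
  · intro t ht
    have := hpos t ht h hmem
    positivity

lemma OmegaE_eq_union_range (l : ℝ) (p : ℕ) :
    OmegaE l p = (⋃ i ∈ Finset.range (p - 1),
      Set.Ico (phi l i) (phi l (i + 1)) ×ˢ Set.Icc 0 (LE l (i + 1))) ∪
        Set.Ico (0 : ℝ) (l / 2) ×ˢ Set.Icc (0 : ℝ) 1 := by
  ext z
  simp only [mem_OmegaE_iff, Set.mem_union, Set.mem_iUnion, Finset.mem_range, Set.mem_prod,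
    Set.mem_Ico, Set.mem_Icc, exists_prop, and_assoc]
  refine or_congr (exists_congr fun i => and_congr_left fun _ => by lia) Iff.rfl

lemma lintegral_rho_OmegaE {l : ℝ} {p : ℕ} (h : Geom l p) {c : ℝ} (hc : 0 ≤ c) :
    ∫⁻ z in OmegaE l p, rho c z =
      (∑ i ∈ Finset.range (p - 1), ENNReal.ofReal (c * log ((1 + phi l (i + 1) * LE l (i + 1)) /
        (1 + phi l i * LE l (i + 1))))) + ENNReal.ofReal (c * log (1 + l / 2)) := by
  have hl := h.pos
  have hl2 := h.lt_two
  have hmono : ∀ i ∈ Finset.range (p - 1), phi l i < phi l (i + 1) ∧ phi l (i + 1) ≤ 0 := by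
    intro i hi
    rw [Finset.mem_range] at hi
    refine ⟨h.phi_lt_succ (by lia), ?_⟩
    rw [← h.phi_pred]
    exact h.phi_mono (by lia) (by lia)
  rw [OmegaE_eq_union_range, lintegral_union (measurableSet_Ico.prod measurableSet_Icc) ?_,
    lintegral_biUnion_finset ?_ fun i _ => measurableSet_Ico.prod measurableSet_Icc]
  · congr 1
    · refine Finset.sum_congr rfl fun i hi => ?_
      obtain ⟨h1, h2⟩ := hmono i hi
      rw [Finset.mem_range] at hi
      have h3 := h.LE_nonneg (i + 1) (by lia) (by lia)
      have h4 := h.LE_lt_one (i + 1) (by lia) (by lia)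
      have h5 := h.phi_mono (Nat.zero_le i) (by lia)
      rw [h.phi_zero] at h5
      exact lintegral_rho_rectangle h1.le h3.le hc (by nlinarith)
    · rw [lintegral_rho_rectangle (by linarith) zero_le_one hc (by norm_num)]
      norm_num
  · intro i hi j hj hij
    rw [Function.onFun, Set.disjoint_left]
    rintro z ⟨hz, -⟩ ⟨hz', -⟩
    simp only [Finset.coe_range, Set.mem_Iio] at hi hj
    rcases lt_or_gt_of_ne hij with hlt | hlt
    · have := h.phi_mono (i := i + 1) (j := j) (by lia) (by lia)
      linarith [hz.2, hz'.1]
    · have := h.phi_mono (i := j + 1) (j := i) (by lia) (by lia)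
      linarith [hz'.2, hz.1]
  · rw [Set.disjoint_left]
    intro z hz hz'
    simp only [Set.mem_iUnion, exists_prop] at hz
    obtain ⟨i, hi, hz, -⟩ := hz
    linarith [hz.2, hz'.1.1, (hmono i hi).2]

lemma one_add_phi_mul_LE_ratio {p : ℕ} {θ : ℝ} (hp : 2 ≤ p) (hθ : θ * p = π / 2) {i : ℕ}
    (hi : i + 2 ≤ p) :
    (1 + phi (2 * cos θ) (i + 1) * LE (2 * cos θ) (i + 1)) /
        (1 + phi (2 * cos θ) i * LE (2 * cos θ) (i + 1)) =
      cos (i * θ) / cos ((i + 1) * θ) := by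
  have hip : (i : ℝ) + 2 ≤ p := by exact_mod_cast hi
  have hi0 : (0 : ℝ) ≤ i := Nat.cast_nonneg i
  have hθ0 := theta_pos hp hθ
  have c0 := cos_mul_pos hp hθ (x := i) hi0 (by linarith)
  have c1 := cos_mul_pos hp hθ (x := i + 1) (by linarith) (by linarith)
  have s1 := sin_mul_pos hp hθ (x := i + 1 / 2) (by linarith) (by linarith)
  have s2 := sin_mul_pos hp hθ (x := i + 1 / 2 + 1) (by linarith) (by linarith)
  rw [phi_eq_cos_div hp hθ (by lia), phi_eq_cos_div hp hθ (by lia), LE_eq_sin_div hp hθ hi]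
  push_cast
  have hd : 0 < sin (2 * (θ / 2)) * cos (θ / 2) := by
    have h1 := sin_mul_pos hp hθ (x := 1) one_pos (by linarith)
    have h2 := cos_mul_pos hp hθ (x := 1 / 2) (by norm_num) (by linarith)
    rw [show 2 * (θ / 2) = 1 * θ by ring, show θ / 2 = 1 / 2 * θ by ring]
    positivity
  rw [show (i + 1 + 1 : ℝ) * θ = (i + 1) * θ + 2 * (θ / 2) by ring]
  rw [show (i : ℝ) * θ = (i + 1) * θ - 2 * (θ / 2) by ring] at c0 ⊢
  rw [show (i + 1 / 2 : ℝ) * θ = (i + 1) * θ - θ / 2 by ring] at s1 ⊢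
  rw [show (i + 1 / 2 + 1 : ℝ) * θ = (i + 1) * θ + θ / 2 by ring] at s2 ⊢
  generalize (i + 1 : ℝ) * θ = A at *
  generalize θ / 2 = d at *
  have h1 : cos A * sin (A + d) - cos (A + 2 * d) * sin (A - d) = sin (2 * d) * cos d := by
    rw [cos_add A, sin_add, sin_sub, cos_two_mul, sin_two_mul]
    linear_combination (2 * sin d * cos d ^ 2) * sin_sq_add_cos_sq A -
      (2 * cos A * sin A * cos d) * sin_sq_add_cos_sq d
  have h2 : cos (A - 2 * d) * sin (A + d) - cos A * sin (A - d) = sin (2 * d) * cos d := by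
    rw [cos_sub A, sin_add, sin_sub, cos_two_mul, sin_two_mul]
    linear_combination (2 * sin d * cos d ^ 2) * sin_sq_add_cos_sq A +
      (2 * cos A * sin A * cos d) * sin_sq_add_cos_sq d
  have e1 : 1 + -(cos (A + 2 * d) / cos A) * (sin (A - d) / sin (A + d)) =
      sin (2 * d) * cos d / (cos A * sin (A + d)) := by
    rw [← h1]
    field_simp
    ring
  have e2 : 1 + -(cos A / cos (A - 2 * d)) * (sin (A - d) / sin (A + d)) =
      sin (2 * d) * cos d / (cos (A - 2 * d) * sin (A + d)) := by
    rw [← h2]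
    field_simp
    ring
  rw [e1, e2]
  generalize sin (2 * d) * cos d = x at *
  field_simp

lemma isProbabilityMeasure_nuC {p : ℕ} {θ : ℝ} (hp : 2 ≤ p) (hθ : θ * p = π / 2) :
    0 < 1 / log ((1 + cos θ) / sin θ) ∧
      IsProbabilityMeasure (nuC (2 * cos θ) p (1 / log ((1 + cos θ) / sin θ))) := by
  have h := geom_two_mul_cos hp hθ
  have hp' : (2 : ℝ) ≤ p := by exact_mod_cast hp
  have hc := cos_theta_pos hp hθ
  have hs : 0 < sin θ := by simpa using sin_mul_pos hp hθ (x := 1) one_pos (by linarith)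
  have hlog : 0 < log ((1 + cos θ) / sin θ) := by
    apply log_pos
    rw [one_lt_div hs]
    linarith [sin_le_one θ]
  refine ⟨by positivity, ⟨?_⟩⟩
  rw [nuC_apply MeasurableSet.univ, Set.univ_inter]
  set c := 1 / log ((1 + cos θ) / sin θ)
  have hc0 : 0 ≤ c := by positivity
  have hcos : ∀ i ≤ p - 1, 0 < cos (i * θ) := fun i hi =>
    cos_mul_pos hp hθ (by positivity) (by exact_mod_cast (show i < p by lia))
  have hterm : ∀ i ∈ Finset.range (p - 1),
      log ((1 + phi (2 * cos θ) (i + 1) * LE (2 * cos θ) (i + 1)) /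
        (1 + phi (2 * cos θ) i * LE (2 * cos θ) (i + 1))) =
      log (cos (i * θ)) - log (cos ((i + 1 : ℕ) * θ)) := by
    intro i hi
    rw [Finset.mem_range] at hi
    rw [one_add_phi_mul_LE_ratio hp hθ (by lia), ← Nat.cast_succ,
      log_div (hcos i (by lia)).ne' (hcos (i + 1) (by lia)).ne']
  have hnonneg : ∀ i ∈ Finset.range (p - 1),
      0 ≤ c * (log (cos (i * θ)) - log (cos ((i + 1 : ℕ) * θ))) := by
    intro i hi
    rw [Finset.mem_range] at hi
    have hθ0 := theta_pos hp hθ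
    have h1 : (i : ℝ) + 2 ≤ p := by exact_mod_cast (show i + 2 ≤ p by lia)
    refine mul_nonneg hc0 (sub_nonneg.mpr (log_le_log (hcos _ (by lia)) ?_))
    refine cos_le_cos_of_nonneg_of_le_pi (by positivity) ?_ ?_
    · push_cast
      nlinarith [pi_pos]
    · gcongr
      simp
  rw [lintegral_rho_OmegaE h hc0, Finset.sum_congr rfl fun i hi => by rw [hterm i hi],
    ← ENNReal.ofReal_sum_of_nonneg hnonneg, ← ENNReal.ofReal_add (Finset.sum_nonneg hnonneg),
    ← Finset.mul_sum, Finset.sum_range_sub' (fun i : ℕ => log (cos (i * θ)))]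
  · have hsin : cos (((p - 1 : ℕ) : ℝ) * θ) = sin θ := by
      rw [Nat.cast_sub (by lia), Nat.cast_one, sub_mul, one_mul, mul_comm, hθ, cos_pi_div_two_sub]
    rw [hsin]
    have : c * log ((1 + cos θ) / sin θ) = 1 := by simp only [c]; field_simp
    rw [log_div (by positivity) hs.ne'] at this
    norm_num
    linarith
  · exact mul_nonneg hc0 (log_nonneg (by linarith))

end TotalMass

section Ergodicity

variable {l : ℝ} {p : ℕ}

/-- The contraction rate of `T` in the vertical direction. -/
def rate (l : ℝ) : ℝ := max (1 / l) ((l - 1) ^ 2)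

lemma rate_nonneg (l : ℝ) : 0 ≤ rate l := (sq_nonneg _).trans (le_max_right _ _)

lemma Geom.rate_lt_one (h : Geom l p) : rate l < 1 := by
  refine max_lt ?_ ?_
  · rw [div_lt_one h.pos]
    exact h.one_lt
  · nlinarith [h.one_lt, h.lt_two]

def weight (l t : ℝ) : ℝ := if t < 0 then 1 else 1 / l

lemma T_snd_sub (h : Geom l p) {z w : ℝ × ℝ} (hz : z ∈ OmegaE l p) (hw : w ∈ OmegaE l p)
    (e : z.1 = w.1) (ht : z.1 ≠ 0) :
    |(T l z).2 - (T l w).2| = |z.2 - w.2| * ((T l z).2 * (T l w).2) := by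
  have h1 := T_snd_spec h hz ht
  have h2 := T_snd_spec h hw (e ▸ ht)
  have e1 : (T l z).2 = 1 / (digit l z.1 * l + Real.sign z.1 * z.2) := rfl
  have e2 : (T l w).2 = 1 / (digit l w.1 * l + Real.sign w.1 * w.2) := rfl
  rw [← e] at h2 e2
  have key : (T l z).2 - (T l w).2 =
      Real.sign z.1 * ((w.2 - z.2) * ((T l z).2 * (T l w).2)) := by
    rw [e1, e2]
    field_simp
    ring
  have hs : |Real.sign z.1| = 1 := by
    rcases Real.sign_apply_eq_of_ne_zero z.1 ht with h | h <;> simp [h]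
  have h3 : 0 ≤ (T l z).2 := (omegaBounds h (T_mem_OmegaE h hz)).nonneg
  have h4 : 0 ≤ (T l w).2 := (omegaBounds h (T_mem_OmegaE h hw)).nonneg
  rw [key, abs_mul, hs, one_mul, abs_mul, abs_of_nonneg (mul_nonneg h3 h4), abs_sub_comm]

lemma T_snd_le_of_pos (h : Geom l p) {z : ℝ × ℝ} (hz : z ∈ OmegaE l p) (ht : 0 < z.1) :
    (T l z).2 ≤ 1 / l := by
  have b := omegaBounds h hz
  have := b.nonneg
  have hd : (1 : ℝ) ≤ digit l z.1 := by
    exact_mod_cast one_le_digit h.pos h.lt_two ht.ne' b.abs_le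
  rw [T_of_pos ht]
  exact one_div_le_one_div_of_le h.pos (by nlinarith [h.pos])

lemma weight_mul_T_snd_sub_le (h : Geom l p) {z w : ℝ × ℝ} (hz : z ∈ OmegaE l p)
    (hw : w ∈ OmegaE l p) (e : z.1 = w.1) :
    weight l (T l z).1 * |(T l z).2 - (T l w).2| ≤ rate l * (weight l z.1 * |z.2 - w.2|) := by
  have hl := h.pos
  have hl1 := h.one_lt
  have hil : 1 / l ≤ 1 := by rw [div_le_one hl]; exact hl1.le
  have hil0 : 0 ≤ 1 / l := by positivity
  have hwt : 0 ≤ weight l z.1 := by unfold weight; split_ifs <;> positivity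
  have r1 : 1 / l ≤ rate l := le_max_left _ _
  have r2 : (l - 1) ^ 2 ≤ rate l := le_max_right _ _
  have hΔ := abs_nonneg (z.2 - w.2)
  rcases eq_or_ne z.1 0 with ht | ht
  · rw [T_of_zero ht, T_of_zero (e ▸ ht), sub_self, abs_zero, mul_zero]
    exact mul_nonneg (rate_nonneg l) (mul_nonneg hwt hΔ)
  rw [T_snd_sub h hz hw e ht, mul_left_comm, ← mul_assoc (rate l), mul_comm |z.2 - w.2|]
  refine mul_le_mul_of_nonneg_right ?_ hΔ
  have bz := omegaBounds h (T_mem_OmegaE h hz)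
  have bw := omegaBounds h (T_mem_OmegaE h hw)
  have eT : (T l z).1 = (T l w).1 := by simp [T, e]
  have hz0 := bz.nonneg
  have hw0 := bw.nonneg
  rcases lt_or_gt_of_ne ht with ht | ht
  · rw [weight, weight, if_pos ht, mul_one]
    split_ifs with h'
    · refine le_trans ?_ r2
      rw [one_mul, sq]
      exact mul_le_mul (bz.le_of_neg h') (bw.le_of_neg (eT ▸ h')) hw0 (by linarith)
    · refine le_trans ?_ r1
      exact mul_le_of_le_one_right hil0 (mul_le_one₀ bz.le_one hw0 bw.le_one)
  · have hzl := T_snd_le_of_pos h hz ht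
    have hwl := T_snd_le_of_pos h hw (e ▸ ht)
    have hprod : (T l z).2 * (T l w).2 ≤ 1 / l * (1 / l) := mul_le_mul hzl hwl hw0 hil0
    have hwt1 : weight l (T l z).1 ≤ 1 := by unfold weight; split_ifs <;> linarith
    rw [weight.eq_def l z.1, if_neg ht.not_gt]
    calc weight l (T l z).1 * ((T l z).2 * (T l w).2)
        ≤ (T l z).2 * (T l w).2 := mul_le_of_le_one_left (mul_nonneg hz0 hw0) hwt1
      _ ≤ 1 / l * (1 / l) := hprod
      _ ≤ rate l * (1 / l) := mul_le_mul_of_nonneg_right r1 hil0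

lemma T_iterate_fst_congr {z w : ℝ × ℝ} (e : z.1 = w.1) (n : ℕ) :
    ((T l)^[n] z).1 = ((T l)^[n] w).1 := by
  rw [T_iterate_fst, T_iterate_fst, e]

lemma abs_T_iterate_snd_sub_le (h : Geom l p) {z w : ℝ × ℝ} (hz : z ∈ OmegaE l p)
    (hw : w ∈ OmegaE l p) (e : z.1 = w.1) (n : ℕ) :
    |((T l)^[n] z).2 - ((T l)^[n] w).2| ≤ l * rate l ^ n := by
  have hl := h.pos
  have hil : 1 / l ≤ 1 := by rw [div_le_one hl]; exact h.one_lt.le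
  have key : weight l ((T l)^[n] z).1 * |((T l)^[n] z).2 - ((T l)^[n] w).2| ≤ rate l ^ n := by
    induction n with
    | zero =>
      have bz := omegaBounds h hz
      have bw := omegaBounds h hw
      have h1 : |z.2 - w.2| ≤ 1 := abs_sub_le_iff.mpr
        ⟨by linarith [bz.le_one, bw.nonneg], by linarith [bw.le_one, bz.nonneg]⟩
      have h2 : weight l z.1 ≤ 1 := by unfold weight; split_ifs <;> linarith
      simpa using mul_le_one₀ h2 (abs_nonneg _) h1
    | succ n ih =>
      rw [Function.iterate_succ_apply', Function.iterate_succ_apply', pow_succ']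
      exact (weight_mul_T_snd_sub_le h (T_iterate_mem_OmegaE h hz n) (T_iterate_mem_OmegaE h hw n)
        (T_iterate_fst_congr e n)).trans (mul_le_mul_of_nonneg_left ih (rate_nonneg l))
  have hw' : 1 / l ≤ weight l ((T l)^[n] z).1 := by unfold weight; split_ifs <;> linarith
  have := (mul_le_mul_of_nonneg_right hw' (abs_nonneg _)).trans key
  rwa [div_mul_eq_mul_div, one_mul, div_le_iff₀' hl] at this

lemma Tinv_snd_congr {z w : ℝ × ℝ} (e : z.2 = w.2) : (Tinv l z).2 = (Tinv l w).2 := by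
  unfold Tinv
  rw [e]
  split_ifs <;> rfl

lemma Tinv_iterate_snd_congr {z w : ℝ × ℝ} (e : z.2 = w.2) (n : ℕ) :
    ((Tinv l)^[n] z).2 = ((Tinv l)^[n] w).2 := by
  induction n with
  | zero => exact e
  | succ n ih =>
    rw [Function.iterate_succ_apply', Function.iterate_succ_apply']
    exact Tinv_snd_congr ih

lemma Tinv_fst_sub {z w : ℝ × ℝ} (e : z.2 = w.2) (hz : (Tinv l z).1 ≠ 0)
    (hw : (Tinv l w).1 ≠ 0) :
    |(Tinv l z).1 - (Tinv l w).1| = |(Tinv l z).1| * |(Tinv l w).1| * |z.1 - w.1| := by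
  have inv_sub (a b s : ℝ) (ha : s / a ≠ 0) (hb : s / b ≠ 0) (hs : |s| = 1) :
      |s / a - s / b| = |s / a| * |s / b| * |a - b| := by
    have ha' : a ≠ 0 := by rintro rfl; simp at ha
    have hb' : b ≠ 0 := by rintro rfl; simp at hb
    have e1 : s / a - s / b = s * (b - a) / (a * b) := by field_simp
    rw [e1, abs_div, abs_div, abs_div, abs_mul, abs_mul, hs, abs_sub_comm]
    field_simp
  unfold Tinv at *
  rw [← e] at *
  split_ifs at * with hc
  · rw [inv_sub _ _ 1 hz hw (by simp), add_sub_add_left_eq_sub]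
  · rw [inv_sub _ _ (-1) hz hw (by simp), add_sub_add_left_eq_sub]

lemma dist_Tinv_iterate_le (h : Geom l p) {z w : ℝ × ℝ}
    (hz : ∀ n, (Tinv l)^[n] z ∈ OmegaE l p ∧ ((Tinv l)^[n] z).1 ≠ 0)
    (hw : ∀ n, (Tinv l)^[n] w ∈ OmegaE l p ∧ ((Tinv l)^[n] w).1 ≠ 0) (e : z.2 = w.2) (n : ℕ) :
    dist ((Tinv l)^[n] z) ((Tinv l)^[n] w) ≤ l * (l / 2 * (l / 2)) ^ n := by
  rw [Prod.dist_eq, Tinv_iterate_snd_congr e, dist_self, max_eq_left dist_nonneg]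
  have hl := h.pos
  induction n with
  | zero =>
    have bz := omegaBounds h (hz 0).1
    have bw := omegaBounds h (hw 0).1
    rw [pow_zero, mul_one, Real.dist_eq, abs_sub_le_iff]
    exact ⟨by linarith [bz.right, bw.left], by linarith [bw.right, bz.left]⟩
  | succ n ih =>
    have hz1 := hz (n + 1)
    have hw1 := hw (n + 1)
    rw [Function.iterate_succ_apply'] at hz1 hw1
    rw [Function.iterate_succ_apply', Function.iterate_succ_apply', Real.dist_eq,
      Tinv_fst_sub (Tinv_iterate_snd_congr e n) hz1.2 hw1.2, pow_succ', mul_left_comm]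
    exact mul_le_mul (mul_le_mul (omegaBounds h hz1.1).abs_le (omegaBounds h hw1.1).abs_le
      (abs_nonneg _) (by linarith)) ih (abs_nonneg _) (by positivity)

lemma absolutelyContinuous_nuC (h : Geom l p) {c : ℝ} (hc : 0 < c) :
    volume.restrict (OmegaE l p) ≪ nuC l p c := by
  refine withDensity_absolutelyContinuous' (measurable_rho c).aemeasurable ?_
  refine (ae_restrict_iff' measurableSet_OmegaE).mpr (ae_of_all _ fun z hz => ?_)
  have := (omegaBounds h hz).one_add_mul_pos h
  rw [rho, Ne, ENNReal.ofReal_eq_zero, not_le]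
  positivity

lemma ae_nuC_iff (h : Geom l p) {c : ℝ} (hc : 0 < c) {P : ℝ × ℝ → Prop} :
    (∀ᵐ z ∂nuC l p c, P z) ↔ ∀ᵐ z ∂volume, z ∈ OmegaE l p → P z := by
  rw [← ae_restrict_iff' measurableSet_OmegaE]
  exact ⟨fun hP => (absolutelyContinuous_nuC h hc).ae_le hP,
    fun hP => nuC_absolutelyContinuous.ae_le hP⟩

lemma exists_horizontal_leaf (h : Geom l p) {Z : Set (ℝ × ℝ)}
    (hZ : ∀ᵐ z ∂volume, z ∈ OmegaE l p → z ∈ Z) :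
    ∃ v, ∀ᵐ t, t ∈ Set.Ico (-(l / 2)) (l / 2) → (t, v) ∈ OmegaE l p ∧ (t, v) ∈ Z := by
  rw [Measure.volume_eq_prod] at hZ
  have hdense := Measure.dense_of_ae (Measure.ae_ae_of_ae_prod
    ((Measure.measurePreserving_swap (μ := volume) (ν := volume)).quasiMeasurePreserving.ae hZ))
  have hl := h.pos
  obtain ⟨v, hv, hv0, hv1⟩ := hdense.exists_between (show (0 : ℝ) < 1 / (l + 1) by positivity)
  refine ⟨v, ?_⟩
  filter_upwards [hv] with t ht htI
  have hΩ := mem_OmegaE_of_le h (z := (t, v)) htI hv0.le hv1.le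
  exact ⟨hΩ, ht hΩ⟩

theorem ergodic_T (h : Geom l p) {c : ℝ} (hc : 0 < c) [IsFiniteMeasure (nuC l p c)] :
    Ergodic (T l) (nuC l p c) := by
  have hT := measurePreserving_T h (c := c)
  have hTi := measurePreserving_Tinv h (c := c)
  refine ⟨hT, ⟨fun {E} hE hTE => ?_⟩⟩
  have hmemΩ : ∀ᵐ z ∂nuC l p c, z ∈ OmegaE l p := (ae_nuC_iff h hc).mpr (ae_of_all _ fun z hz => hz)
  have hreg : ∀ᵐ z ∂nuC l p c, z ∈ OmegaReg l p :=
    nuC_absolutelyContinuous.ae_le (ae_mem_OmegaReg h)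
  have hinv : ∀ z, T l z ∈ E ↔ z ∈ E := fun z => by rw [← Set.mem_preimage, hTE]
  have hinv' : ∀ᵐ z ∂nuC l p c, Tinv l z ∈ E ↔ z ∈ E := by
    rw [← hT.map_eq, ae_map_iff measurable_T.aemeasurable]
    · filter_upwards [hreg] with z hz
      rw [Tinv_T h hz, hinv]
    · have hi := measurable_Tinv (l := l) hE
      convert (hi.inter hE).union (hi.compl.inter hE.compl) using 1
      ext z
      simp only [Set.mem_ofPred_eq, Set.mem_union, Set.mem_inter_iff, Set.mem_preimage,
        Set.mem_compl_iff]
      tauto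
  obtain ⟨Z₁, hZ₁, hE₁⟩ := exists_ae_saturated hT hE (ae_of_all _ hinv)
    (R := fun z w => z.1 = w.1) (W := OmegaE l p) (b := fun n => l * rate l ^ n) hmemΩ
    (by simpa using (tendsto_pow_atTop_nhds_zero_of_lt_one (rate_nonneg l)
      h.rate_lt_one).const_mul l) (by
      intro z hz w hw e n
      rw [Prod.dist_eq, T_iterate_fst_congr e, dist_self, max_eq_right dist_nonneg, Real.dist_eq]
      exact abs_T_iterate_snd_sub_le h hz hw e n)
  obtain ⟨Z₂, hZ₂, hE₂⟩ := exists_ae_saturated hTi hE hinv'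
    (R := fun z w => z.2 = w.2)
    (W := {z | ∀ n, (Tinv l)^[n] z ∈ OmegaE l p ∧ ((Tinv l)^[n] z).1 ≠ 0})
    (b := fun n => l * (l / 2 * (l / 2)) ^ n)
    (by
      refine ae_all_iff.mpr fun n => ?_
      filter_upwards [(hTi.iterate n).quasiMeasurePreserving.ae hreg] with z hz
      exact ⟨hz.1, hz.2.1⟩)
    (by
      have hl := h.pos
      have hl2 := h.lt_two
      simpa using (tendsto_pow_atTop_nhds_zero_of_lt_one (r := l / 2 * (l / 2)) (by positivity)
        (by nlinarith)).const_mul l)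
    (fun z hz w hw e n => dist_Tinv_iterate_le h hz hw e n)
  obtain ⟨v, hv⟩ := exists_horizontal_leaf h ((ae_nuC_iff h hc).mp (hZ₁.and hZ₂))
  have hleaf : ∀ᵐ z ∂nuC l p c, z ∈ Z₁ ∧ (z.1, v) ∈ Z₁ ∧ (z.1, v) ∈ Z₂ := by
    rw [ae_nuC_iff h hc]
    filter_upwards [(ae_nuC_iff h hc).mp hZ₁,
      (Measure.quasiMeasurePreserving_fst (μ := volume) (ν := volume)).ae hv] with z hz hz' hΩ
    have b := omegaBounds h hΩ
    exact ⟨hz hΩ, (hz' ⟨b.left, b.right⟩).2⟩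
  rw [eventuallyConst_set']
  by_cases hex : ∃ t, (t, v) ∈ Z₂ ∧ (t, v) ∈ E
  · right
    obtain ⟨t, htZ, htE⟩ := hex
    filter_upwards [hleaf] with z ⟨h1, h2, h3⟩
    have : z ∈ E := (hE₁ z h1 _ h2 rfl).mpr ((hE₂ _ htZ _ h3 rfl).mp htE)
    exact propext ⟨fun _ => trivial, fun _ => this⟩
  · left
    push Not at hex
    filter_upwards [hleaf] with z ⟨h1, h2, h3⟩
    have : z ∉ E := fun hzE => hex _ h3 ((hE₁ z h1 _ h2 rfl).mp hzE)
    exact propext ⟨fun hzE => this hzE, fun hf => hf.elim⟩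

end Ergodicity

section Frequency

/-- The proportion of indices below `N` at which `P` holds. -/
def freq (P : ℕ → Prop) (N : ℕ) : ℝ := ((Finset.range N).filter P).card / N

lemma freq_le_add {A B : ℕ → Prop} {J : ℕ} (hAB : ∀ j, J ≤ j → A j → B j) (N : ℕ) :
    freq A N ≤ J / N + freq B N := by
  have h1 : (Finset.range N).filter A ⊆ Finset.range J ∪ (Finset.range N).filter B := by
    intro j
    simp only [Finset.mem_filter, Finset.mem_union, Finset.mem_range]
    rintro ⟨h1, h2⟩
    exact (lt_or_ge j J).imp_right fun h => ⟨h1, hAB j h h2⟩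
  have h2 := (Finset.card_le_card h1).trans (Finset.card_union_le _ _)
  rw [Finset.card_range] at h2
  rw [freq, freq, ← add_div]
  gcongr
  exact_mod_cast h2

lemma eventually_lt_freq {A B : ℕ → Prop} (hAB : ∀ᶠ j in atTop, A j → B j) {a a' : ℝ}
    (hA : Tendsto (freq A) atTop (𝓝 a)) (ha : a' < a) : ∀ᶠ N in atTop, a' < freq B N := by
  obtain ⟨J, hJ⟩ := eventually_atTop.mp hAB
  have := hA.sub (tendsto_const_div_atTop_nhds_zero_nat (J : ℝ))
  rw [sub_zero] at this
  filter_upwards [this.eventually_const_lt ha] with N hN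
  linarith [freq_le_add hJ N]

lemma eventually_freq_lt {A B : ℕ → Prop} (hAB : ∀ᶠ j in atTop, A j → B j) {b b' : ℝ}
    (hB : Tendsto (freq B) atTop (𝓝 b)) (hb : b < b') : ∀ᶠ N in atTop, freq A N < b' := by
  obtain ⟨J, hJ⟩ := eventually_atTop.mp hAB
  have := (tendsto_const_div_atTop_nhds_zero_nat (J : ℝ)).add hB
  rw [zero_add] at this
  filter_upwards [this.eventually_lt_const hb] with N hN
  linarith [freq_le_add hJ N]

lemma exists_rat_pos_of_eventually {P : ℝ → Prop} (hP : ∀ᶠ δ in 𝓝 (0 : ℝ), P δ) :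
    ∃ δ : ℚ, 0 < δ ∧ P δ ∧ P (-δ) := by
  obtain ⟨ε, hε, h⟩ := Metric.eventually_nhds_iff.mp hP
  obtain ⟨δ, h1, h2⟩ := exists_rat_btwn hε
  refine ⟨δ, by exact_mod_cast h1, h ?_, h ?_⟩
  · rwa [Real.dist_eq, sub_zero, abs_of_pos h1]
  · rwa [Real.dist_eq, sub_zero, abs_neg, abs_of_pos h1]

lemma tendsto_freq_of_squeeze {P : ℕ → Prop} {Q : ℝ → ℕ → Prop} {d : ℝ → ℝ}
    (hd : Tendsto d (𝓝 0) (𝓝 (d 0))) (hQ : ∀ δ : ℚ, Tendsto (freq (Q δ)) atTop (𝓝 (d δ)))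
    (h1 : ∀ δ > 0, ∀ᶠ j in atTop, Q δ j → P j) (h2 : ∀ δ > 0, ∀ᶠ j in atTop, P j → Q (-δ) j) :
    Tendsto (freq P) atTop (𝓝 (d 0)) := by
  refine tendsto_order.mpr ⟨fun a ha => ?_, fun b hb => ?_⟩
  · obtain ⟨δ, hδ, h, -⟩ := exists_rat_pos_of_eventually (hd.eventually_const_lt ha)
    exact eventually_lt_freq (h1 δ (by exact_mod_cast hδ)) (hQ δ) h
  · obtain ⟨δ, hδ, -, h⟩ := exists_rat_pos_of_eventually (hd.eventually_lt_const hb)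
    refine eventually_freq_lt (h2 δ (by exact_mod_cast hδ)) ?_ h
    simpa using hQ (-δ)

end Frequency

section Blocks

variable {l : ℝ} {p : ℕ}

/-- The points whose first `m` approximation coefficients exceed `1/2 + δ` and whose next one is
less than `1/2 - δ`. -/
def Block (l : ℝ) (m : ℕ) (δ : ℝ) : Set (ℝ × ℝ) :=
  {z | (∀ i < m, 1 / 2 + δ < Th ((T l)^[i] z)) ∧ Th ((T l)^[m] z) < 1 / 2 - δ}

lemma measurable_Th_iterate (n : ℕ) : Measurable fun z => Th ((T l)^[n] z) :=
  measurable_Th.comp (measurable_T.iterate n)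

lemma measurableSet_Block (m : ℕ) (δ : ℝ) : MeasurableSet (Block l m δ) := by
  have : Block l m δ = (⋂ i, ⋂ _ : i < m, {z | 1 / 2 + δ < Th ((T l)^[i] z)}) ∩
      {z | Th ((T l)^[m] z) < 1 / 2 - δ} := by
    ext z
    simp [Block]
  rw [this]
  exact (MeasurableSet.iInter fun i => MeasurableSet.iInter fun _ =>
    measurableSet_lt measurable_const (measurable_Th_iterate i)).inter
      (measurableSet_lt (measurable_Th_iterate m) measurable_const)

lemma volume_Th_eq_half (h : Geom l p) : volume {z ∈ OmegaE l p | Th z = 1 / 2} = 0 := by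
  have hm : MeasurableSet {z ∈ OmegaE l p | Th z = 1 / 2} :=
    measurableSet_OmegaE.inter (measurableSet_eq_fun measurable_Th measurable_const)
  rw [Measure.volume_eq_prod, Measure.measure_prod_null (by exact hm)]
  refine ae_of_all _ fun t => Set.Subsingleton.measure_zero ?_ _
  have key : ∀ v, (t, v) ∈ {z ∈ OmegaE l p | Th z = 1 / 2} → 2 * |t| = 1 + t * v := by
    rintro v ⟨hv, e⟩
    have := (omegaBounds h hv).one_add_mul_pos h
    rw [Th, div_eq_iff this.ne'] at e
    linarith
  intro v hv w hw
  have h1 := key v hv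
  have h2 := key w hw
  rcases eq_or_ne t 0 with rfl | ht
  · norm_num at h1
  · exact mul_left_cancel₀ ht (by linarith)

lemma ae_Th_iterate_ne_half (h : Geom l p) {c : ℝ} [IsFiniteMeasure (nuC l p c)] :
    ∀ᵐ z ∂nuC l p c, ∀ n, Th ((T l)^[n] z) ≠ 1 / 2 := by
  refine ae_all_iff.mpr fun n => ?_
  refine ((measurePreserving_T h).iterate n).quasiMeasurePreserving.ae
    (p := fun z => Th z ≠ 1 / 2) ?_
  have : ∀ᵐ z ∂volume.restrict (OmegaE l p), Th z ≠ 1 / 2 := by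
    rw [ae_restrict_iff' measurableSet_OmegaE, ae_iff]
    simpa using volume_Th_eq_half h
  exact nuC_absolutelyContinuous.ae_le this

lemma tendsto_measureReal_Block (h : Geom l p) {c : ℝ} [IsFiniteMeasure (nuC l p c)] (m : ℕ) :
    Tendsto (fun δ => (nuC l p c).real (Block l m δ)) (𝓝 0)
      (𝓝 ((nuC l p c).real (Block l m 0))) := by
  refine (ENNReal.tendsto_toReal (measure_ne_top _ _)).comp
    (tendsto_measure_of_ae_tendsto_indicator_of_isFiniteMeasure (𝓝 0) (measurableSet_Block m 0)
      (measurableSet_Block m) ?_)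
  filter_upwards [ae_Th_iterate_ne_half h] with z hz
  have h1 : ∀ a : ℝ, a ≠ 1 / 2 → ∀ᶠ δ in 𝓝 (0 : ℝ), (1 / 2 + δ < a ↔ 1 / 2 + 0 < a) ∧
      (a < 1 / 2 - δ ↔ a < 1 / 2 - 0) := by
    intro a ha
    rcases lt_or_gt_of_ne ha with ha | ha
    · filter_upwards [Metric.ball_mem_nhds 0 (sub_pos.mpr ha)] with δ hδ
      rw [mem_ball_zero_iff, Real.norm_eq_abs, abs_lt] at hδ
      constructor <;> constructor <;> intro <;> linarith [hδ.1, hδ.2]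
    · filter_upwards [Metric.ball_mem_nhds 0 (sub_pos.mpr ha)] with δ hδ
      rw [mem_ball_zero_iff, Real.norm_eq_abs, abs_lt] at hδ
      constructor <;> constructor <;> intro <;> linarith [hδ.1, hδ.2]
  have h2 : ∀ᶠ δ in 𝓝 (0 : ℝ), ∀ i ∈ Finset.range m,
      (1 / 2 + δ < Th ((T l)^[i] z) ↔ 1 / 2 + 0 < Th ((T l)^[i] z)) :=
    (Finset.eventually_all _).mpr fun i _ => (h1 _ (hz i)).mono fun _ h => h.1
  filter_upwards [h2, h1 _ (hz m)] with δ h3 h4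
  exact and_congr (forall₂_congr fun i hi => h3 i (Finset.mem_range.mpr hi)) h4.2

lemma birkhoffSum_indicator_div {U : ℝ × ℝ → ℝ × ℝ} (B : Set (ℝ × ℝ)) (z : ℝ × ℝ) (N : ℕ) :
    birkhoffSum U (B.indicator 1 : ℝ × ℝ → ℝ) N z / N = freq (fun j => U^[j] z ∈ B) N := by
  rw [freq, birkhoffSum]
  simp [Set.indicator_apply, Finset.sum_boole]

lemma ae_tendsto_freq_Block (h : Geom l p) {c : ℝ} (hc : 0 < c)
    [IsProbabilityMeasure (nuC l p c)] :
    ∀ᵐ z ∂nuC l p c, ∀ (m : ℕ) (δ : ℚ), Tendsto (freq fun j => (T l)^[j] z ∈ Block l m δ) atTop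
      (𝓝 ((nuC l p c).real (Block l m δ))) := by
  refine ae_all_iff.mpr fun m => ae_all_iff.mpr fun δ => ?_
  have hB := measurableSet_Block (l := l) m (δ : ℝ)
  have := ae_tendsto_birkhoffSum_div (ergodic_T h hc) (measurable_one.indicator hB)
    ((integrable_const (1 : ℝ)).indicator hB)
  filter_upwards [this] with z hz
  simp_rw [birkhoffSum_indicator_div] at hz
  rwa [integral_indicator_one hB] at hz

lemma tendsto_Th_iterate_sub (h : Geom l p) {z w : ℝ × ℝ} (hz : z ∈ OmegaE l p)
    (hw : w ∈ OmegaE l p) (e : z.1 = w.1) :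
    Tendsto (fun n => Th ((T l)^[n] z) - Th ((T l)^[n] w)) atTop (𝓝 0) := by
  have hl := h.pos
  have hl2 := h.lt_two
  have hlim : Tendsto (fun n => l * rate l ^ n / (1 - l / 2) ^ 2) atTop (𝓝 0) := by
    simpa using ((tendsto_pow_atTop_nhds_zero_of_lt_one (rate_nonneg l)
      h.rate_lt_one).const_mul l).div_const ((1 - l / 2) ^ 2)
  refine squeeze_zero_norm (fun n => ?_) hlim
  have hd := abs_T_iterate_snd_sub_le h hz hw e n
  have bz := omegaBounds h (T_iterate_mem_OmegaE h hz n)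
  have bw := omegaBounds h (T_iterate_mem_OmegaE h hw n)
  have et := T_iterate_fst_congr (l := l) e n
  have p1 := bz.one_add_mul_pos h
  have p2 := bw.one_add_mul_pos h
  have g1 := bz.one_add_mul_ge
  have g2 := bw.one_add_mul_ge
  have ht := bz.abs_le
  set a := (T l)^[n] z
  set b := (T l)^[n] w
  rw [← et] at p2 g2
  have e1 : Th a - Th b = |a.1| * (a.1 * (b.2 - a.2)) / ((1 + a.1 * a.2) * (1 + a.1 * b.2)) := by
    rw [Th, Th, ← et]
    field_simp
    ring
  rw [Real.norm_eq_abs, e1, abs_div, abs_mul, abs_mul, abs_abs, abs_of_pos (mul_pos p1 p2),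
    abs_sub_comm b.2, sq]
  refine div_le_div₀ (by have := rate_nonneg l; positivity) ?_ (by nlinarith)
    (mul_le_mul g1 g2 (by linarith) p1.le)
  have h1 : |a.1| ≤ 1 := by linarith
  have h0 := abs_nonneg a.1
  have h2 := abs_nonneg (a.2 - b.2)
  calc |a.1| * (|a.1| * |a.2 - b.2|) ≤ |a.2 - b.2| :=
        (mul_le_of_le_one_left (mul_nonneg h0 h2) h1).trans (mul_le_of_le_one_left h2 h1)
    _ ≤ _ := hd

lemma eventually_mem_Block_of_mem (h : Geom l p) {z w : ℝ × ℝ} (hz : z ∈ OmegaE l p)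
    (hw : w ∈ OmegaE l p) (e : z.1 = w.1) (m : ℕ) {δ δ' : ℝ} (hδ : δ' < δ) :
    ∀ᶠ j in atTop, (T l)^[j] z ∈ Block l m δ → (T l)^[j] w ∈ Block l m δ' := by
  have hlim := tendsto_Th_iterate_sub h hz hw e
  obtain ⟨J, hJ⟩ := eventually_atTop.mp (Metric.tendsto_nhds.mp hlim (δ - δ') (sub_pos.mpr hδ))
  have hJ' : ∀ n, J ≤ n → |Th ((T l)^[n] z) - Th ((T l)^[n] w)| < δ - δ' := fun n hn => by
    simpa [Real.dist_eq] using hJ n hn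
  filter_upwards [eventually_ge_atTop J] with j hj
  rintro ⟨h1, h2⟩
  simp only [← Function.iterate_add_apply] at h1 h2
  refine ⟨fun i hi => ?_, ?_⟩
  · rw [← Function.iterate_add_apply]
    linarith [h1 i hi, (abs_lt.mp (hJ' (i + j) (by lia))).2]
  · rw [← Function.iterate_add_apply]
    linarith [(abs_lt.mp (hJ' (m + j) (by lia))).1]

lemma measurableSet_AEk (k : ℕ) : MeasurableSet (AEk l p k) := by
  have h1 : MeasurableSet (DE l p) := by
    have h2 : MeasurableSet {z : ℝ × ℝ | z.2 / (1 + z.1 * z.2) > 1 / 2} :=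
      measurableSet_lt measurable_const (by fun_prop)
    exact measurableSet_OmegaE.inter
      (h2.inter (measurableSet_lt measurable_const measurable_Th))
  have h2 : MeasurableSet {z : ℝ × ℝ | -2 / (3 * l) ≤ z.1} :=
    measurableSet_le measurable_const measurable_fst
  exact (h1.inter (h2.inter (measurableSet_le measurable_fst measurable_const))).inter
    (measurableSet_le measurable_const measurable_fst)

lemma mem_Block_iff (h : Geom l p) {z : ℝ × ℝ} (hz : z ∈ OmegaE l p) (ht : z.1 ≠ 0) (m : ℕ) :
    z ∈ Block l (m + 2) 0 ↔ T l z ∈ DE l p ∧ Stay l m (T l z) := by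
  simp only [Block, DE, Stay, Set.mem_ofPred_eq, T_mem_OmegaE h hz, true_and, T_snd_div h hz ht,
    ← Function.iterate_succ_apply, add_zero, sub_zero]
  change _ ↔ (Th z > 1 / 2 ∧ Th (T l z) > 1 / 2) ∧ _
  constructor
  · rintro ⟨h1, h2⟩
    exact ⟨⟨h1 0 (by lia), h1 1 (by lia)⟩, fun i hi => h1 (i + 1) (by lia), h2⟩
  · rintro ⟨⟨h1, -⟩, h2, h3⟩
    refine ⟨fun i hi => ?_, h3⟩
    cases i with
    | zero => exact h1
    | succ i => exact h2 i (by lia)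

lemma measureReal_Block (h : Geom l p) {c : ℝ} [IsFiniteMeasure (nuC l p c)] {k : ℕ}
    (hk : 1 ≤ k) :
    (nuC l p c).real (Block l (k * (p - 1) + 2) 0) =
      (nuC l p c).real (AEk l p (k - 1)) - (nuC l p c).real (AEk l p k) := by
  have hsub : AEk l p k ⊆ AEk l p (k - 1) := by
    obtain ⟨k, rfl⟩ := Nat.exists_eq_add_of_le' hk
    exact AEk_succ_subset h k
  have hm := measurableSet_AEk (l := l) (p := p)
  rw [← measureReal_sdiff hsub (hm k), ← (measurePreserving_T h).measureReal_preimage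
    ((hm _).diff (hm _)).nullMeasurableSet]
  refine measureReal_congr ?_
  filter_upwards [nuC_absolutelyContinuous.ae_le (ae_mem_OmegaReg h)] with z hz
  exact propext ((mem_Block_iff h hz.1 hz.2.1 _).trans (mem_DE_and_stay_iff h hk))

end Blocks

section Transfer

variable {l : ℝ} {p : ℕ}

lemma ae_tendsto_freq_theta (h : Geom l p) {c : ℝ} (hc : 0 < c)
    [IsProbabilityMeasure (nuC l p c)] :
    ∀ᵐ x ∂volume.restrict (Set.Ico (-(l / 2)) (l / 2)), ∀ m : ℕ,
      Tendsto (freq fun j => (∀ i < m, 1 / 2 < theta l x (i + j)) ∧ theta l x (m + j) < 1 / 2) atTop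
        (𝓝 ((nuC l p c).real (Block l m 0))) := by
  have hne : ∀ᵐ z ∂nuC l p c, ∀ n, ((T l)^[n] z).1 ≠ 0 := by
    refine ae_all_iff.mpr fun n => ?_
    filter_upwards [((measurePreserving_T h).iterate n).quasiMeasurePreserving.ae
      (nuC_absolutelyContinuous.ae_le (ae_mem_OmegaReg h))] with z hz
    exact hz.2.1
  have hgood := (ae_nuC_iff h hc).mp ((ae_tendsto_freq_Block h hc).and hne)
  rw [Measure.volume_eq_prod] at hgood
  have hl := h.pos
  refine (ae_restrict_iff' measurableSet_Ico).mpr ?_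
  filter_upwards [Measure.ae_ae_of_ae_prod hgood] with x hx hxI m
  obtain ⟨y, hy, hy0, hy1⟩ :=
    (Measure.dense_of_ae hx).exists_between (show (0 : ℝ) < 1 / (l + 1) by positivity)
  have hΩ := mem_OmegaE_of_le h (z := (x, y)) hxI hy0.le hy1.le
  have hΩ0 := mem_OmegaE_of_le h (z := (x, 0)) hxI le_rfl (by positivity)
  obtain ⟨hfreq, hirr⟩ := hy hΩ
  have hIrr : Irr l x := fun n => by
    rw [← T_iterate_fst (x, y)]
    exact hirr n
  have hP : (fun j => (∀ i < m, 1 / 2 < theta l x (i + j)) ∧ theta l x (m + j) < 1 / 2) =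
      fun j => (T l)^[j] (x, 0) ∈ Block l m 0 := by
    funext j
    simp only [Block, Set.mem_ofPred_eq, ← Function.iterate_add_apply, add_zero, sub_zero,
      theta_eq_Th h hIrr hxI]
  rw [hP]
  exact tendsto_freq_of_squeeze (Q := fun δ j => (T l)^[j] (x, y) ∈ Block l m δ)
    (tendsto_measureReal_Block h m) (hfreq m)
    (fun δ hδ => eventually_mem_Block_of_mem h hΩ hΩ0 rfl m hδ)
    (fun δ hδ => eventually_mem_Block_of_mem h hΩ0 hΩ rfl m (by linarith))

lemma card_filter_Icc_one (P : ℕ → Prop) (N : ℕ) :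
    ((Finset.Icc 1 N).filter fun j => P (j - 1)).card = ((Finset.range N).filter P).card := by
  refine (Finset.card_bij (fun j _ => j + 1) ?_ (fun _ _ _ _ => Nat.succ.inj) ?_).symm
  · intro j
    simp only [Finset.mem_filter, Finset.mem_range, Finset.mem_Icc]
    exact fun ⟨h1, h2⟩ => ⟨by lia, h2⟩
  · intro j
    simp only [Finset.mem_filter, Finset.mem_range, Finset.mem_Icc, exists_prop]
    exact fun ⟨h1, h2⟩ => ⟨j - 1, ⟨by lia, h2⟩, by lia⟩

end Transfer

/-- metrical result on blocks of large approximation coefficients (even case). -/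
theorem metric_even (q p : ℕ) (hp : 2 ≤ p) (hq : q = 2 * p) :
    ∀ᵐ x ∂(volume.restrict (Set.Ico (-(lam q / 2)) (lam q / 2))),
      ∀ k : ℕ, 1 ≤ k →
        Tendsto
          (fun N : ℕ =>
            (((Finset.Icc 1 N).filter fun j =>
                  (∀ i ∈ Finset.range (k * (p - 1) + 2),
                      theta (lam q) x (j - 1 + i) > 1 / 2) ∧
                  theta (lam q) x (j + k * (p - 1) + 1) < 1 / 2).card : ℝ) / N)
          atTop
          (𝓝 ((nuE q p (AEk (lam q) p (k - 1))).toReal - (nuE q p (AEk (lam q) p k)).toReal)) := by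
  have hθ : π / q * p = π / 2 := by
    have : (p : ℝ) ≠ 0 := by positivity
    rw [hq]
    push_cast
    field_simp
  have h : Geom (lam q) p := geom_two_mul_cos hp hθ
  obtain ⟨hc, hprob⟩ := isProbabilityMeasure_nuC hp hθ
  change IsProbabilityMeasure (nuC (lam q) p _) at hprob
  filter_upwards [ae_tendsto_freq_theta h hc] with x hx k hk
  have := hx (k * (p - 1) + 2)
  rw [measureReal_Block h hk] at this
  refine this.congr fun N => ?_
  rw [freq, ← card_filter_Icc_one]
  congr 2
  refine congrArg Finset.card (Finset.ext fun j => ?_)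
  simp only [Finset.mem_filter, Finset.mem_range, gt_iff_lt]
  refine and_congr_right fun hj => ?_
  have hj1 := (Finset.mem_Icc.mp hj).1
  simp only [add_comm (j - 1),
    show j + k * (p - 1) + 1 = k * (p - 1) + 2 + (j - 1) by lia]

end RosenTong
end
end

section
/- Fix an even integer q = 2p with p ≥ 3 and let λ = 2·cos(π/q). Then D = {(t,v) ∈ Ω : t < 0, v > 1/(2−t), and v > (2|t|−1)/t}. Moreover D has exactly two connected components, namely D_1 = {(t,v) ∈ D : t ≤ 1−λ} and D_2 = {(t,v) ∈ D : t > 1−λ}, both nonempty. -/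
noncomputable section

open Real Filter Topology MeasureTheory
open scoped Classical

namespace RosenTong

/-! ### Trigonometric closed forms -/

/-- `-cos ((j+1)θ) / cos (jθ)`, the closed form of `φ_j`. -/
lemma phi_eq_neg_cos_div_cos {θ : ℝ} {p : ℕ} (hθ : 0 < θ) (hpθ : p * θ = π / 2) (j : ℕ)
    (hj : j + 1 ≤ p) :
    phi (2 * cos θ) j = -(cos ((j + 1) * θ) / cos (j * θ)) := by
  have hcos (i : ℕ) (hi : i < p) : 0 < cos (i * θ) := by
    have hi' : (i : ℝ) < p := by exact_mod_cast hi
    apply cos_pos_of_mem_Ioo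
    constructor <;> nlinarith [mul_nonneg (Nat.cast_nonneg (α := ℝ) i) hθ.le, pi_pos]
  induction j with
  | zero => simp [phi]
  | succ j ih =>
    have ih := ih (by omega)
    have h0 := hcos j (by omega)
    have h1 : 0 < cos ((j + 1) * θ) := by simpa using hcos (j + 1) (by omega)
    have hle : cos ((j + 1) * θ) ≤ cos (j * θ) := by
      apply cos_le_cos_of_nonneg_of_le_pi (by positivity) _ (by nlinarith)
      have : ((j + 1 : ℕ) : ℝ) ≤ p := by exact_mod_cast (by omega : j + 1 ≤ p)
      push_cast at this
      nlinarith [pi_pos]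
    have hlast : 0 ≤ cos ((j + 2) * θ) := by
      have : ((j + 2 : ℕ) : ℝ) ≤ p := by exact_mod_cast hj
      push_cast at this
      apply cos_nonneg_of_mem_Icc
      constructor <;> nlinarith [mul_nonneg (Nat.cast_nonneg (α := ℝ) j) hθ.le, pi_pos]
    have hsum : 2 * cos θ * cos ((j + 1) * θ) = cos ((j + 2) * θ) + cos (j * θ) := by
      have e1 : ((j : ℝ) + 2) * θ = (j + 1) * θ + θ := by ring
      have e2 : (j : ℝ) * θ = (j + 1) * θ - θ := by ring
      rw [e1, e2, cos_add, cos_sub]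
      ring
    have hcθ : 0 < cos θ := by
      simpa using hcos 1 (by omega)
    have habs : |(-(cos ((j + 1) * θ) / cos (j * θ)))| = cos ((j + 1) * θ) / cos (j * θ) := by
      rw [abs_neg, abs_of_pos (by positivity)]
    have hfloor :
        ⌊1 / (2 * cos θ * (cos ((j + 1) * θ) / cos (j * θ))) + 1 / 2⌋ = 1 := by
      have e : 1 / (2 * cos θ * (cos ((j + 1) * θ) / cos (j * θ))) =
          cos (j * θ) / (2 * cos θ * cos ((j + 1) * θ)) := by field_simp
      have hpos : 0 < 2 * cos θ * cos ((j + 1) * θ) := by positivity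
      have hup : cos (j * θ) / (2 * cos θ * cos ((j + 1) * θ)) ≤ 1 := by
        rw [div_le_one hpos]; linarith
      have hlo : 1 / 2 ≤ cos (j * θ) / (2 * cos θ * cos ((j + 1) * θ)) := by
        rw [div_le_div_iff₀ two_pos hpos]
        nlinarith [cos_le_one θ]
      rw [e, Int.floor_eq_iff]
      constructor <;> push_cast <;> linarith
    have hne : -(cos ((j + 1) * θ) / cos (j * θ)) ≠ 0 := by
      simp [h0.ne', h1.ne']
    have hstep : phi (2 * cos θ) (j + 1) = f (2 * cos θ) (phi (2 * cos θ) j) := by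
      simp only [phi, Function.iterate_succ_apply']
    rw [hstep, ih, f, if_neg hne, habs, hfloor]
    push_cast
    rw [show ((j : ℝ) + 1 + 1) * θ = (j + 2) * θ by ring]
    generalize cos ((j + 2) * θ) = a, cos ((j + 1) * θ) = b, cos (j * θ) = c at *
    rw [show a = 2 * cos θ * b - c by linarith]
    field_simp
    ring

lemma phi_le_phi_succ {θ : ℝ} {p : ℕ} (hθ : 0 < θ) (hpθ : p * θ = π / 2) (j : ℕ)
    (hj : j + 2 ≤ p) : phi (2 * cos θ) j ≤ phi (2 * cos θ) (j + 1) := by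
  have hcos (i : ℕ) (hi : i < p) : 0 < cos (i * θ) := by
    have hi' : (i : ℝ) < p := by exact_mod_cast hi
    apply cos_pos_of_mem_Ioo
    constructor <;> nlinarith [mul_nonneg (Nat.cast_nonneg (α := ℝ) i) hθ.le, pi_pos]
  have h0 := hcos j (by omega)
  have h1 : 0 < cos ((j + 1) * θ) := by simpa using hcos (j + 1) (by omega)
  rw [phi_eq_neg_cos_div_cos hθ hpθ j (by omega), phi_eq_neg_cos_div_cos hθ hpθ (j + 1) hj]
  push_cast
  rw [neg_le_neg_iff, div_le_div_iff₀ h1 h0]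
  have e1 : ((j : ℝ) + 1 + 1) * θ = (j + 1) * θ + θ := by ring
  have e2 : (j : ℝ) * θ = (j + 1) * θ - θ := by ring
  rw [e1, e2, cos_add, cos_sub]
  nlinarith [sq_nonneg (sin θ), sin_sq_add_cos_sq θ, sin_sq_add_cos_sq ((j + 1) * θ)]

lemma phi_mono {θ : ℝ} {p : ℕ} (hθ : 0 < θ) (hpθ : p * θ = π / 2) {i j : ℕ}
    (hij : i ≤ j) (hj : j + 1 ≤ p) : phi (2 * cos θ) i ≤ phi (2 * cos θ) j := by
  induction j, hij using Nat.le_induction with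
  | base => exact le_rfl
  | succ j _ ih => exact (ih (by omega)).trans (phi_le_phi_succ hθ hpθ j hj)

/-- The closed form of the heights `L_j`. -/
lemma LE_eq_sin_div_sin {θ : ℝ} {p : ℕ} (hθ : 0 < θ) (hpθ : p * θ = π / 2) (j : ℕ)
    (hj : j + 2 ≤ p) :
    LE (2 * cos θ) (j + 1) = sin ((2 * j + 1) * (θ / 2)) / sin ((2 * j + 3) * (θ / 2)) := by
  have hsin (i : ℕ) (hi : i + 1 ≤ p) : 0 < sin ((2 * i + 1) * (θ / 2)) := by
    have hi' : ((i + 1 : ℕ) : ℝ) ≤ p := by exact_mod_cast hi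
    push_cast at hi'
    apply sin_pos_of_pos_of_lt_pi (by positivity)
    nlinarith [pi_pos]
  induction j with
  | zero =>
    have h0 := hsin 0 (by omega)
    simp only [Nat.cast_zero, mul_zero, zero_add, one_mul] at h0 ⊢
    rw [LE, sin_three_mul]
    have hd : 0 < cos θ := by
      have : ((2 : ℕ) : ℝ) ≤ p := by exact_mod_cast hj
      push_cast at this
      apply cos_pos_of_mem_Ioo
      constructor <;> nlinarith [pi_pos]
    have hc : cos θ = 1 - 2 * sin (θ / 2) ^ 2 := by
      have := cos_two_mul (θ / 2)
      rw [show 2 * (θ / 2) = θ by ring] at this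
      nlinarith [sin_sq_add_cos_sq (θ / 2)]
    have e : 3 * sin (θ / 2) - 4 * sin (θ / 2) ^ 3 = sin (θ / 2) * (2 * cos θ + 1) := by
      rw [hc]; ring
    rw [e]
    field_simp
  | succ j ih =>
    have h1 : 0 < sin ((2 * j + 3) * (θ / 2)) := by
      have := hsin (j + 1) (by omega)
      push_cast at this
      rwa [show 2 * ((j : ℝ) + 1) + 1 = 2 * j + 3 by ring] at this
    have h2 : 0 < sin ((2 * j + 5) * (θ / 2)) := by
      have := hsin (j + 2) (by omega)
      push_cast at this
      rwa [show 2 * ((j : ℝ) + 2) + 1 = 2 * j + 5 by ring] at this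
    rw [LE, ih (by omega)]
    push_cast
    rw [show 2 * ((j : ℝ) + 1) + 1 = 2 * j + 3 by ring,
      show 2 * ((j : ℝ) + 1) + 3 = 2 * j + 5 by ring]
    have e : 2 * cos θ - sin ((2 * j + 1) * (θ / 2)) / sin ((2 * j + 3) * (θ / 2)) =
        sin ((2 * j + 5) * (θ / 2)) / sin ((2 * j + 3) * (θ / 2)) := by
      have e1 : (2 * (j : ℝ) + 5) * (θ / 2) = (2 * j + 3) * (θ / 2) + θ := by ring
      have e2 : (2 * (j : ℝ) + 1) * (θ / 2) = (2 * j + 3) * (θ / 2) - θ := by ring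
      rw [e1, e2, sin_add, sin_sub, eq_div_iff h1.ne', sub_mul, div_mul_cancel₀ _ h1.ne']
      ring
    rw [e, one_div_div]

lemma LE_mem_Ioc {θ : ℝ} {p : ℕ} (hθ : 0 < θ) (hpθ : p * θ = π / 2) {j : ℕ}
    (hj : 1 ≤ j) (hjp : j + 1 ≤ p) : LE (2 * cos θ) j ∈ Set.Ioc (0 : ℝ) 1 := by
  obtain ⟨i, rfl⟩ := Nat.exists_eq_add_of_le' hj
  have hi' : ((i + 2 : ℕ) : ℝ) ≤ p := by exact_mod_cast hjp
  push_cast at hi'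
  have h0 : 0 < sin ((2 * i + 1) * (θ / 2)) :=
    sin_pos_of_pos_of_lt_pi (by positivity) (by nlinarith [pi_pos])
  have hle : sin ((2 * i + 1) * (θ / 2)) ≤ sin ((2 * i + 3) * (θ / 2)) := by
    apply sin_le_sin_of_le_of_le_pi_div_two
    · have : 0 < (2 * (i : ℝ) + 1) * (θ / 2) := by positivity
      linarith [pi_pos]
    · nlinarith
    · nlinarith
  rw [LE_eq_sin_div_sin hθ hpθ i hjp]
  exact ⟨div_pos h0 (h0.trans_le hle), (div_le_one (h0.trans_le hle)).2 hle⟩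

/-! ### The combinatorial data of the domain `Ω` -/

/-- The properties of `l = 2 cos (π / (2p))`, of the points `φ_j` and of the heights `L_j` that
determine the shape of `D`. -/
structure EvenData (l : ℝ) (p : ℕ) : Prop where
  three_le : 3 ≤ p
  lt_l : 3 / 2 < l
  l_lt : l < 2
  phi_mono : ∀ i j, i ≤ j → j + 1 ≤ p → phi l i ≤ phi l j
  phi_zero : phi l 0 = -(l / 2)
  lt_phi_one : 1 - l < phi l 1
  phi_lt : phi l (p - 2) < -1 / 2
  phi_last : phi l (p - 1) = 0
  LE_one : LE l 1 = 1 / (l + 1)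
  LE_le : ∀ j, 1 ≤ j → j + 1 ≤ p → LE l j ≤ 1
  lt_LE : ∀ j, 2 ≤ j → j + 1 ≤ p → 1 / 2 < LE l j

lemma evenData_lam {q p : ℕ} (hp : 3 ≤ p) (hq : q = 2 * p) : EvenData (lam q) p := by
  obtain ⟨θ, hθdef⟩ : ∃ θ : ℝ, θ = π / q := ⟨_, rfl⟩
  have hl : lam q = 2 * cos θ := by rw [lam, hθdef]
  have hp' : (3 : ℝ) ≤ p := by exact_mod_cast hp
  have hpθ : p * θ = π / 2 := by
    rw [hθdef, hq]
    push_cast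
    field_simp
  have hθ : 0 < θ := by
    rw [hθdef, hq]
    push_cast
    have := pi_pos
    positivity
  have hθ6 : θ ≤ π / 6 := by nlinarith
  have hlt : 3 / 4 < cos θ := by
    have h : cos (π / 6) ≤ cos θ :=
      cos_le_cos_of_nonneg_of_le_pi hθ.le (by linarith [pi_pos]) hθ6
    rw [cos_pi_div_six] at h
    have : 3 / 2 < √3 := Real.lt_sqrt_of_sq_lt (by norm_num)
    linarith
  have hlt1 : cos θ < 1 := by
    have h := cos_lt_cos_of_nonneg_of_le_pi le_rfl (by linarith [pi_pos] : θ ≤ π) hθ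
    rwa [cos_zero] at h
  rw [hl]
  refine ⟨hp, by linarith, by linarith, fun i j hij hj => phi_mono hθ hpθ hij hj, rfl, ?_, ?_, ?_,
    rfl, fun j h1 h2 => (LE_mem_Ioc hθ hpθ h1 h2).2, fun j h1 h2 => ?_⟩
  · rw [phi_eq_neg_cos_div_cos hθ hpθ 1 (by omega)]
    norm_num
    rw [cos_two_mul, lt_neg, div_lt_iff₀ (by linarith)]
    nlinarith
  · rw [phi_eq_neg_cos_div_cos hθ hpθ (p - 2) (by omega)]
    have e : ((p - 2 : ℕ) : ℝ) = p - 2 := by push_cast [show 2 ≤ p by omega]; ring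
    have e1 : ((p : ℝ) - 2 + 1) * θ = π / 2 - θ := by linarith
    have e2 : ((p : ℝ) - 2) * θ = π / 2 - 2 * θ := by linarith
    have hs : 0 < sin θ := sin_pos_of_pos_of_lt_pi hθ (by linarith [pi_pos])
    rw [e, e1, e2, cos_pi_div_two_sub, cos_pi_div_two_sub, sin_two_mul, neg_div, neg_lt_neg_iff,
      div_lt_div_iff₀ two_pos (by positivity)]
    nlinarith
  · rw [phi_eq_neg_cos_div_cos hθ hpθ (p - 1) (by omega)]
    have e : ((p - 1 : ℕ) : ℝ) = p - 1 := by push_cast [show 1 ≤ p by omega]; ring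
    rw [e, sub_add_cancel, hpθ, cos_pi_div_two]
    simp
  · obtain ⟨i, rfl⟩ := Nat.exists_eq_add_of_le' h1
    obtain ⟨h3, h4⟩ := LE_mem_Ioc hθ hpθ (j := i + 1) (by omega) (by omega)
    rw [LE]
    exact one_div_lt_one_div_of_lt (by linarith) (by linarith)

namespace EvenData

variable {l : ℝ} {p : ℕ}

lemma phi_lt_zero (h : EvenData l p) {j : ℕ} (hj : j + 2 ≤ p) : phi l j < 0 := by
  linarith [h.phi_mono j (p - 2) (by omega) (by have := h.three_le; omega), h.phi_lt]

lemma neg_one_lt_fst (h : EvenData l p) {z : ℝ × ℝ} {j : ℕ} (hj : j + 1 ≤ p)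
    (hz : phi l j ≤ z.1) : -1 < z.1 := by
  linarith [h.phi_mono 0 j (by omega) hj, h.phi_zero, h.l_lt]

lemma mem_OmegaE_iff_of_neg {z : ℝ × ℝ} (hz : z.1 < 0) :
    z ∈ OmegaE l p ↔ ∃ j, 1 ≤ j ∧ j + 1 ≤ p ∧ phi l (j - 1) ≤ z.1 ∧ z.1 < phi l j ∧
      0 ≤ z.2 ∧ z.2 ≤ LE l j := by
  simp only [OmegaE, Set.mem_union, Set.mem_iUnion, Finset.mem_Icc, Set.mem_prod, Set.mem_Ico,
    Set.mem_Icc]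
  constructor
  · rintro (⟨j, ⟨h1, h2⟩, ⟨h3, h4⟩, h5, h6⟩ | ⟨⟨h1, -⟩, -⟩)
    · exact ⟨j, h1, by omega, h3, h4, h5, h6⟩
    · linarith
  · rintro ⟨j, h1, h2, h3, h4, h5, h6⟩
    exact Or.inl ⟨j, ⟨h1, by omega⟩, ⟨h3, h4⟩, h5, h6⟩

lemma fst_neg_of_mem_DE (h : EvenData l p) {z : ℝ × ℝ} (hz : z ∈ DE l p) : z.1 < 0 := by
  by_contra! hneg
  obtain ⟨hΩ, hv, ht⟩ := hz
  have hbound : z.1 < 1 ∧ 0 ≤ z.2 ∧ z.2 ≤ 1 := by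
    simp only [OmegaE, Set.mem_union, Set.mem_iUnion, Finset.mem_Icc, Set.mem_prod, Set.mem_Ico,
      Set.mem_Icc] at hΩ
    rcases hΩ with ⟨j, ⟨h1, h2⟩, ⟨-, h4⟩, -⟩ | ⟨⟨-, h2⟩, h3, h4⟩
    · have := h.three_le
      linarith [h.phi_mono j (p - 1) h2 (by omega), h.phi_last]
    · exact ⟨by linarith [h.l_lt], h3, h4⟩
  obtain ⟨h1, h2, h3⟩ := hbound
  have hpos : 0 < 1 + z.1 * z.2 := by positivity
  rw [abs_of_nonneg hneg, gt_iff_lt, div_lt_div_iff₀ two_pos hpos] at ht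
  rw [gt_iff_lt, div_lt_div_iff₀ two_pos hpos] at hv
  nlinarith [mul_nonneg (sub_nonneg.2 h1.le) (sub_nonneg.2 h3)]

/-- On the left half of `Ω` the two inequalities defining `D` become polynomial. -/
lemma mem_DE_iff_of_mem_OmegaE (h : EvenData l p) {z : ℝ × ℝ} (hz : z.1 < 0)
    (hΩ : z ∈ OmegaE l p) :
    z ∈ DE l p ↔ 1 < z.2 * (2 - z.1) ∧ z.2 * z.1 < -2 * z.1 - 1 := by
  obtain ⟨j, h1, h2, h3, h4, h5, h6⟩ := (mem_OmegaE_iff_of_neg hz).1 hΩ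
  have ht := h.neg_one_lt_fst (by omega) h3
  have hv := h.LE_le j h1 h2
  have hpos : 0 < 1 + z.1 * z.2 := by nlinarith
  simp only [DE, Set.mem_ofPred_eq, hΩ, true_and, abs_of_neg hz, gt_iff_lt,
    div_lt_div_iff₀ two_pos hpos]
  constructor <;> rintro ⟨ha, hb⟩ <;> constructor <;> linarith

lemma mem_DE_iff (h : EvenData l p) {z : ℝ × ℝ} :
    z ∈ DE l p ↔ z.1 < 0 ∧ 1 < z.2 * (2 - z.1) ∧ z.2 * z.1 < -2 * z.1 - 1 ∧
      ∃ j, 1 ≤ j ∧ j + 1 ≤ p ∧ phi l (j - 1) ≤ z.1 ∧ z.1 < phi l j ∧ z.2 ≤ LE l j := by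
  constructor
  · intro hz
    have hneg := h.fst_neg_of_mem_DE hz
    obtain ⟨ha, hb⟩ := (h.mem_DE_iff_of_mem_OmegaE hneg hz.1).1 hz
    obtain ⟨j, h1, h2, h3, h4, -, h6⟩ := (mem_OmegaE_iff_of_neg hneg).1 hz.1
    exact ⟨hneg, ha, hb, j, h1, h2, h3, h4, h6⟩
  · rintro ⟨hneg, ha, hb, j, h1, h2, h3, h4, h6⟩
    have hv : 0 ≤ z.2 := by
      by_contra! hv
      nlinarith
    exact (h.mem_DE_iff_of_mem_OmegaE hneg
      ((mem_OmegaE_iff_of_neg hneg).2 ⟨j, h1, h2, h3, h4, hv, h6⟩)).2 ⟨ha, hb⟩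

lemma DE_eq (h : EvenData l p) :
    DE l p = {z ∈ OmegaE l p |
      z.1 < 0 ∧ z.2 > 1 / (2 - z.1) ∧ z.2 > (2 * |z.1| - 1) / z.1} := by
  ext z
  have key (hneg : z.1 < 0) : (z.2 > 1 / (2 - z.1) ∧ z.2 > (2 * |z.1| - 1) / z.1) ↔
      1 < z.2 * (2 - z.1) ∧ z.2 * z.1 < -2 * z.1 - 1 := by
    rw [gt_iff_lt, gt_iff_lt, div_lt_iff₀ (by linarith), div_lt_iff_of_neg hneg, abs_of_neg hneg,
      mul_neg, neg_mul]
  constructor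
  · intro hz
    have hneg := h.fst_neg_of_mem_DE hz
    exact ⟨hz.1, hneg, (key hneg).2 ((h.mem_DE_iff_of_mem_OmegaE hneg hz.1).1 hz)⟩
  · rintro ⟨hΩ, hneg, hz⟩
    exact (h.mem_DE_iff_of_mem_OmegaE hneg hΩ).2 ((key hneg).1 hz)

/-! ### The two pieces -/

lemma mem_left_iff (h : EvenData l p) {z : ℝ × ℝ} :
    z ∈ {z ∈ DE l p | z.1 ≤ 1 - l} ↔
      -(l / 2) ≤ z.1 ∧ z.1 ≤ 1 - l ∧ 1 < z.2 * (2 - z.1) ∧ z.2 ≤ 1 / (l + 1) := by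
  have hp := h.three_le
  have hl := h.lt_l
  rw [Set.mem_ofPred_eq, h.mem_DE_iff]
  constructor
  · rintro ⟨⟨-, ha, -, j, h1, h2, h3, h4, h6⟩, hle⟩
    obtain rfl : j = 1 := by
      by_contra hj
      linarith [h.phi_mono 1 (j - 1) (by omega) (by omega), h.lt_phi_one]
    rw [h.LE_one] at h6
    exact ⟨by simpa [h.phi_zero] using h3, hle, ha, h6⟩
  · rintro ⟨h1, h2, h3, h4⟩
    have hv : 0 < z.2 := by
      by_contra! hv
      nlinarith
    refine ⟨⟨by linarith, h3, by nlinarith, 1, le_rfl, by omega, ?_, ?_, ?_⟩, h2⟩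
    · simpa [h.phi_zero] using h1
    · linarith [h.lt_phi_one]
    · rwa [h.LE_one]

lemma fst_lt_of_mem_left (h : EvenData l p) {z : ℝ × ℝ}
    (hz : z ∈ {z ∈ DE l p | z.1 ≤ 1 - l}) : z.1 < 1 - l := by
  obtain ⟨-, h2, h3, h4⟩ := h.mem_left_iff.1 hz
  have hl := h.lt_l
  refine lt_of_le_of_ne h2 fun he => ?_
  rw [he, ← div_lt_iff₀ (by linarith), show 2 - (1 - l) = l + 1 by ring] at h3
  linarith

lemma mem_right_iff (h : EvenData l p) {z : ℝ × ℝ} :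
    z ∈ {z ∈ DE l p | z.1 > 1 - l} ↔ z.1 < 0 ∧ 1 < z.2 * (2 - z.1) ∧ z.2 * z.1 < -2 * z.1 - 1 ∧
      ∃ j, 2 ≤ j ∧ j + 1 ≤ p ∧ phi l (j - 1) ≤ z.1 ∧ z.1 < phi l j ∧ z.2 ≤ LE l j := by
  have hl := h.lt_l
  rw [Set.mem_ofPred_eq, h.mem_DE_iff]
  constructor
  · rintro ⟨⟨hneg, ha, hb, j, h1, h2, h3, h4, h6⟩, hlt⟩
    refine ⟨hneg, ha, hb, j, ?_, h2, h3, h4, h6⟩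
    by_contra hj
    obtain rfl : j = 1 := by omega
    rw [h.LE_one, le_div_iff₀ (by linarith)] at h6
    have hv : 0 < z.2 := by
      by_contra! hv
      nlinarith
    nlinarith
  · rintro ⟨hneg, ha, hb, j, h1, h2, h3, h4, h6⟩
    refine ⟨⟨hneg, ha, hb, j, by omega, h2, h3, h4, h6⟩, ?_⟩
    linarith [h.phi_mono 1 (j - 1) (by omega) (by omega), h.lt_phi_one]

lemma left_base_mem (h : EvenData l p) :
    (-(l / 2), 1 / (l + 1)) ∈ {z ∈ DE l p | z.1 ≤ 1 - l} := by
  have hl := h.lt_l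
  have hl2 := h.l_lt
  rw [h.mem_left_iff]
  refine ⟨le_rfl, by linarith, ?_, le_rfl⟩
  rw [one_div, ← div_eq_inv_mul, lt_div_iff₀ (by linarith)]
  linarith

/-- The segment at height `1/2` from `φ_1` to `φ_{p-2}` lies in the right piece. -/
lemma half_mem_right (h : EvenData l p) {t : ℝ} (h1 : phi l 1 ≤ t) (h2 : t ≤ phi l (p - 2)) :
    (t, 1 / 2) ∈ {z ∈ DE l p | z.1 > 1 - l} := by
  have hp := h.three_le
  have hlt := h.phi_lt
  have hex : ∃ j, t < phi l j := ⟨p - 1, by rw [h.phi_last]; linarith⟩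
  have hle : Nat.find hex ≤ p - 1 := Nat.find_min' hex (by rw [h.phi_last]; linarith)
  have hspec := Nat.find_spec hex
  have hge : 2 ≤ Nat.find hex := by
    by_contra hlt2
    linarith [h.phi_mono (Nat.find hex) 1 (by omega) (by omega)]
  rw [h.mem_right_iff]
  refine ⟨by dsimp; linarith, by dsimp; linarith, by dsimp; linarith, Nat.find hex, hge, by omega,
    ?_, hspec, (h.lt_LE _ hge (by omega)).le⟩
  exact not_lt.1 (Nat.find_min hex (by omega))

lemma isPreconnected_left (h : EvenData l p) :
    IsPreconnected {z ∈ DE l p | z.1 ≤ 1 - l} := by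
  have hl := h.lt_l
  apply isPreconnected_of_forall (-(l / 2), 1 / (l + 1))
  rintro ⟨t, v⟩ hz
  obtain ⟨h1, h2, h3, h4⟩ := h.mem_left_iff.1 hz
  dsimp only at h1 h2 h3 h4
  have hv : 0 < v := by
    by_contra! hv
    nlinarith
  refine ⟨Set.Icc (-(l / 2)) t ×ˢ {v} ∪ {-(l / 2)} ×ˢ Set.Icc v (1 / (l + 1)), ?_,
    Or.inr ⟨rfl, h4, le_rfl⟩, Or.inl ⟨⟨h1, le_rfl⟩, rfl⟩, ?_⟩
  · rintro ⟨s, w⟩ (⟨⟨hs1, hs2⟩, hw⟩ | ⟨hs, hw1, hw2⟩)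
    · obtain rfl : w = v := hw
      dsimp only at hs1 hs2
      exact h.mem_left_iff.2 ⟨hs1, hs2.trans h2, by dsimp; nlinarith, h4⟩
    · obtain rfl : s = -(l / 2) := hs
      dsimp only at hw1 hw2
      exact h.mem_left_iff.2 ⟨le_rfl, h1.trans h2, by dsimp; nlinarith, hw2⟩
  · exact IsPreconnected.union (-(l / 2), v) ⟨⟨le_rfl, h1⟩, rfl⟩ ⟨rfl, le_rfl, h4⟩
      (isPreconnected_Icc.prod isPreconnected_singleton)
      (isPreconnected_singleton.prod isPreconnected_Icc)

/-- A point of the right piece can be moved horizontally to the left, up to abscissa `φ_{p-2}`,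
and then vertically to height `1/2`. -/
lemma isPreconnected_right (h : EvenData l p) :
    IsPreconnected {z ∈ DE l p | z.1 > 1 - l} := by
  have hp := h.three_le
  have hlt := h.phi_lt
  apply isPreconnected_of_forall (phi l 1, 1 / 2)
  rintro ⟨t, v⟩ hz
  obtain ⟨hneg, ha, hb, j, h1, h2, h3, h4, h5⟩ := h.mem_right_iff.1 hz
  dsimp only at hneg ha hb h3 h4 h5
  have hv : 0 < v := by
    by_contra! hv
    nlinarith
  obtain ⟨s, hst, hs1, hs2, hsj, hsj'⟩ : ∃ s ≤ t, phi l 1 ≤ s ∧ s ≤ phi l (p - 2) ∧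
      phi l (j - 1) ≤ s ∧ ∀ r, s ≤ r → r ≤ t → phi l (j - 1) ≤ r ∧ r < phi l j := by
    have hj1 := h.phi_mono 1 (j - 1) (by omega) (by omega)
    rcases le_total t (phi l (p - 2)) with ht | ht
    · exact ⟨t, le_rfl, hj1.trans h3, ht, h3, fun r hr1 hr2 =>
        ⟨h3.trans hr1, hr2.trans_lt h4⟩⟩
    · have hjp : j = p - 1 := by
        by_contra hj
        linarith [h.phi_mono j (p - 2) (by omega) (by omega)]
      have e : j - 1 = p - 2 := by omega
      rw [e] at hj1 ⊢
      exact ⟨_, ht, hj1, le_rfl, le_rfl, fun r hr1 hr2 => ⟨hr1, hr2.trans_lt h4⟩⟩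
  have hsub1 : Set.Icc s t ×ˢ {v} ⊆ {z ∈ DE l p | z.1 > 1 - l} := by
    rintro ⟨r, w⟩ ⟨⟨hr1, hr2⟩, hw⟩
    obtain rfl : w = v := hw
    dsimp only at hr1 hr2
    obtain ⟨h6, h7⟩ := hsj' r hr1 hr2
    exact h.mem_right_iff.2 ⟨by dsimp; linarith, by dsimp; nlinarith, by dsimp; nlinarith, j, h1, h2,
      h6, h7, h5⟩
  have hsub2 : {s} ×ˢ Set.uIcc v (1 / 2) ⊆ {z ∈ DE l p | z.1 > 1 - l} := by
    rintro ⟨r, w⟩ ⟨hr, hw⟩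
    obtain rfl : r = s := hr
    dsimp only at hw
    obtain ⟨h6, h7⟩ := hsj' r le_rfl hst
    have hwL : w ≤ LE l j := (Set.mem_Icc.1 hw).2.trans (max_le h5 (h.lt_LE j h1 h2).le)
    have hw2 : 1 < w * (2 - r) := by
      rcases min_le_iff.1 (Set.mem_Icc.1 hw).1 with hw | hw <;> nlinarith
    have hw0 : 0 < w := lt_of_lt_of_le (lt_min hv (by norm_num)) (Set.mem_Icc.1 hw).1
    exact h.mem_right_iff.2 ⟨by dsimp; linarith, hw2, by dsimp; nlinarith, j, h1, h2, h6, h7, hwL⟩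
  have hsub3 : Set.Icc (phi l 1) s ×ˢ {1 / 2} ⊆ {z ∈ DE l p | z.1 > 1 - l} := by
    rintro ⟨r, w⟩ ⟨⟨hr1, hr2⟩, hw⟩
    obtain rfl : w = 1 / 2 := hw
    exact h.half_mem_right hr1 (hr2.trans hs2)
  refine ⟨Set.Icc s t ×ˢ {v} ∪ ({s} ×ˢ Set.uIcc v (1 / 2) ∪ Set.Icc (phi l 1) s ×ˢ {1 / 2}),
    Set.union_subset hsub1 (Set.union_subset hsub2 hsub3), Or.inr (Or.inr ⟨⟨le_rfl, hs1⟩, rfl⟩),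
    Or.inl ⟨⟨hst, le_rfl⟩, rfl⟩, ?_⟩
  refine IsPreconnected.union (s, v) ⟨⟨le_rfl, hst⟩, rfl⟩ (Or.inl ⟨rfl, Set.left_mem_uIcc⟩)
    (isPreconnected_Icc.prod isPreconnected_singleton) ?_
  exact IsPreconnected.union (s, 1 / 2) ⟨rfl, Set.right_mem_uIcc⟩ ⟨⟨hs1, le_rfl⟩, rfl⟩
    (isPreconnected_singleton.prod isPreconnected_uIcc)
    (isPreconnected_Icc.prod isPreconnected_singleton)

end EvenData

/-- If `A ⊆ S` is preconnected and `A`, `S \ A` lie in disjoint open sets, then `A` is the connected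
component in `S` of each of its points. -/
lemma connectedComponentIn_eq_of_separated {X : Type*} [TopologicalSpace X] {S A U V : Set X}
    (hA : IsPreconnected A) (hAS : A ⊆ S) (hU : IsOpen U) (hV : IsOpen V) (hUV : Disjoint U V)
    (hSUV : S ⊆ U ∪ V) (hSU : S ∩ U ⊆ A) (hAU : A ⊆ U) {z : X} (hz : z ∈ A) :
    connectedComponentIn S z = A := by
  apply Set.Subset.antisymm _ (hA.subset_connectedComponentIn hz hAS)
  have hsub : connectedComponentIn S z ⊆ U :=
    isPreconnected_connectedComponentIn.subset_left_of_subset_union hU hV hUV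
      ((connectedComponentIn_subset S z).trans hSUV)
      ⟨z, mem_connectedComponentIn (hAS hz), hAU hz⟩
  exact fun w hw => hSU ⟨connectedComponentIn_subset S z hw, hsub hw⟩

/-- shape of `D` and its two connected components (even case). -/
theorem D_two_components_even (q p : ℕ) (hp : 3 ≤ p) (hq : q = 2 * p) :
    DE (lam q) p =
      {z ∈ OmegaE (lam q) p |
        z.1 < 0 ∧ z.2 > 1 / (2 - z.1) ∧ z.2 > (2 * |z.1| - 1) / z.1} ∧
    ({z ∈ DE (lam q) p | z.1 ≤ 1 - lam q}).Nonempty ∧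
    ({z ∈ DE (lam q) p | z.1 > 1 - lam q}).Nonempty ∧
    (∀ z ∈ {z ∈ DE (lam q) p | z.1 ≤ 1 - lam q},
        connectedComponentIn (DE (lam q) p) z = {z ∈ DE (lam q) p | z.1 ≤ 1 - lam q}) ∧
    (∀ z ∈ {z ∈ DE (lam q) p | z.1 > 1 - lam q},
        connectedComponentIn (DE (lam q) p) z = {z ∈ DE (lam q) p | z.1 > 1 - lam q}) := by
  have h := evenData_lam hp hq
  have hlt : IsOpen {z : ℝ × ℝ | z.1 < 1 - lam q} := isOpen_lt continuous_fst continuous_const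
  have hgt : IsOpen {z : ℝ × ℝ | 1 - lam q < z.1} := isOpen_lt continuous_const continuous_fst
  have hdisj : Disjoint {z : ℝ × ℝ | z.1 < 1 - lam q} {z : ℝ × ℝ | 1 - lam q < z.1} :=
    Set.disjoint_left.2 fun z (h1 : z.1 < _) (h2 : _ < z.1) => lt_asymm h1 h2
  have hcover : DE (lam q) p ⊆ {z | z.1 < 1 - lam q} ∪ {z | 1 - lam q < z.1} := fun z hz =>
    (le_or_gt z.1 (1 - lam q)).imp (fun hle => h.fst_lt_of_mem_left ⟨hz, hle⟩) id
  refine ⟨h.DE_eq, ⟨_, h.left_base_mem⟩,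
    ⟨_, h.half_mem_right le_rfl (h.phi_mono 1 (p - 2) (by omega) (by omega))⟩,
    fun z hz => ?_, fun z hz => ?_⟩
  · exact connectedComponentIn_eq_of_separated h.isPreconnected_left (fun _ hw => hw.1) hlt hgt hdisj
      hcover (fun _ hw => ⟨hw.1, le_of_lt hw.2⟩) (fun _ hw => h.fst_lt_of_mem_left hw) hz
  · exact connectedComponentIn_eq_of_separated h.isPreconnected_right (fun _ hw => hw.1) hgt hlt
      hdisj.symm (Set.union_comm _ _ ▸ hcover) (fun _ hw => hw) (fun _ hw => hw.2) hz

end RosenTong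
end
end
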